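/- arXiv:2512.18688 — 3 statements merged into one kernel-verified Lean document; each statement's English description precedes it below -/
import Mathlib

section
/- Let 0 < s < 1, p ≥ q ≥ 1, d ≥ 1, and suppose α < sq − (1 − q/p)d, β < sp, α > −d, β > −d, and α + qβ/p > −d. Then for every u ∈ C_c^1(ℝ^d), the weighted Triebel–Lizorkin seminorm ∫_{ℝ^d} ( ∫_{ℝ^d} |u(x)−u(y)|^p |x−y|^{−d−sp} |y|^β dy )^{q/p} |x|^α dx is finite. -/
open MeasureTheory Set
open scoped ENNReal

noncomputable section

/-- truncated power weight -/
def powBall {d : ℕ} (r M : ℝ) (z : EuclideanSpace ℝ (Fin d)) : ℝ≥0∞ :=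
  (Metric.ball 0 M).indicator (fun z => ENNReal.ofReal (‖z‖ ^ r)) z

lemma powBall_measurable {d : ℕ} (r M : ℝ) :
    Measurable (powBall (d := d) r M) := by
  unfold powBall
  exact Measurable.indicator (by fun_prop) measurableSet_ball

lemma powBall_lt_top {d : ℕ} (hd : 1 ≤ d) {r : ℝ} (hr : -(d : ℝ) < r) (M : ℝ) :
    ∫⁻ z, powBall (d := d) r M z < ⊤ := by
  unfold powBall
  rw [lintegral_indicator measurableSet_ball]
  apply IntegrableOn.setLIntegral_lt_top
  refine integrableOn_ball_of_norm_le_rpow (C := 1) (α := -r) (by simpa using hd)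
    (by simp; linarith) ?_ (Measurable.aestronglyMeasurable (by fun_prop))
  refine Filter.Eventually.of_forall fun x => ?_
  simp [abs_of_nonneg (Real.rpow_nonneg (norm_nonneg x) r)]

lemma powBall_eq {d : ℕ} (r : ℝ) {M : ℝ} {z : EuclideanSpace ℝ (Fin d)} (h : ‖z‖ < M) :
    powBall r M z = ENNReal.ofReal (‖z‖ ^ r) := by
  unfold powBall
  rw [indicator_of_mem]
  simpa using h

lemma one_add_lt_top {d : ℕ} {r : ℝ} (hr : r < -(d : ℝ)) :
    ∫⁻ z : EuclideanSpace ℝ (Fin d), ENNReal.ofReal ((1 + ‖z‖) ^ r) < ⊤ := by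
  have := finite_integral_one_add_norm (E := EuclideanSpace ℝ (Fin d)) (μ := volume) (r := -r)
    (by simp; linarith)
  simpa using this

lemma rpow_le_one_add {t r : ℝ} (ht : 1 ≤ t) (hr : r ≤ 0) :
    t ^ r ≤ 2 ^ (-r) * (1 + t) ^ r := by
  have h1 : t ^ r ≤ ((1 + t) / 2) ^ r :=
    Real.rpow_le_rpow_of_nonpos (by linarith) (by linarith) hr
  refine h1.trans (le_of_eq ?_)
  rw [Real.div_rpow (by linarith) (by norm_num), Real.rpow_neg (by norm_num)]
  field_simp

lemma half_rpow_le {a e r : ℝ} (ha : 0 < a) (he : 0 < e) (h : a ≤ 2 * e) (hr : r ≤ 0) :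
    e ^ r ≤ 2 ^ (-r) * a ^ r := by
  have h1 : e ^ r ≤ (a / 2) ^ r :=
    Real.rpow_le_rpow_of_nonpos (by linarith) (by linarith) hr
  refine h1.trans (le_of_eq ?_)
  rw [Real.div_rpow (by linarith) (by norm_num), Real.rpow_neg (by norm_num)]
  field_simp

lemma pt1 (β γ M : ℝ) (hM : 0 < M) : ∃ C : ℝ, 0 ≤ C ∧ ∀ a c e : ℝ, 0 < a → 0 < c → 0 < e →
    c ≤ M → e ≤ M → a ≤ c + e →
    c ^ γ * e ^ β ≤ C * a ^ (min β 0) * (c ^ γ + e ^ γ + e ^ β) := by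
  rcases le_or_gt 0 β with hb | hb
  · refine ⟨M ^ β, by positivity, fun a c e ha hc he hcM heM _ => ?_⟩
    rw [min_eq_right hb, Real.rpow_zero, mul_one]
    have h1 : e ^ β ≤ M ^ β := Real.rpow_le_rpow he.le heM hb
    have : 0 < c ^ γ := by positivity
    have : 0 < e ^ γ := by positivity
    have : 0 < e ^ β := by positivity
    have : 0 < M ^ β := by positivity
    calc c ^ γ * e ^ β ≤ c ^ γ * M ^ β := by gcongr
      _ = M ^ β * (c ^ γ) := by ring
      _ ≤ _ := by gcongr; linarith
  · refine ⟨2 ^ (-β) * (1 + M ^ (γ - β)), by positivity, fun a c e ha hc he hcM heM hace => ?_⟩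
    rw [min_eq_left hb.le]
    have hcg : 0 < c ^ γ := by positivity
    have heg : 0 < e ^ γ := by positivity
    have heb : 0 < e ^ β := by positivity
    have hMg : 0 < M ^ (γ - β) := by positivity
    have hab : 0 < 2 ^ (-β) * a ^ β := by positivity
    have key : c ^ γ * e ^ β ≤ 2 ^ (-β) * a ^ β * (c ^ γ + e ^ γ + M ^ (γ - β) * e ^ β) := by
      rcases le_total c e with h | h
      · have h1 := half_rpow_le ha he (by linarith) hb.le
        calc c ^ γ * e ^ β ≤ c ^ γ * (2 ^ (-β) * a ^ β) := by gcongr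
          _ = 2 ^ (-β) * a ^ β * c ^ γ := by ring
          _ ≤ _ := by
            gcongr
            have : 0 < M ^ (γ - β) * e ^ β := by positivity
            linarith
      · have h1 := half_rpow_le ha hc (by linarith) hb.le
        have h2 : c ^ (γ - β) * e ^ β ≤ c ^ γ + e ^ γ + M ^ (γ - β) * e ^ β := by
          rcases le_total (γ - β) 0 with hg | hg
          · have h3 : c ^ (γ - β) ≤ e ^ (γ - β) := Real.rpow_le_rpow_of_nonpos he h hg
            have h4 : c ^ (γ - β) * e ^ β ≤ e ^ (γ - β) * e ^ β := by gcongr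
            rw [← Real.rpow_add he (γ - β), sub_add_cancel] at h4
            have : 0 < M ^ (γ - β) * e ^ β := by positivity
            linarith
          · have h3 : c ^ (γ - β) ≤ M ^ (γ - β) := Real.rpow_le_rpow hc.le hcM hg
            have h4 : c ^ (γ - β) * e ^ β ≤ M ^ (γ - β) * e ^ β := by gcongr
            linarith
        calc c ^ γ * e ^ β = c ^ β * (c ^ (γ - β) * e ^ β) := by
              rw [← mul_assoc, ← Real.rpow_add hc]; congr 2; ring
          _ ≤ (2 ^ (-β) * a ^ β) * (c ^ (γ - β) * e ^ β) := by gcongr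
          _ ≤ _ := by gcongr
    refine key.trans ?_
    have : 2 ^ (-β) * (1 + M ^ (γ - β)) * a ^ β * (c ^ γ + e ^ γ + e ^ β)
      = 2 ^ (-β) * a ^ β * ((1 + M ^ (γ - β)) * (c ^ γ + e ^ γ + e ^ β)) := by ring
    rw [this]
    gcongr
    nlinarith [mul_pos hMg hcg, mul_pos hMg heg]

section
variable {d : ℕ} {s p β : ℝ} {u : EuclideanSpace ℝ (Fin d) → ℝ}

lemma ae_ne (hd : 1 ≤ d) (x : EuclideanSpace ℝ (Fin d)) :
    ∀ᵐ y : EuclideanSpace ℝ (Fin d), y ≠ x := by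
  haveI : Nonempty (Fin d) := ⟨⟨0, hd⟩⟩
  have : volume ({x} : Set (EuclideanSpace ℝ (Fin d))) = 0 := measure_singleton x
  filter_upwards [compl_mem_ae_iff.mpr this] with y hy using hy

/-- far bound -/
lemma far_bound (hd : 1 ≤ d) (hs : 0 < s) (hp : 1 ≤ p) (hβ' : -(d : ℝ) < β) {R N : ℝ} (hR : 1 ≤ R)
    (hN : ∀ x, |u x| ≤ N) (huR : ∀ x, R ≤ ‖x‖ → u x = 0) :
    ∃ K : ℝ≥0∞, K < ⊤ ∧ ∀ x : EuclideanSpace ℝ (Fin d), 2 * R ≤ ‖x‖ →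
      (∫⁻ y, ENNReal.ofReal
          (|u x - u y| ^ p * ‖x - y‖ ^ (-(d : ℝ) - s * p) * ‖y‖ ^ β)) ≤
      K * ENNReal.ofReal (‖x‖ ^ (-(d : ℝ) - s * p)) := by
  have hN0 : 0 ≤ N := (abs_nonneg _).trans (hN 0)
  set m : ℝ := -(d : ℝ) - s * p with hm
  have hm0 : m ≤ 0 := by
    have : 0 < s * p := by positivity
    have : (0 : ℝ) ≤ d := by positivity
    linarith
  refine ⟨ENNReal.ofReal (N ^ p * 2 ^ (-m)) * ∫⁻ z, powBall (d := d) β R z,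
    ENNReal.mul_lt_top ENNReal.ofReal_lt_top (powBall_lt_top hd hβ' R), fun x hx => ?_⟩
  have hle : ∀ y, ENNReal.ofReal (|u x - u y| ^ p * ‖x - y‖ ^ m * ‖y‖ ^ β) ≤
      ENNReal.ofReal (N ^ p * 2 ^ (-m)) * ENNReal.ofReal (‖x‖ ^ m) * powBall β R y := by
    intro y
    rcases lt_or_ge ‖y‖ R with hy | hy
    · rw [powBall_eq _ hy, ← ENNReal.ofReal_mul (by positivity), ← ENNReal.ofReal_mul (by positivity)]
      apply ENNReal.ofReal_le_ofReal
      rw [huR x (by linarith), zero_sub, abs_neg, mul_assoc (N ^ p)]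
      have h1 : ‖x‖ - ‖y‖ ≤ ‖x - y‖ := norm_sub_norm_le x y
      have h2 := half_rpow_le (a := ‖x‖) (e := ‖x - y‖) (by linarith) (by linarith) (by linarith) hm0
      have h3 : |u y| ^ p ≤ N ^ p := Real.rpow_le_rpow (abs_nonneg _) (hN y) (by linarith)
      gcongr
    · rw [huR x (by linarith), huR y hy]
      simp [Real.zero_rpow (by linarith : p ≠ 0)]
  calc _ ≤ ∫⁻ y, ENNReal.ofReal (N ^ p * 2 ^ (-m)) * ENNReal.ofReal (‖x‖ ^ m) * powBall β R y :=
        lintegral_mono hle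
    _ = _ := by
        rw [lintegral_const_mul _ (powBall_measurable _ _)]
        ring

lemma near_bound (hd : 1 ≤ d) (hs : 0 < s) (hs1 : s < 1) (hp : 1 ≤ p)
    (hβ : β < s * p) (hβ' : -(d : ℝ) < β) {R N L : ℝ} (hR : 1 ≤ R)
    (hN : ∀ x, |u x| ≤ N) (huR : ∀ x, R ≤ ‖x‖ → u x = 0)
    (hL0 : 0 ≤ L) (hL : ∀ x y, |u x - u y| ≤ L * ‖x - y‖) :
    ∃ K : ℝ≥0∞, K < ⊤ ∧ ∀ x : EuclideanSpace ℝ (Fin d), x ≠ 0 → ‖x‖ < 2 * R →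
      (∫⁻ y, ENNReal.ofReal
          (|u x - u y| ^ p * ‖x - y‖ ^ (-(d : ℝ) - s * p) * ‖y‖ ^ β)) ≤
      K * ENNReal.ofReal (‖x‖ ^ (min β 0)) := by
  have hN0 : 0 ≤ N := (abs_nonneg _).trans (hN 0)
  set m : ℝ := -(d : ℝ) - s * p with hm
  have hsp : 0 < s * p := by positivity
  have hm0 : m ≤ 0 := by
    have : (0 : ℝ) ≤ d := by positivity
    linarith
  set γ : ℝ := p + m with hγ
  have hγd : -(d : ℝ) < γ := by nlinarith
  set b : ℝ := min β 0 with hb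
  have hb0 : b ≤ 0 := min_le_right _ _
  obtain ⟨C, hC0, hC⟩ := pt1 β γ (6 * R) (by linarith)
  set D : ℝ := N ^ p * (2 ^ (-m) * 2 ^ (-(m + β))) * (2 * R) ^ (-b) with hD
  have hD0 : 0 ≤ D := by positivity
  set G : ℝ≥0∞ := ENNReal.ofReal (L ^ p * C)
  set H : ℝ≥0∞ := ENNReal.ofReal D
  set I1 := ∫⁻ z, powBall (d := d) γ (6 * R) z
  set I2 := ∫⁻ z, powBall (d := d) β (6 * R) z
  set I3 := ∫⁻ z : EuclideanSpace ℝ (Fin d), ENNReal.ofReal ((1 + ‖z‖) ^ (m + β))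
  have hI1 : I1 < ⊤ := powBall_lt_top hd hγd _
  have hI2 : I2 < ⊤ := powBall_lt_top hd hβ' _
  have hI3 : I3 < ⊤ := one_add_lt_top (by linarith)
  refine ⟨G * (I1 + I1 + I2) + H * I3, ?_, fun x hx0 hx => ?_⟩
  · have h1 : G < ⊤ := ENNReal.ofReal_lt_top
    have h2 : H < ⊤ := ENNReal.ofReal_lt_top
    exact ENNReal.add_lt_top.2 ⟨ENNReal.mul_lt_top h1 (by simp [hI1, hI2]), ENNReal.mul_lt_top h2 hI3⟩
  have hx0' : 0 < ‖x‖ := norm_pos_iff.2 hx0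
  have hle : ∀ y, y ≠ 0 → y ≠ x → ENNReal.ofReal (|u x - u y| ^ p * ‖x - y‖ ^ m * ‖y‖ ^ β) ≤
      ENNReal.ofReal (‖x‖ ^ b) * (G * (powBall γ (6 * R) (x - y) + powBall γ (6 * R) y
        + powBall β (6 * R) y) + H * ENNReal.ofReal ((1 + ‖y‖) ^ (m + β))) := by
    intro y hy0 hyx
    have hy0' : 0 < ‖y‖ := norm_pos_iff.2 hy0
    have hxy : 0 < ‖x - y‖ := norm_pos_iff.2 (sub_ne_zero.2 hyx.symm)
    rcases lt_or_ge ‖y‖ (4 * R) with hy | hy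
    · refine le_trans ?_ (mul_le_mul_right le_self_add _)
      have h6 : ‖x - y‖ < 6 * R := (norm_sub_le x y).trans_lt (by linarith)
      rw [powBall_eq _ h6, powBall_eq _ (by linarith : ‖y‖ < 6 * R),
        powBall_eq _ (by linarith : ‖y‖ < 6 * R), ← ENNReal.ofReal_add (by positivity) (by positivity),
        ← ENNReal.ofReal_add (by positivity) (by positivity), ← ENNReal.ofReal_mul (by positivity),
        ← ENNReal.ofReal_mul (by positivity)]
      apply ENNReal.ofReal_le_ofReal
      have h1 := hC ‖x‖ ‖x - y‖ ‖y‖ hx0' hxy hy0' h6.le (by linarith)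
        (by simpa using norm_add_le (x - y) y)
      have h2 : |u x - u y| ^ p ≤ L ^ p * ‖x - y‖ ^ p := by
        rw [← Real.mul_rpow hL0 hxy.le]
        exact Real.rpow_le_rpow (abs_nonneg _) (hL x y) (by linarith)
      calc _ ≤ (L ^ p * ‖x - y‖ ^ p) * ‖x - y‖ ^ m * ‖y‖ ^ β := by gcongr
        _ = L ^ p * (‖x - y‖ ^ γ * ‖y‖ ^ β) := by rw [hγ, Real.rpow_add hxy]; ring
        _ ≤ L ^ p * (C * ‖x‖ ^ b * (‖x - y‖ ^ γ + ‖y‖ ^ γ + ‖y‖ ^ β)) :=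
          mul_le_mul_of_nonneg_left h1 (by positivity)
        _ = _ := by ring
    · refine le_trans ?_ (mul_le_mul_right le_add_self _)
      rw [← ENNReal.ofReal_mul (by positivity), ← ENNReal.ofReal_mul (by positivity)]
      apply ENNReal.ofReal_le_ofReal
      rw [huR y (by linarith), sub_zero]
      have h1 : ‖y‖ - ‖x‖ ≤ ‖x - y‖ := by rw [norm_sub_rev]; exact norm_sub_norm_le y x
      have h2 := half_rpow_le (a := ‖y‖) (e := ‖x - y‖) (by linarith) (by linarith) (by linarith) hm0
      have h3 : |u x| ^ p ≤ N ^ p := Real.rpow_le_rpow (abs_nonneg _) (hN x) (by linarith)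
      have h4 : ‖y‖ ^ (m + β) ≤ 2 ^ (-(m + β)) * (1 + ‖y‖) ^ (m + β) :=
        rpow_le_one_add (by linarith) (by
          have : (0 : ℝ) ≤ d := by positivity
          linarith)
      have h5 : 1 ≤ ‖x‖ ^ b * (2 * R) ^ (-b) := by
        have : (2 * R) ^ b ≤ ‖x‖ ^ b := Real.rpow_le_rpow_of_nonpos hx0' hx.le hb0
        rw [Real.rpow_neg (by linarith), ← div_eq_mul_inv, one_le_div (by positivity)]
        exact this
      calc _ ≤ N ^ p * (2 ^ (-m) * ‖y‖ ^ m) * ‖y‖ ^ β := by gcongr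
        _ = N ^ p * 2 ^ (-m) * (‖y‖ ^ (m + β)) := by rw [Real.rpow_add hy0']; ring
        _ ≤ N ^ p * 2 ^ (-m) * (2 ^ (-(m + β)) * (1 + ‖y‖) ^ (m + β)) := by gcongr
        _ = 1 * (N ^ p * 2 ^ (-m) * (2 ^ (-(m + β)) * (1 + ‖y‖) ^ (m + β))) := by ring
        _ ≤ (‖x‖ ^ b * (2 * R) ^ (-b)) *
            (N ^ p * 2 ^ (-m) * (2 ^ (-(m + β)) * (1 + ‖y‖) ^ (m + β))) := by gcongr
        _ = _ := by rw [hD]; ring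
  have mγ : Measurable (powBall (d := d) γ (6 * R)) := powBall_measurable _ _
  have mβ : Measurable (powBall (d := d) β (6 * R)) := powBall_measurable _ _
  have mγx : Measurable (fun y => powBall (d := d) γ (6 * R) (x - y)) :=
    mγ.comp (by fun_prop)
  calc _ ≤ ∫⁻ y, ENNReal.ofReal (‖x‖ ^ b) * (G * (powBall γ (6 * R) (x - y) + powBall γ (6 * R) y
        + powBall β (6 * R) y) + H * ENNReal.ofReal ((1 + ‖y‖) ^ (m + β))) := by
        apply lintegral_mono_ae
        filter_upwards [ae_ne hd 0, ae_ne hd x] with y h1 h2 using hle y h1 h2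
    _ = _ := by
        rw [lintegral_const_mul _ (by fun_prop), lintegral_add_left (by fun_prop),
          lintegral_const_mul _ (by fun_prop), lintegral_const_mul _ (by fun_prop),
          lintegral_add_left (by fun_prop), lintegral_add_left (by fun_prop),
          lintegral_sub_left_eq_self (powBall (d := d) γ (6 * R)) x, mul_comm]

end

theorem TriebelLizorkin_seminorm_finite (d : ℕ) (hd : 1 ≤ d) (s p q α β : ℝ)
    (hs : 0 < s) (hs1 : s < 1) (hq : 1 ≤ q) (hpq : q ≤ p)
    (hα : α < s * q - (1 - q / p) * d) (hβ : β < s * p)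
    (hα' : -(d : ℝ) < α) (hβ' : -(d : ℝ) < β) (hαβ : -(d : ℝ) < α + q * β / p)
    (u : EuclideanSpace ℝ (Fin d) → ℝ)
    (hu : ContDiff ℝ 1 u) (hsupp : HasCompactSupport u) :
    (∫⁻ x, (∫⁻ y, ENNReal.ofReal
          (|u x - u y| ^ p * ‖x - y‖ ^ (-(d : ℝ) - s * p) * ‖y‖ ^ β)) ^ (q / p)
        * ENNReal.ofReal (‖x‖ ^ α)) < ⊤ := by
  have hp : 1 ≤ p := hq.trans hpq
  have hp0 : 0 < p := by linarith
  have hq0 : 0 < q := by linarith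
  have hqp : 0 ≤ q / p := by positivity
  obtain ⟨L, hL⟩ := ContDiff.lipschitzWith_of_hasCompactSupport hsupp hu one_ne_zero
  obtain ⟨N, hN⟩ := hsupp.exists_bound_of_continuous hu.continuous
  obtain ⟨R0, hR0⟩ := hsupp.isCompact.isBounded.exists_norm_le
  set R : ℝ := max 1 (R0 + 1) with hRdef
  have hR : 1 ≤ R := le_max_left _ _
  have hR1 : R0 + 1 ≤ R := le_max_right _ _
  have huR : ∀ x, R ≤ ‖x‖ → u x = 0 := by
    intro x hx
    by_contra h
    have := hR0 x (subset_tsupport _ h)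
    linarith
  have hL' : ∀ x y, |u x - u y| ≤ L * ‖x - y‖ := by
    intro x y
    have := hL.dist_le_mul x y
    rwa [Real.dist_eq, dist_eq_norm] at this
  obtain ⟨K1, hK1, h1⟩ := far_bound hd hs hp hβ' hR hN huR
  obtain ⟨K2, hK2, h2⟩ := near_bound hd hs hs1 hp hβ hβ' hR hN huR L.2 hL'
  set e1 : ℝ := (-(d : ℝ) - s * p) * (q / p) + α with he1
  set e2 : ℝ := min β 0 * (q / p) + α with he2
  have he1' : e1 < -(d : ℝ) := by
    have : (-(d : ℝ) - s * p) * (q / p) = -(q / p) * d - s * q := by field_simp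
    rw [he1, this]
    linarith
  have hd0 : (0 : ℝ) ≤ d := by positivity
  have he2' : -(d : ℝ) < e2 := by
    rw [he2]
    rcases min_choice β 0 with h | h
    · rw [h]
      have : β * (q / p) = q * β / p := by ring
      linarith
    · rw [h]; linarith
  have comb : ∀ (x : EuclideanSpace ℝ (Fin d)) (F K : ℝ≥0∞) (r : ℝ), x ≠ 0 →
      F ≤ K * ENNReal.ofReal (‖x‖ ^ r) →
      F ^ (q / p) * ENNReal.ofReal (‖x‖ ^ α) ≤
        K ^ (q / p) * ENNReal.ofReal (‖x‖ ^ (r * (q / p) + α)) := by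
    intro x F K r hx hF
    have hx' : 0 < ‖x‖ := norm_pos_iff.2 hx
    calc _ ≤ (K * ENNReal.ofReal (‖x‖ ^ r)) ^ (q / p) * ENNReal.ofReal (‖x‖ ^ α) := by gcongr
      _ = _ := by
        rw [ENNReal.mul_rpow_of_nonneg _ _ hqp, ENNReal.ofReal_rpow_of_nonneg (by positivity) hqp,
          ← Real.rpow_mul hx'.le, mul_assoc, ← ENNReal.ofReal_mul (by positivity),
          ← Real.rpow_add hx']
  have hK1' : K1 ^ (q / p) < ⊤ := ENNReal.rpow_lt_top_of_nonneg hqp hK1.ne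
  have hK2' : K2 ^ (q / p) < ⊤ := ENNReal.rpow_lt_top_of_nonneg hqp hK2.ne
  have mb : Measurable (powBall (d := d) e2 (2 * R)) := powBall_measurable _ _
  calc _ ≤ ∫⁻ x : EuclideanSpace ℝ (Fin d), (K2 ^ (q / p) * powBall e2 (2 * R) x +
        K1 ^ (q / p) * ENNReal.ofReal (2 ^ (-e1)) * ENNReal.ofReal ((1 + ‖x‖) ^ e1)) := by
        apply lintegral_mono_ae
        filter_upwards [ae_ne hd 0] with x hx
        rcases lt_or_ge ‖x‖ (2 * R) with hxR | hxR
        · refine le_trans ?_ le_self_add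
          rw [powBall_eq _ hxR]
          exact comb x _ _ _ hx (h2 x hx hxR)
        · refine le_trans ?_ le_add_self
          refine (comb x _ _ _ hx (h1 x hxR)).trans ?_
          rw [mul_assoc, ← ENNReal.ofReal_mul (by positivity)]
          gcongr
          exact rpow_le_one_add (by linarith) (by linarith)
    _ < ⊤ := by
        rw [lintegral_add_left (by fun_prop), lintegral_const_mul _ (by fun_prop),
          lintegral_const_mul _ (by fun_prop)]
        exact ENNReal.add_lt_top.2 ⟨ENNReal.mul_lt_top hK2' (powBall_lt_top hd he2' _),
          ENNReal.mul_lt_top (ENNReal.mul_lt_top hK1' ENNReal.ofReal_lt_top) (one_add_lt_top he1')⟩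
end
end

section
/- Let 0 < s < 1, p ≥ q ≥ 1, d ≥ 1, and let α, β satisfy α < sq − (1 − q/p)d, β < sp, α, β > −d, α + qβ/p > −d. Set C = ( ∫_0^1 t^{sp−1} ( t^{−(p/q−1)d − pα/q} + t^{−β} ) |1 − t^{(d+α+qβ/p−sq)/q}|^p Φ_{d,s,p}(t) dt )^{q/p}, where Φ_{d,s,p}(t) = ω_{d−2} ∫_{−1}^1 (1−r²)^{(d−3)/2}(1−2tr+t²)^{−(d+sp)/2} dr for d ≥ 2 and Φ_{1,s,p}(t) = (1−t)^{−1−sp}+(1+t)^{−1−sp}. Then for every u ∈ C_c^1(ℝ^d) (if sq − α − qβ/p < d) or u ∈ C_c^1(ℝ^d ∖ {0}) (if sq − α − qβ/p > d), one has ∫_{ℝ^d} ( ∫_{ℝ^d} |u(x)−u(y)|^p |x−y|^{−d−sp} |y|^β dy )^{q/p} |x|^α dx ≥ C ∫_{ℝ^d} |u(x)|^q |x|^{−(sq−α−qβ/p)} dx. -/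
open MeasureTheory Set
open scoped ENNReal

noncomputable section

/-- The angular kernel `Φ_{d,s,p}`. -/
def Phi (d : ℕ) (s p t : ℝ) : ℝ :=
  if d = 1 then (1 - t) ^ (-1 - s * p) + (1 + t) ^ (-1 - s * p)
  else (2 * Real.pi ^ (((d : ℝ) - 1) / 2) / Real.Gamma (((d : ℝ) - 1) / 2)) *
    ∫ r in (-1 : ℝ)..1,
      (1 - r ^ 2) ^ (((d : ℝ) - 3) / 2) * (1 - 2 * t * r + t ^ 2) ^ (-((d : ℝ) + s * p) / 2)

namespace HardyTL

/-- The Minkowski integral inequality, for kernels. -/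
theorem minkowski_int {X T : Type*} [MeasurableSpace X] [MeasurableSpace T]
    (μ : Measure X) (ν : Measure T) [SFinite μ] [SigmaFinite ν]
    (H : X → T → ℝ≥0∞) (hH : Measurable (Function.uncurry H)) (P : ℝ) (hP : 1 ≤ P) :
    (∫⁻ t, (∫⁻ x, H x t ∂μ) ^ P ∂ν) ^ (1 / P) ≤ ∫⁻ x, (∫⁻ t, H x t ^ P ∂ν) ^ (1 / P) ∂μ := by
  have hP0 : 0 < P := by linarith
  rcases hP.eq_or_lt with rfl | hP1
  · simp only [ENNReal.rpow_one, div_one]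
    rw [lintegral_lintegral_swap]
    exact (hH.comp measurable_swap).aemeasurable
  set J : T → ℝ≥0∞ := fun t => ∫⁻ x, H x t ∂μ with hJ
  have hJm : Measurable J := by
    exact Measurable.lintegral_prod_right (hH.comp measurable_swap)
  set R := ∫⁻ x, (∫⁻ t, H x t ^ P ∂ν) ^ (1 / P) ∂μ with hR
  have key : ∀ g : T → ℝ≥0∞, Measurable g → g ≤ J → (∫⁻ t, g t ^ P ∂ν) ≠ ∞ →
      ∫⁻ t, g t ^ P ∂ν ≤ R ^ P := by
    intro g hg hgJ hfin
    set A := ∫⁻ t, g t ^ P ∂ν with hA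
    by_cases hA0 : A = 0
    · rw [hA0]; exact zero_le
    have hc : P.HolderConjugate (P.conjExponent) := Real.HolderConjugate.conjExponent hP1
    have h1 : A ≤ R * A ^ (1 / P.conjExponent) := by
      calc A ≤ ∫⁻ t, J t * g t ^ (P - 1) ∂ν := by
            refine lintegral_mono fun t => ?_
            calc g t ^ P = g t ^ (1 + (P - 1)) := by ring_nf
              _ = g t ^ (1:ℝ) * g t ^ (P - 1) := by
                rw [ENNReal.rpow_add_of_nonneg _ _ (by norm_num) (by linarith)]
              _ ≤ J t * g t ^ (P - 1) := by
                rw [ENNReal.rpow_one]; gcongr; exact hgJ t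
        _ = ∫⁻ t, ∫⁻ x, H x t * g t ^ (P - 1) ∂μ ∂ν := by
            refine lintegral_congr fun t => ?_
            rw [lintegral_mul_const]
            exact hH.comp measurable_prodMk_right
        _ = ∫⁻ x, ∫⁻ t, H x t * g t ^ (P - 1) ∂ν ∂μ := by
            rw [lintegral_lintegral_swap]
            refine Measurable.aemeasurable ?_
            exact (hH.comp measurable_swap).mul ((hg.comp measurable_fst).pow_const _)
        _ ≤ ∫⁻ x, (∫⁻ t, H x t ^ P ∂ν) ^ (1 / P) * A ^ (1 / P.conjExponent) ∂μ := by
            refine lintegral_mono fun x => ?_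
            exact ENNReal.lintegral_mul_rpow_le_lintegral_rpow_mul_lintegral_rpow hc
              (hH.comp measurable_prodMk_left).aemeasurable hg.aemeasurable
        _ = R * A ^ (1 / P.conjExponent) := by
            rw [lintegral_mul_const]
            refine Measurable.pow_const ?_ _
            exact Measurable.lintegral_prod_right (hH.pow_const P)
    have h2 : A ^ (1 / P) ≤ R := by
      have e : A = A ^ (1 / P) * A ^ (1 / P.conjExponent) := by
        rw [← ENNReal.rpow_add _ _ hA0 hfin]
        have := hc.inv_add_inv_eq_one
        rw [one_div, one_div, this, ENNReal.rpow_one]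
      have hne : A ^ (1 / P.conjExponent) ≠ 0 := by
        simp [hA0, hfin]
      have hnt : A ^ (1 / P.conjExponent) ≠ ∞ := by
        exact ENNReal.rpow_ne_top_of_nonneg (by have := hc.symm.pos; positivity) hfin
      by_contra hlt
      push Not at hlt
      have : R * A ^ (1 / P.conjExponent) < A ^ (1 / P) * A ^ (1 / P.conjExponent) :=
        ENNReal.mul_lt_mul_left hne hnt hlt
      rw [← e] at this
      exact absurd h1 (not_le.2 this)
    calc A = (A ^ (1 / P)) ^ P := by
          rw [← ENNReal.rpow_mul, one_div_mul_cancel hP0.ne', ENNReal.rpow_one]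
      _ ≤ R ^ P := ENNReal.rpow_le_rpow h2 hP0.le
  suffices h : ∫⁻ t, J t ^ P ∂ν ≤ R ^ P by
    calc (∫⁻ t, J t ^ P ∂ν) ^ (1 / P) ≤ (R ^ P) ^ (1 / P) :=
          ENNReal.rpow_le_rpow h (by positivity)
      _ = R := by rw [← ENNReal.rpow_mul, mul_one_div_cancel hP0.ne', ENNReal.rpow_one]
  let g : ℕ → T → ℝ≥0∞ := fun n => (spanningSets ν n).indicator fun t => min (J t) n
  have hgm : ∀ n, Measurable (g n) := fun n =>
    (hJm.min measurable_const).indicator (measurableSet_spanningSets ν n)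
  have hmono : Monotone g := by
    intro m n hmn t
    simp only [g]
    by_cases ht : t ∈ spanningSets ν m
    · have ht' := monotone_spanningSets ν hmn ht
      rw [indicator_of_mem ht, indicator_of_mem ht']
      gcongr
    · rw [indicator_of_notMem ht]; exact zero_le
  have hlim : ∀ t, Filter.Tendsto (fun n => g n t) Filter.atTop (nhds (J t)) := by
    intro t
    have h1 : Filter.Tendsto (fun n : ℕ => min (J t) (n : ℝ≥0∞)) Filter.atTop
        (nhds (min (J t) ∞)) := tendsto_const_nhds.min ENNReal.tendsto_nat_nhds_top
    rw [min_eq_left le_top] at h1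
    refine h1.congr' ?_
    filter_upwards [eventually_mem_spanningSets ν t] with n hn
    simp only [g]
    rw [indicator_of_mem hn]
  refine le_of_tendsto' (lintegral_tendsto_of_tendsto_of_monotone
    (f := fun n t => g n t ^ P) (F := fun t => J t ^ P)
    (fun n => ((hgm n).pow_const P).aemeasurable) ?_ ?_) fun n => key (g n) (hgm n) ?_ ?_
  · refine Filter.Eventually.of_forall fun t m n hmn => ?_
    exact ENNReal.rpow_le_rpow (hmono hmn t) hP0.le
  · exact Filter.Eventually.of_forall fun t =>
      (ENNReal.continuous_rpow_const.tendsto _).comp (hlim t)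
  · intro t
    exact (indicator_le_self' (by simp) t).trans (min_le_left _ _)
  · refine ne_of_lt ?_
    calc ∫⁻ t, g n t ^ P ∂ν ≤ ∫⁻ t, (spanningSets ν n).indicator (fun _ => (n:ℝ≥0∞) ^ P) t ∂ν := by
          refine lintegral_mono fun t => ?_
          simp only [g]
          by_cases ht : t ∈ spanningSets ν n
          · rw [indicator_of_mem ht, indicator_of_mem ht]
            exact ENNReal.rpow_le_rpow (min_le_right _ _) hP0.le
          · rw [indicator_of_notMem ht, indicator_of_notMem ht, ENNReal.zero_rpow_of_pos hP0]
      _ = (n:ℝ≥0∞) ^ P * ν (spanningSets ν n) := by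
          rw [lintegral_indicator_const (measurableSet_spanningSets ν n)]
      _ < ∞ := ENNReal.mul_lt_top (ENNReal.rpow_lt_top_of_nonneg hP0.le (by simp))
          (measure_spanningSets_lt_top ν n)

/-- Polar coordinates for lower integrals. -/
theorem polar {E : Type*} [NormedAddCommGroup E] [NormedSpace ℝ E] [FiniteDimensional ℝ E]
    [MeasurableSpace E] [BorelSpace E] [Nontrivial E] (μ : Measure E) [μ.IsAddHaarMeasure]
    (g : E → ℝ≥0∞) (hg : Measurable g) :
    ∫⁻ y, g y ∂μ = ∫⁻ r in Ioi (0:ℝ), ENNReal.ofReal (r ^ (Module.finrank ℝ E - 1)) *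
      ∫⁻ φ : Metric.sphere (0:E) 1, g (r • (φ:E)) ∂μ.toSphere := by
  have hm := μ.measurePreserving_homeomorphUnitSphereProd
  calc ∫⁻ y, g y ∂μ = ∫⁻ x : ({(0)}ᶜ : Set E), g x ∂(μ.comap (↑)) := by
        rw [lintegral_subtype_comap (measurableSet_singleton _).compl, restrict_compl_singleton]
    _ = ∫⁻ z, g (z.2.1 • (z.1:E)) ∂(μ.toSphere.prod (.volumeIoiPow (Module.finrank ℝ E - 1))) := by
        rw [← hm.lintegral_comp_emb (Homeomorph.measurableEmbedding _)]
        refine lintegral_congr fun x => ?_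
        have hx : ‖(x:E)‖ ≠ 0 := norm_ne_zero_iff.2 (fun h => x.2 h)
        simp [smul_smul, hx]
    _ = ∫⁻ r : Ioi (0:ℝ), ∫⁻ φ, g (r.1 • (φ:E)) ∂μ.toSphere
          ∂(.volumeIoiPow (Module.finrank ℝ E - 1)) := by
        rw [lintegral_prod_symm]
        refine Measurable.aemeasurable ?_
        exact hg.comp (by fun_prop)
    _ = _ := by
        have hm2 : Measurable fun r : ℝ => ∫⁻ φ : Metric.sphere (0:E) 1, g (r • (φ:E)) ∂μ.toSphere := by
          refine Measurable.lintegral_prod_right (f := fun (r : ℝ) (φ : Metric.sphere (0:E) 1) => g (r • (φ:E))) ?_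
          exact hg.comp (by fun_prop)
        have hm3 := hm2.comp (measurable_subtype_coe (p := fun r : ℝ => r ∈ Ioi (0:ℝ)))
        rw [Measure.volumeIoiPow]
        refine (lintegral_withDensity_eq_lintegral_mul _ (by fun_prop) hm3).trans ?_
        rw [← lintegral_subtype_comap measurableSet_Ioi]
        rfl

/-- Scaling on the half line. -/
theorem scale_Ioi (c : ℝ) (hc : 0 < c) (g : ℝ → ℝ≥0∞) :
    ∫⁻ r in Ioi (0:ℝ), g r = ENNReal.ofReal c * ∫⁻ t in Ioi (0:ℝ), g (c * t) := by
  have himg : (fun t : ℝ => c * t) '' Ioi 0 = Ioi 0 := by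
    rw [Set.image_mul_left_Ioi hc, mul_zero]
  have := lintegral_image_eq_lintegral_abs_deriv_mul (s := Ioi (0:ℝ)) (f := fun t => c * t)
    (f' := fun _ => c) measurableSet_Ioi
    (fun x _ => by simpa using ((hasDerivAt_id x).const_mul c).hasDerivWithinAt)
    (fun x _ y _ h => by simpa [hc.ne'] using h) g
  rw [himg] at this
  rw [this, abs_of_pos hc, lintegral_const_mul' _ _ ENNReal.ofReal_ne_top]

end HardyTL
namespace HardyTL

theorem rot {n : ℕ} (θ : EuclideanSpace ℝ (Fin (n+1))) (hθ : ‖θ‖ = 1) (g : ℝ → ℝ → ℝ≥0∞) :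
    ∫⁻ y, g (inner ℝ θ y) ‖y‖ = ∫⁻ y : EuclideanSpace ℝ (Fin (n+1)), g (y 0) ‖y‖ := by
  set e : EuclideanSpace ℝ (Fin (n+1)) := EuclideanSpace.single 0 1
  have he : ‖e‖ = 1 := by simp [e]
  set L := (Submodule.span ℝ {θ - e})ᗮ.reflection
  have hL : L θ = e := Submodule.reflection_sub (by rw [hθ, he])
  have hmp := L.measurePreserving
  rw [← hmp.lintegral_comp_emb (L.toHomeomorph.measurableEmbedding)
    (fun y : EuclideanSpace ℝ (Fin (n+1)) => g (y 0) ‖y‖)]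
  refine lintegral_congr fun y => ?_
  have h1 : (L y) 0 = inner ℝ θ y := by
    rw [← L.inner_map_map, hL, EuclideanSpace.inner_single_left]
    simp
  rw [h1, L.norm_map]

theorem pow_int (n : ℕ) : (∫⁻ r in Ioo (0:ℝ) 1, ENNReal.ofReal (r ^ n)) ≠ 0 ∧
    (∫⁻ r in Ioo (0:ℝ) 1, ENNReal.ofReal (r ^ n)) ≠ ∞ := by
  constructor
  · rw [← pos_iff_ne_zero, setLIntegral_pos_iff (by fun_prop)]
    have : Ioo (0:ℝ) 1 ⊆ Function.support (fun r : ℝ => ENNReal.ofReal (r ^ n)) ∩ Ioo 0 1 := by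
      intro r hr
      refine ⟨?_, hr⟩
      simp only [Function.mem_support, ne_eq, ENNReal.ofReal_eq_zero, not_le]
      exact pow_pos hr.1 n
    exact lt_of_lt_of_le (by simp) (measure_mono this)
  · refine ne_of_lt (lt_of_le_of_lt (setLIntegral_mono (g := fun _ => 1) measurable_const ?_) ?_)
    · intro r hr
      rw [ENNReal.ofReal_le_one]
      exact pow_le_one₀ hr.1.le hr.2.le
    · simp

theorem sphere_aux {n : ℕ} (θ : EuclideanSpace ℝ (Fin (n+1))) (hθ : ‖θ‖ = 1)
    (f : ℝ → ℝ≥0∞) (hf : Measurable f) :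
    (∫⁻ r in Ioo (0:ℝ) 1, ENNReal.ofReal (r ^ n)) *
      ∫⁻ φ : Metric.sphere (0:EuclideanSpace ℝ (Fin (n+1))) 1, f (inner ℝ θ (φ:EuclideanSpace ℝ (Fin (n+1))))
        ∂(volume : Measure (EuclideanSpace ℝ (Fin (n+1)))).toSphere =
    ∫⁻ y : EuclideanSpace ℝ (Fin (n+1)), (Iio (1:ℝ)).indicator (fun τ => f (y 0 / τ)) ‖y‖ := by
  have hG : Measurable (fun z : ℝ × ℝ => (Iio (1:ℝ)).indicator (fun τ => f (z.1 / τ)) z.2) := by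
    have : (fun z : ℝ × ℝ => (Iio (1:ℝ)).indicator (fun τ => f (z.1 / τ)) z.2)
      = (Prod.snd ⁻¹' (Iio (1:ℝ))).indicator (fun z : ℝ × ℝ => f (z.1 / z.2)) := by
      ext z; simp [indicator]
    rw [this]
    exact (hf.comp (by fun_prop)).indicator (measurable_snd measurableSet_Iio)
  rw [← rot θ hθ (fun a τ' => (Iio (1:ℝ)).indicator (fun τ => f (a / τ)) τ'), polar volume]
  swap
  · exact hG.comp (f := fun y => (inner ℝ θ y, ‖y‖)) (by fun_prop)
  rw [finrank_euclideanSpace_fin, Nat.add_sub_cancel, ← lintegral_mul_const _ (by fun_prop)]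
  rw [← Ioi_inter_Iio, inter_comm, ← Measure.restrict_restrict measurableSet_Iio,
    ← lintegral_indicator measurableSet_Iio]
  refine setLIntegral_congr_fun measurableSet_Ioi fun r (hr : 0 < r) => ?_
  by_cases h1 : r < 1
  · rw [indicator_of_mem (by exact h1)]
    congr 1
    refine lintegral_congr fun φ => ?_
    have hφ : ‖(φ:EuclideanSpace ℝ (Fin (n+1)))‖ = 1 := by simp
    have hnorm : ‖r • (φ:EuclideanSpace ℝ (Fin (n+1)))‖ = r := by
      rw [norm_smul, hφ, mul_one, Real.norm_eq_abs, abs_of_pos hr]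
    rw [hnorm, indicator_of_mem (by exact h1), inner_smul_right, mul_div_cancel_left₀ _ hr.ne']
  · rw [indicator_of_notMem (by exact h1)]
    symm
    convert mul_zero _
    rw [lintegral_eq_zero_iff']
    · refine Filter.Eventually.of_forall fun φ => ?_
      have hφ : ‖(φ:EuclideanSpace ℝ (Fin (n+1)))‖ = 1 := by simp
      have hnorm : ‖r • (φ:EuclideanSpace ℝ (Fin (n+1)))‖ = r := by
        rw [norm_smul, hφ, mul_one, Real.norm_eq_abs, abs_of_pos hr]
      simp only [hnorm]
      rw [indicator_of_notMem (by exact h1)]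
      rfl
    · refine Measurable.aemeasurable ?_
      exact hG.comp (f := fun φ : Metric.sphere (0:EuclideanSpace ℝ (Fin (n+1))) 1 =>
        (inner ℝ θ (r • (φ:EuclideanSpace ℝ (Fin (n+1)))), ‖r • (φ:EuclideanSpace ℝ (Fin (n+1)))‖)) (by fun_prop)

/-- splitting off the first coordinate -/
theorem split_first {n : ℕ} (g : ℝ → ℝ → ℝ≥0∞) (hg : Measurable (Function.uncurry g)) :
    ∫⁻ y : EuclideanSpace ℝ (Fin (n+1)), g (y 0) ‖y‖ =
    ∫⁻ a : ℝ, ∫⁻ y' : EuclideanSpace ℝ (Fin n), g a √(a ^ 2 + ‖y'‖ ^ 2) := by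
  have h1 := (EuclideanSpace.volume_preserving_symm_measurableEquiv_toLp (Fin (n+1))).symm
  have h2 := (volume_preserving_piFinSuccAbove (fun _ : Fin (n+1) => ℝ) 0).symm
  have h3 := (EuclideanSpace.volume_preserving_symm_measurableEquiv_toLp (Fin n))
  rw [← h1.lintegral_comp_emb (MeasurableEquiv.measurableEmbedding _),
    ← h2.lintegral_comp_emb (MeasurableEquiv.measurableEmbedding _)]
  rw [Measure.volume_eq_prod, lintegral_prod]
  · refine lintegral_congr fun a => ?_
    rw [← h3.lintegral_comp_emb (MeasurableEquiv.measurableEmbedding _)]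
    refine lintegral_congr fun y' => ?_
    congr 1
    rw [EuclideanSpace.norm_eq]
    congr 1
    rw [Fin.sum_univ_succ, EuclideanSpace.norm_eq, Real.sq_sqrt (by positivity)]
    simp
  · refine Measurable.aemeasurable ?_
    have hm : Measurable fun y : EuclideanSpace ℝ (Fin (n+1)) => g (y 0) ‖y‖ :=
      hg.comp (f := fun y : EuclideanSpace ℝ (Fin (n+1)) => (y 0, ‖y‖)) (by fun_prop)
    exact (hm.comp (MeasurableEquiv.measurable _)).comp (MeasurableEquiv.measurable _)

end HardyTL
namespace HardyTL

theorem indic_meas (f : ℝ → ℝ≥0∞) (hf : Measurable f) :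
    Measurable (Function.uncurry fun a τ' => (Iio (1:ℝ)).indicator (fun τ => f (a / τ)) τ') := by
  have : (Function.uncurry fun a τ' => (Iio (1:ℝ)).indicator (fun τ => f (a / τ)) τ')
      = (Prod.snd ⁻¹' (Iio (1:ℝ))).indicator (fun z : ℝ × ℝ => f (z.1 / z.2)) := by
    ext z; simp [indicator, Function.uncurry]
  rw [this]
  exact (hf.comp (by fun_prop)).indicator (measurable_snd measurableSet_Iio)

theorem sphere_one (θ : EuclideanSpace ℝ (Fin 1)) (hθ : ‖θ‖ = 1)
    (f : ℝ → ℝ≥0∞) (hf : Measurable f) :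
    ∫⁻ φ : Metric.sphere (0:EuclideanSpace ℝ (Fin 1)) 1, f (inner ℝ θ (φ:EuclideanSpace ℝ (Fin 1)))
        ∂(volume : Measure (EuclideanSpace ℝ (Fin 1))).toSphere = f 1 + f (-1) := by
  have h := sphere_aux (n := 0) θ hθ f hf
  rw [split_first _ (indic_meas f hf)] at h
  simp only [pow_zero, ENNReal.ofReal_one, lintegral_const, Measure.restrict_apply_univ,
    Real.volume_Ioo, sub_zero, one_mul, ENNReal.ofReal_one] at h
  rw [h]
  have h0 : ∀ a : ℝ, ∫⁻ y' : EuclideanSpace ℝ (Fin 0), (Iio (1:ℝ)).indicator (fun τ => f (a / τ))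
      √(a ^ 2 + ‖y'‖ ^ 2) = (Iio (1:ℝ)).indicator (fun τ => f (a / τ)) |a| := by
    intro a
    have : ∀ y' : EuclideanSpace ℝ (Fin 0), ‖y'‖ = 0 := by
      intro y'
      rw [norm_eq_zero]; exact Subsingleton.elim _ _
    simp only [this]
    rw [lintegral_const, zero_pow two_ne_zero, add_zero, Real.sqrt_sq_eq_abs]
    simp [volume_euclideanSpace_eq_dirac]
  rw [lintegral_congr h0]
  have h1 : ∀ᵐ a : ℝ, (Iio (1:ℝ)).indicator (fun τ => f (a / τ)) |a|
      = (Ioo (0:ℝ) 1).indicator (fun _ => f 1) a + (Ioo (-1:ℝ) 0).indicator (fun _ => f (-1)) a := by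
    have : ∀ᵐ a : ℝ, a ≠ 0 := by simp [ae_iff]
    filter_upwards [this] with a ha
    rcases lt_or_gt_of_ne ha with h | h
    · have : a / |a| = -1 := by rw [abs_of_neg h]; field_simp
      by_cases h2 : -1 < a
      · have h3 : |a| < 1 := by rw [abs_of_neg h]; linarith
        simp [indicator, h3, h2, h, this, not_lt.2 h.le]
      · have h3 : ¬ |a| < 1 := by rw [abs_of_neg h]; linarith
        simp [indicator, h3, h2, not_lt.2 h.le]
    · have : a / |a| = 1 := by rw [abs_of_pos h]; field_simp
      by_cases h2 : a < 1
      · have h3 : |a| < 1 := by rwa [abs_of_pos h]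
        simp [indicator, h3, h2, h, this, not_lt.2 h.le]
      · have h3 : ¬ |a| < 1 := by rwa [abs_of_pos h]
        simp [indicator, h3, h2, not_lt.2 h.le]
  rw [lintegral_congr_ae h1, lintegral_add_left (by fun_prop (disch := exact measurableSet_Ioo)),
    lintegral_indicator_const measurableSet_Ioo, lintegral_indicator_const measurableSet_Ioo]
  simp

theorem radial {n : ℕ} (hn : 1 ≤ n) (g : ℝ → ℝ≥0∞) (hg : Measurable g) :
    ∫⁻ y : EuclideanSpace ℝ (Fin n), g ‖y‖ = (volume : Measure (EuclideanSpace ℝ (Fin n))).toSphere univ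
      * ∫⁻ ρ in Ioi (0:ℝ), ENNReal.ofReal (ρ ^ (n-1)) * g ρ := by
  have : Nonempty (Fin n) := ⟨⟨0, hn⟩⟩
  have : Nontrivial (EuclideanSpace ℝ (Fin n)) := inferInstance
  rw [polar volume (fun y => g ‖y‖) (hg.comp measurable_norm), finrank_euclideanSpace_fin,
    ← lintegral_const_mul _ (by fun_prop)]
  refine setLIntegral_congr_fun measurableSet_Ioi fun r (hr : 0 < r) => ?_
  have : ∀ φ : Metric.sphere (0:EuclideanSpace ℝ (Fin n)) 1,
      g ‖r • (φ:EuclideanSpace ℝ (Fin n))‖ = g r := by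
    intro φ
    rw [norm_smul, norm_eq_of_mem_sphere, mul_one, Real.norm_eq_abs, abs_of_pos hr]
  simp only [this, lintegral_const]
  ring

theorem cos_image : Real.cos '' Ioo 0 Real.pi = Ioo (-1) 1 := by
  ext r
  constructor
  · rintro ⟨x, hx, rfl⟩
    constructor
    · rw [← Real.cos_pi]
      exact Real.cos_lt_cos_of_nonneg_of_le_pi hx.1.le le_rfl hx.2
    · rw [← Real.cos_zero]
      exact Real.cos_lt_cos_of_nonneg_of_le_pi le_rfl hx.2.le hx.1
  · intro hr
    refine ⟨Real.arccos r, ⟨?_, ?_⟩, Real.cos_arccos hr.1.le hr.2.le⟩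
    · exact Real.arccos_pos.2 hr.2
    · refine lt_of_le_of_ne (Real.arccos_le_pi r) ?_
      rw [Ne, Real.arccos_eq_pi]
      linarith [hr.1]

theorem cos_subst {n : ℕ} (hn : 1 ≤ n) (f : ℝ → ℝ≥0∞) :
    ∫⁻ r in Ioo (-1:ℝ) 1, ENNReal.ofReal ((1 - r ^ 2) ^ (((n:ℝ) - 2) / 2)) * f r =
    ∫⁻ x in Ioo 0 Real.pi, ENNReal.ofReal (Real.sin x ^ (n-1)) * f (Real.cos x) := by
  rw [← cos_image, lintegral_image_eq_lintegral_abs_deriv_mul (f' := fun x => - Real.sin x)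
    measurableSet_Ioo (fun x _ => (Real.hasDerivAt_cos x).hasDerivWithinAt)
    (Real.injOn_cos.mono Ioo_subset_Icc_self)]
  refine setLIntegral_congr_fun measurableSet_Ioo fun x hx => ?_
  have hs : 0 < Real.sin x := Real.sin_pos_of_mem_Ioo hx
  rw [← mul_assoc, ← ENNReal.ofReal_mul (abs_nonneg _), abs_neg, abs_of_pos hs]
  congr 2
  have : 1 - Real.cos x ^ 2 = Real.sin x ^ (2:ℝ) := by
    rw [Real.rpow_two, Real.sin_sq]
  rw [this, ← Real.rpow_mul hs.le]
  nth_rewrite 1 [← Real.rpow_one (Real.sin x)]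
  rw [← Real.rpow_add hs, ← Real.rpow_natCast, Nat.cast_sub hn]
  congr 1; push_cast; ring

theorem sphere_ge_two {n : ℕ} (hn : 1 ≤ n) (θ : EuclideanSpace ℝ (Fin (n+1))) (hθ : ‖θ‖ = 1)
    (f : ℝ → ℝ≥0∞) (hf : Measurable f) :
    ∫⁻ φ : Metric.sphere (0:EuclideanSpace ℝ (Fin (n+1))) 1, f (inner ℝ θ (φ:EuclideanSpace ℝ (Fin (n+1))))
        ∂(volume : Measure (EuclideanSpace ℝ (Fin (n+1)))).toSphere =
    (volume : Measure (EuclideanSpace ℝ (Fin n))).toSphere univ *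
      ∫⁻ r in Ioo (-1:ℝ) 1, ENNReal.ofReal ((1 - r ^ 2) ^ (((n:ℝ) - 2) / 2)) * f r := by
  have h := sphere_aux θ hθ f hf
  obtain ⟨hc0, hct⟩ := pow_int n
  refine (ENNReal.mul_right_inj hc0 hct).1 ?_
  rw [h, split_first _ (indic_meas f hf)]
  set S := (volume : Measure (EuclideanSpace ℝ (Fin n))).toSphere univ
  set G : ℝ → ℝ → ℝ≥0∞ := fun a τ' => (Iio (1:ℝ)).indicator (fun τ => f (a / τ)) τ' with hGdef
  have hG : Measurable (Function.uncurry G) := indic_meas f hf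
  have hF : Measurable fun z : ℝ × ℝ => ENNReal.ofReal (z.2 ^ (n-1)) * G z.1 √(z.1 ^ 2 + z.2 ^ 2) := by
    refine Measurable.mul (by fun_prop) ?_
    exact hG.comp (f := fun z : ℝ × ℝ => (z.1, √(z.1 ^ 2 + z.2 ^ 2))) (by fun_prop)
  have hF' := hF.indicator (s := Prod.snd ⁻¹' (Ioi (0:ℝ))) (measurable_snd measurableSet_Ioi)
  set F : ℝ × ℝ → ℝ≥0∞ := (Prod.snd ⁻¹' (Ioi (0:ℝ))).indicator
    fun z : ℝ × ℝ => ENNReal.ofReal (z.2 ^ (n-1)) * G z.1 √(z.1 ^ 2 + z.2 ^ 2) with hFdef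
  have e1 : ∫⁻ a : ℝ, ∫⁻ y' : EuclideanSpace ℝ (Fin n), G a √(a ^ 2 + ‖y'‖ ^ 2)
      = S * ∫⁻ z, F z := by
    rw [Measure.volume_eq_prod, lintegral_prod _ hF'.aemeasurable,
      ← lintegral_const_mul _ hF'.lintegral_prod_right']
    refine lintegral_congr fun a => ?_
    rw [radial hn (fun ρ => G a √(a ^ 2 + ρ ^ 2))]
    · congr 1
      rw [← lintegral_indicator measurableSet_Ioi]
      rfl
    · exact hG.comp (f := fun ρ : ℝ => (a, √(a ^ 2 + ρ ^ 2))) (by fun_prop)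
  have e2 : ∫⁻ z, F z = ∫⁻ τ in Ioi (0:ℝ), ∫⁻ x in Ioo (-Real.pi) Real.pi,
      ENNReal.ofReal τ * F (τ * Real.cos x, τ * Real.sin x) := by
    rw [← lintegral_comp_polarCoord_symm, polarCoord_target, Measure.volume_eq_prod,
      ← Measure.prod_restrict, lintegral_prod]
    · simp only [smul_eq_mul, polarCoord_symm_apply]
    · simp only [smul_eq_mul, polarCoord_symm_apply]
      refine Measurable.aemeasurable ?_
      exact Measurable.mul (by fun_prop) (hF'.comp (f := fun p : ℝ × ℝ => (p.1 * Real.cos p.2, p.1 * Real.sin p.2)) (by fun_prop))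
  have e3 : ∀ τ ∈ Ioi (0:ℝ), ∫⁻ x in Ioo (-Real.pi) Real.pi,
      ENNReal.ofReal τ * F (τ * Real.cos x, τ * Real.sin x)
      = (Iio (1:ℝ)).indicator (fun τ => ENNReal.ofReal (τ ^ n) *
        ∫⁻ x in Ioo 0 Real.pi, ENNReal.ofReal (Real.sin x ^ (n-1)) * f (Real.cos x)) τ := by
    intro τ (hτ : 0 < τ)
    have hsub : Ioo 0 Real.pi ⊆ Ioo (-Real.pi) Real.pi := by
      intro x hx; exact ⟨by linarith [hx.1, Real.pi_pos], hx.2⟩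
    have e4 : ∫⁻ x in Ioo (-Real.pi) Real.pi,
      ENNReal.ofReal τ * F (τ * Real.cos x, τ * Real.sin x) = ∫⁻ x in Ioo 0 Real.pi,
      ENNReal.ofReal τ * F (τ * Real.cos x, τ * Real.sin x) := by
      rw [← lintegral_indicator measurableSet_Ioo, ← lintegral_indicator measurableSet_Ioo]
      refine lintegral_congr fun x => ?_
      by_cases hx : x ∈ Ioo 0 Real.pi
      · rw [indicator_of_mem hx, indicator_of_mem (hsub hx)]
      · rw [indicator_of_notMem hx]
        by_cases hx' : x ∈ Ioo (-Real.pi) Real.pi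
        · rw [indicator_of_mem hx']
          have : Real.sin x ≤ 0 := by
            refine Real.sin_nonpos_of_nonpos_of_neg_pi_le ?_ hx'.1.le
            by_contra hh
            exact hx ⟨not_le.1 hh, hx'.2⟩
          rw [hFdef, indicator_of_notMem, mul_zero]
          simp only [mem_preimage, mem_Ioi, not_lt]
          exact mul_nonpos_of_nonneg_of_nonpos hτ.le this
        · rw [indicator_of_notMem hx']
    rw [e4]
    have e5 : ∀ x ∈ Ioo 0 Real.pi, ENNReal.ofReal τ * F (τ * Real.cos x, τ * Real.sin x)
        = (Iio (1:ℝ)).indicator (fun τ => ENNReal.ofReal (τ ^ n) *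
          (ENNReal.ofReal (Real.sin x ^ (n-1)) * f (Real.cos x))) τ := by
      intro x hx
      have hs : 0 < Real.sin x := Real.sin_pos_of_mem_Ioo hx
      have hsq : √((τ * Real.cos x) ^ 2 + (τ * Real.sin x) ^ 2) = τ := by
        have : (τ * Real.cos x) ^ 2 + (τ * Real.sin x) ^ 2 = τ ^ 2 := by
          linear_combination τ ^ 2 * Real.cos_sq_add_sin_sq x
        rw [this, Real.sqrt_sq hτ.le]
      rw [hFdef, indicator_of_mem (by simpa using mul_pos hτ hs)]
      simp only [hsq, hGdef]
      by_cases h1 : τ < 1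
      · rw [indicator_of_mem (by exact h1), indicator_of_mem (by exact h1),
          mul_div_cancel_left₀ _ hτ.ne', ← mul_assoc, ← mul_assoc, ← ENNReal.ofReal_mul hτ.le,
          ← ENNReal.ofReal_mul (by positivity)]
        congr 2
        rw [mul_pow, ← mul_assoc, ← pow_succ', Nat.sub_add_cancel hn]
      · rw [indicator_of_notMem (by exact h1), indicator_of_notMem (by exact h1), mul_zero, mul_zero]
    rw [setLIntegral_congr_fun measurableSet_Ioo e5]
    by_cases h1 : τ < 1
    · simp only [indicator_of_mem (show τ ∈ Iio 1 from h1)]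
      rw [lintegral_const_mul]
      fun_prop
    · simp only [indicator_of_notMem (show τ ∉ Iio 1 from h1)]
      simp
  rw [e1, e2, setLIntegral_congr_fun measurableSet_Ioi e3, lintegral_indicator measurableSet_Iio,
    Measure.restrict_restrict measurableSet_Iio, inter_comm, Ioi_inter_Iio,
    lintegral_mul_const _ (by fun_prop), cos_subst hn]
  ring

theorem toSphere_val {n : ℕ} (hn : 1 ≤ n) :
    (volume : Measure (EuclideanSpace ℝ (Fin n))).toSphere univ =
      ENNReal.ofReal (2 * Real.pi ^ ((n:ℝ) / 2) / Real.Gamma ((n:ℝ) / 2)) := by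
  have : Nonempty (Fin n) := ⟨⟨0, hn⟩⟩
  have hn' : (0:ℝ) < n := by exact_mod_cast hn
  rw [Measure.toSphere_apply_univ, EuclideanSpace.volume_ball, finrank_euclideanSpace_fin]
  simp only [ENNReal.ofReal_one, one_pow, one_mul, Fintype.card_fin]
  rw [← ENNReal.ofReal_natCast, ← ENNReal.ofReal_mul (by positivity)]
  congr 1
  rw [Real.Gamma_add_one (by positivity), Real.sqrt_eq_rpow, ← Real.rpow_natCast,
    ← Real.rpow_mul Real.pi_pos.le]
  have : Real.Gamma ((n:ℝ)/2) ≠ 0 := (Real.Gamma_pos_of_pos (by positivity)).ne'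
  rw [show 1 / 2 * (n:ℝ) = n / 2 by ring]
  field_simp

end HardyTL
namespace HardyTL

theorem ofReal_int_le {X : Type*} [MeasurableSpace X] (μ : Measure X) (f : X → ℝ)
    (hf : 0 ≤ᵐ[μ] f) : ENNReal.ofReal (∫ x, f x ∂μ) ≤ ∫⁻ x, ENNReal.ofReal (f x) ∂μ := by
  by_cases h : Integrable f μ
  · rw [ofReal_integral_eq_lintegral_ofReal h hf]
  · rw [integral_undef h]; simp

abbrev EE (n : ℕ) := EuclideanSpace ℝ (Fin n)
abbrev SS (n : ℕ) := Metric.sphere (0 : EE n) 1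
abbrev sg (n : ℕ) : Measure (SS n) := (volume : Measure (EE n)).toSphere

/-- The angular kernel as a lower integral over the sphere. -/
def PhiT (n : ℕ) (a t : ℝ) : ℝ≥0∞ :=
  ∫⁻ φ : SS (n+1), ENNReal.ofReal (‖(EuclideanSpace.single 0 1 : EE (n+1)) - t • (φ : EE (n+1))‖ ^ a) ∂sg (n+1)

theorem norm_kernel {n : ℕ} (a t : ℝ) (θ φ : EE n) (hθ : ‖θ‖ = 1) (hφ : ‖φ‖ = 1) :
    ‖θ - t • φ‖ ^ a = (1 - 2 * t * inner ℝ θ φ + t ^ 2) ^ (a / 2) := by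
  have h : ‖θ - t • φ‖ ^ (2:ℝ) = 1 - 2 * t * inner ℝ θ φ + t ^ 2 := by
    rw [Real.rpow_two, @norm_sub_sq_real, inner_smul_right, norm_smul, hθ, hφ]
    simp; ring
  rw [← h, ← Real.rpow_mul (norm_nonneg _)]
  congr 1; ring

theorem norm_kernel_symm {n : ℕ} (t : ℝ) (θ φ : EE n) (hθ : ‖θ‖ = 1) (hφ : ‖φ‖ = 1) :
    ‖θ - t • φ‖ = ‖φ - t • θ‖ := by
  have h1 := norm_kernel 1 t θ φ hθ hφ
  have h2 := norm_kernel 1 t φ θ hφ hθ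
  rw [Real.rpow_one] at h1 h2
  rw [h1, h2, real_inner_comm]

theorem PhiT_eq {n : ℕ} (a t : ℝ) (θ : EE (n+1)) (hθ : ‖θ‖ = 1) :
    ∫⁻ φ : SS (n+1), ENNReal.ofReal (‖θ - t • (φ : EE (n+1))‖ ^ a) ∂sg (n+1) = PhiT n a t := by
  have key : ∀ θ : EE (n+1), ‖θ‖ = 1 →
      ∫⁻ φ : SS (n+1), ENNReal.ofReal (‖θ - t • (φ : EE (n+1))‖ ^ a) ∂sg (n+1) =
      ∫⁻ φ : SS (n+1), (fun r => ENNReal.ofReal ((1 - 2 * t * r + t ^ 2) ^ (a / 2)))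
        (inner ℝ θ (φ : EE (n+1))) ∂sg (n+1) := by
    intro θ hθ
    refine lintegral_congr fun φ => ?_
    rw [norm_kernel a t θ φ hθ (norm_eq_of_mem_sphere φ)]
  have he : ‖(EuclideanSpace.single 0 1 : EE (n+1))‖ = 1 := by simp
  have hf : Measurable (fun r : ℝ => ENNReal.ofReal ((1 - 2 * t * r + t ^ 2) ^ (a / 2))) := by fun_prop
  rw [PhiT, key θ hθ, key _ he]
  obtain ⟨hc0, hct⟩ := pow_int n
  refine (ENNReal.mul_right_inj hc0 hct).1 ?_
  rw [sphere_aux θ hθ _ hf, sphere_aux _ he _ hf]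

theorem PhiT_eq' {n : ℕ} (a t : ℝ) (φ : EE (n+1)) (hφ : ‖φ‖ = 1) :
    ∫⁻ θ : SS (n+1), ENNReal.ofReal (‖(θ : EE (n+1)) - t • φ‖ ^ a) ∂sg (n+1) = PhiT n a t := by
  rw [← PhiT_eq a t φ hφ]
  refine lintegral_congr fun θ => ?_
  rw [norm_kernel_symm t _ _ (norm_eq_of_mem_sphere θ) hφ]

theorem PhiT_meas (n : ℕ) (a : ℝ) : Measurable (PhiT n a) := by
  unfold PhiT
  refine Measurable.lintegral_prod_right (f := fun (t : ℝ) (φ : SS (n+1)) =>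
    ENNReal.ofReal (‖(EuclideanSpace.single 0 1 : EE (n+1)) - t • (φ : EE (n+1))‖ ^ a)) ?_
  unfold Function.uncurry
  fun_prop

theorem PhiT_ne_top {n : ℕ} {a t : ℝ} (ha : a ≤ 0) (ht : 0 < t) (ht1 : t ≠ 1) : PhiT n a t ≠ ∞ := by
  unfold PhiT
  refine ne_of_lt (lt_of_le_of_lt (lintegral_mono (g := fun _ => ENNReal.ofReal (|1 - t| ^ a)) ?_) ?_)
  · intro φ
    refine ENNReal.ofReal_le_ofReal ?_
    refine Real.rpow_le_rpow_of_nonpos (abs_pos.2 (sub_ne_zero.2 ht1.symm)) ?_ ha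
    have h := abs_norm_sub_norm_le (EuclideanSpace.single 0 1 : EE (n+1)) (t • (φ : EE (n+1)))
    rw [norm_smul, norm_eq_of_mem_sphere φ, Real.norm_eq_abs, abs_of_pos ht] at h
    simpa using h
  · rw [lintegral_const]
    exact ENNReal.mul_lt_top ENNReal.ofReal_lt_top (measure_lt_top _ _)

theorem PhiT_inv {n : ℕ} {a t : ℝ} (ht : 0 < t) :
    PhiT n a t⁻¹ = ENNReal.ofReal (t ^ (-a)) * PhiT n a t := by
  unfold PhiT
  rw [← lintegral_const_mul' _ _ ENNReal.ofReal_ne_top]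
  refine lintegral_congr fun φ => ?_
  rw [← ENNReal.ofReal_mul (by positivity)]
  congr 1
  set e := (EuclideanSpace.single 0 1 : EE (n+1))
  have he : ‖e‖ = 1 := by simp [e]
  have hφ : ‖(φ : EE (n+1))‖ = 1 := norm_eq_of_mem_sphere φ
  have h1 : ‖e - t⁻¹ • (φ : EE (n+1))‖ = t⁻¹ * ‖e - t • (φ : EE (n+1))‖ := by
    rw [norm_kernel_symm t e φ he hφ, norm_sub_rev]
    have : (t⁻¹ • (φ : EE (n+1)) - e) = t⁻¹ • ((φ : EE (n+1)) - t • e) := by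
      rw [smul_sub, smul_smul, inv_mul_cancel₀ ht.ne', one_smul]
    rw [this, norm_smul, Real.norm_eq_abs, abs_of_pos (inv_pos.2 ht)]
  rw [h1, Real.mul_rpow (by positivity) (norm_nonneg _), Real.inv_rpow ht.le, Real.rpow_neg ht.le]

theorem Phi_nonneg {d : ℕ} (hd : 1 ≤ d) (s p t : ℝ) (h0 : 0 < t) (h1 : t < 1) : 0 ≤ Phi d s p t := by
  unfold Phi
  have hd' : (1:ℝ) ≤ d := by exact_mod_cast hd
  split_ifs with h
  · have : 0 < 1 - t := by linarith
    positivity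
  · have : (1:ℝ) < d := by
      have : 1 < d := by omega
      exact_mod_cast this
    refine mul_nonneg (div_nonneg (by positivity) (Real.Gamma_pos_of_pos (by linarith)).le) ?_
    refine intervalIntegral.integral_nonneg (by norm_num) fun r hr => ?_
    have : 0 ≤ 1 - r ^ 2 := by nlinarith [hr.1, hr.2]
    have : 0 ≤ 1 - 2 * t * r + t ^ 2 := by nlinarith [sq_nonneg (t - r)]
    positivity

theorem PhiT_inner (n : ℕ) (a t : ℝ) : PhiT n a t =
      ∫⁻ φ : SS (n+1), (fun r => ENNReal.ofReal ((1 - 2 * t * r + t ^ 2) ^ (a / 2)))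
        (inner ℝ (EuclideanSpace.single 0 1 : EE (n+1)) (φ : EE (n+1))) ∂sg (n+1) := by
  have he : ‖(EuclideanSpace.single 0 1 : EE (n+1))‖ = 1 := by simp
  unfold PhiT
  refine lintegral_congr fun φ => ?_
  have hφ : ‖(φ : EE (n+1))‖ = 1 := norm_eq_of_mem_sphere φ
  rw [norm_kernel a t (EuclideanSpace.single 0 1 : EE (n+1)) φ he hφ]

theorem Phi_le {n : ℕ} {s p t : ℝ} (h0 : 0 < t) (h1 : t < 1) :
    ENNReal.ofReal (Phi (n+1) s p t) ≤ PhiT n (-((n+1 : ℕ):ℝ) - s * p) t := by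
  obtain ⟨a, ha⟩ : ∃ a, a = -((n+1 : ℕ):ℝ) - s * p := ⟨_, rfl⟩
  rw [← ha]
  have he : ‖(EuclideanSpace.single 0 1 : EE (n+1))‖ = 1 := by simp
  have hf : Measurable (fun r : ℝ => ENNReal.ofReal ((1 - 2 * t * r + t ^ 2) ^ (a / 2))) := by fun_prop
  rw [PhiT_inner]
  rcases Nat.eq_zero_or_pos n with rfl | hn
  · rw [sphere_one _ he _ hf]
    simp only [Phi, zero_add, if_true]
    have h3 : 0 < 1 - t := by linarith
    rw [← ENNReal.ofReal_add]
    · refine le_of_eq ?_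
      congr 2
      · have : 1 - 2 * t * 1 + t ^ 2 = (1 - t) ^ (2:ℝ) := by rw [Real.rpow_two]; ring
        rw [this, ← Real.rpow_mul h3.le]
        congr 1; rw [ha]; push_cast; ring
      · have : 1 - 2 * t * (-1) + t ^ 2 = (1 + t) ^ (2:ℝ) := by rw [Real.rpow_two]; ring
        rw [this, ← Real.rpow_mul (by positivity)]
        congr 1; rw [ha]; push_cast; ring
    · exact Real.rpow_nonneg (by nlinarith) _
    · exact Real.rpow_nonneg (by nlinarith) _
  · rw [sphere_ge_two hn _ he _ hf, toSphere_val hn]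
    have hn' : (0:ℝ) < n := by exact_mod_cast hn
    have hne : ¬ (n + 1 = 1) := by omega
    simp only [Phi, if_neg hne]
    have e1 : (((n+1:ℕ):ℝ) - 1) / 2 = (n:ℝ) / 2 := by push_cast; ring
    have e2 : (((n+1:ℕ):ℝ) - 3) / 2 = ((n:ℝ) - 2) / 2 := by push_cast; ring
    have e3 : -(((n+1:ℕ):ℝ) + s * p) / 2 = a / 2 := by rw [ha]; ring
    rw [e1, e2, e3, ENNReal.ofReal_mul (div_nonneg (by positivity) (Real.Gamma_pos_of_pos (by positivity)).le)]
    gcongr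
    rw [intervalIntegral.integral_of_le (by norm_num),
      integral_Ioc_eq_integral_Ioo]
    refine (ofReal_int_le _ _ ?_).trans (le_of_eq ?_)
    · filter_upwards [ae_restrict_mem measurableSet_Ioo] with r hr
      have : 0 ≤ 1 - r ^ 2 := by nlinarith [hr.1, hr.2]
      have : 0 ≤ 1 - 2 * t * r + t ^ 2 := by nlinarith [sq_nonneg (t - r)]
      simp only [Pi.zero_apply]
      positivity
    · refine setLIntegral_congr_fun measurableSet_Ioo fun r hr => ?_
      have : 0 ≤ 1 - r ^ 2 := by nlinarith [hr.1, hr.2]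
      exact ENNReal.ofReal_mul (by positivity)

end HardyTL
namespace HardyTL

theorem jensen {Y : Type*} [MeasurableSpace Y] (ρ : Measure Y) (f k : Y → ℝ≥0∞) (hf : Measurable f)
    (hk : Measurable k) {p q : ℝ} (hq : 0 < q) (hpq : q ≤ p) :
    ∫⁻ y, f y ^ q * k y ∂ρ ≤ (∫⁻ y, f y ^ p * k y ∂ρ) ^ (q / p) * (∫⁻ y, k y ∂ρ) ^ (1 - q / p) := by
  have hp : 0 < p := hq.trans_le hpq
  have h1 : q / p ≤ 1 := (div_le_one hp).2 hpq
  have h0 : 0 ≤ q / p := by positivity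
  refine le_trans (le_of_eq ?_) (ENNReal.lintegral_mul_norm_pow_le
    ((hf.pow_const p).mul hk).aemeasurable hk.aemeasurable h0 (sub_nonneg.2 h1) (by ring))
  refine lintegral_congr fun y => ?_
  simp only [Pi.mul_apply]
  rw [ENNReal.mul_rpow_of_nonneg _ _ h0, ← ENNReal.rpow_mul, mul_div_cancel₀ _ hp.ne', mul_assoc,
    ← ENNReal.rpow_add_of_nonneg _ _ h0 (sub_nonneg.2 h1)]
  simp

theorem rev_triangle {Y : Type*} [MeasurableSpace Y] (ρ : Measure Y) (f g h : Y → ℝ≥0∞)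
    (hf : Measurable f) (hg : Measurable g) (hh : Measurable h) (h1 : ∀ y, f y ≤ h y + g y)
    (h2 : ∀ y, g y ≤ h y + f y) {q : ℝ} (hq : 1 ≤ q) (A : ℝ≥0∞) (hA : A ≠ ∞) (τ : ℝ) (hτ : 0 ≤ τ)
    (hfA : ∫⁻ y, f y ^ q ∂ρ = A) (hgA : ∫⁻ y, g y ^ q ∂ρ = ENNReal.ofReal (τ ^ q) * A) :
    ENNReal.ofReal (|1 - τ| ^ q) * A ≤ ∫⁻ y, h y ^ q ∂ρ := by
  have hq0 : 0 < q := by linarith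
  set B := A ^ (1 / q) with hB
  set D := (∫⁻ y, h y ^ q ∂ρ) ^ (1 / q) with hD
  have hBt : B ≠ ∞ := ENNReal.rpow_ne_top_of_nonneg (by positivity) hA
  have hgB : (∫⁻ y, g y ^ q ∂ρ) ^ (1 / q) = ENNReal.ofReal τ * B := by
    rw [hgA, ENNReal.mul_rpow_of_nonneg _ _ (by positivity), ← ENNReal.ofReal_rpow_of_nonneg hτ hq0.le,
      ← ENNReal.rpow_mul, mul_one_div_cancel hq0.ne', ENNReal.rpow_one]
  have hgBt : ENNReal.ofReal τ * B ≠ ∞ := ENNReal.mul_ne_top ENNReal.ofReal_ne_top hBt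
  have k1 : B ≤ D + ENNReal.ofReal τ * B := by
    rw [← hgB, hB, ← hfA]
    refine le_trans ?_ (ENNReal.lintegral_Lp_add_le hh.aemeasurable hg.aemeasurable hq)
    gcongr with y
    exact h1 y
  have k2 : ENNReal.ofReal τ * B ≤ D + B := by
    rw [← hgB, hB, ← hfA]
    refine le_trans ?_ (ENNReal.lintegral_Lp_add_le hh.aemeasurable hf.aemeasurable hq)
    gcongr with y
    exact h2 y
  have k3 : ENNReal.ofReal |1 - τ| * B ≤ D := by
    rcases le_total τ 1 with h | h
    · rw [abs_of_nonneg (by linarith)]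
      refine (ENNReal.add_le_add_iff_right hgBt).1 ?_
      rw [← add_mul, ← ENNReal.ofReal_add (by linarith) hτ]
      simpa using k1
    · rw [abs_of_nonpos (by linarith)]
      refine (ENNReal.add_le_add_iff_right hBt).1 ?_
      nth_rewrite 2 [← one_mul B]
      rw [← add_mul, ← ENNReal.ofReal_one, ← ENNReal.ofReal_add (by linarith) (by linarith)]
      simpa using k2
  have k4 := ENNReal.rpow_le_rpow k3 hq0.le
  rw [ENNReal.mul_rpow_of_nonneg _ _ hq0.le, hB, hD, ← ENNReal.rpow_mul, ← ENNReal.rpow_mul,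
    one_div_mul_cancel hq0.ne', ENNReal.rpow_one, ENNReal.rpow_one,
    ENNReal.ofReal_rpow_of_nonneg (abs_nonneg _) hq0.le] at k4
  exact k4

/-- The angular kernel. -/
def ker (n : ℕ) (a t : ℝ) (x : EE (n+1)) (φ : SS (n+1)) : ℝ≥0∞ :=
  ENNReal.ofReal (‖‖x‖⁻¹ • x - t • (φ : EE (n+1))‖ ^ a)

theorem ker_meas (n : ℕ) (a : ℝ) :
    Measurable fun z : (EE (n+1) × ℝ) × SS (n+1) => ker n a z.1.2 z.1.1 z.2 := by
  unfold ker
  fun_prop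

theorem ker_smul {n : ℕ} (a t r : ℝ) (hr : 0 < r) (θ φ : SS (n+1)) :
    ker n a t (r • (θ : EE (n+1))) φ = ENNReal.ofReal (‖(θ : EE (n+1)) - t • (φ : EE (n+1))‖ ^ a) := by
  unfold ker
  have : ‖r • (θ : EE (n+1))‖ = r := by
    rw [norm_smul, norm_eq_of_mem_sphere, mul_one, Real.norm_eq_abs, abs_of_pos hr]
  rw [this, smul_smul, inv_mul_cancel₀ hr.ne', one_smul]

theorem ker_int {n : ℕ} (a t : ℝ) (x : EE (n+1)) (hx : x ≠ 0) :
    ∫⁻ φ, ker n a t x φ ∂sg (n+1) = PhiT n a t := by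
  unfold ker
  refine PhiT_eq a t _ ?_
  rw [norm_smul, norm_inv, norm_norm, inv_mul_cancel₀ (norm_ne_zero_iff.2 hx)]

theorem norm_rs {n : ℕ} {r : ℝ} (hr : 0 < r) (φ : SS (n+1)) : ‖r • (φ : EE (n+1))‖ = r := by
  rw [norm_smul, norm_eq_of_mem_sphere, mul_one, Real.norm_eq_abs, abs_of_pos hr]

theorem polarE {n : ℕ} (g : EE (n+1) → ℝ≥0∞) (hg : Measurable g) :
    ∫⁻ y, g y = ∫⁻ r in Ioi (0:ℝ), ENNReal.ofReal (r ^ n) *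
      ∫⁻ φ : SS (n+1), g (r • (φ:EE (n+1))) ∂sg (n+1) := by
  rw [polar volume g hg, finrank_euclideanSpace_fin, Nat.add_sub_cancel]

theorem transported {n : ℕ} (a e t : ℝ) (ht : 0 < t) (V : EE (n+1) → ℝ≥0∞) (hV : Measurable V) :
    ∫⁻ x, (∫⁻ φ : SS (n+1), V ((t * ‖x‖) • (φ : EE (n+1))) * ker n a t x φ ∂sg (n+1)) * ENNReal.ofReal (‖x‖ ^ e)
    = ENNReal.ofReal (t ^ (-((n+1 : ℕ) + e))) * (PhiT n a t * ∫⁻ x, V x * ENNReal.ofReal (‖x‖ ^ e)) := by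
  have hk : Measurable fun z : EE (n+1) × SS (n+1) => ker n a t z.1 z.2 := by
    unfold ker; fun_prop
  have hVm : Measurable fun z : EE (n+1) × SS (n+1) => V ((t * ‖z.1‖) • (z.2 : EE (n+1))) :=
    hV.comp (by fun_prop)
  have hin : Measurable fun x : EE (n+1) =>
      ∫⁻ φ : SS (n+1), V ((t * ‖x‖) • (φ : EE (n+1))) * ker n a t x φ ∂sg (n+1) :=
    (hVm.mul hk).lintegral_prod_right'
  rw [polarE (fun x : EE (n+1) => (∫⁻ φ : SS (n+1), V ((t * ‖x‖) • (φ : EE (n+1))) * ker n a t x φ ∂sg (n+1))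
      * ENNReal.ofReal (‖x‖ ^ e)) (hin.mul (by fun_prop)),
    polarE (fun x => V x * ENNReal.ofReal (‖x‖ ^ e)) (hV.mul (by fun_prop))]
  have hVr : ∀ r : ℝ, Measurable fun φ : SS (n+1) => V (r • (φ : EE (n+1))) :=
    fun r => hV.comp (by fun_prop)
  have hW : Measurable fun r : ℝ => ∫⁻ φ : SS (n+1), V (r • (φ : EE (n+1))) ∂sg (n+1) := by
    refine Measurable.lintegral_prod_right (f := fun (r : ℝ) (φ : SS (n+1)) => V (r • (φ : EE (n+1)))) ?_
    exact hV.comp (by fun_prop)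
  have hl : ∀ r ∈ Ioi (0:ℝ), ENNReal.ofReal (r ^ n) * ∫⁻ θ : SS (n+1),
      (∫⁻ φ : SS (n+1), V ((t * ‖r • (θ : EE (n+1))‖) • (φ : EE (n+1))) * ker n a t (r • (θ : EE (n+1))) φ ∂sg (n+1))
        * ENNReal.ofReal (‖r • (θ : EE (n+1))‖ ^ e) ∂sg (n+1)
      = PhiT n a t * (ENNReal.ofReal (r ^ n) * (ENNReal.ofReal (r ^ e) *
        ∫⁻ φ : SS (n+1), V ((t * r) • (φ : EE (n+1))) ∂sg (n+1))) := by
    intro r (hr : 0 < r)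
    simp only [norm_rs hr, ker_smul a t r hr]
    have hm1 : Measurable fun z : SS (n+1) × SS (n+1) => V ((t * r) • (z.2 : EE (n+1))) *
        ENNReal.ofReal (‖(z.1 : EE (n+1)) - t • (z.2 : EE (n+1))‖ ^ a) := by
      refine Measurable.mul (hV.comp (by fun_prop)) (by fun_prop)
    rw [lintegral_mul_const _ hm1.lintegral_prod_right', lintegral_lintegral_swap hm1.aemeasurable]
    have : ∀ φ : SS (n+1), ∫⁻ θ : SS (n+1), V ((t * r) • (φ : EE (n+1))) *
        ENNReal.ofReal (‖(θ : EE (n+1)) - t • (φ : EE (n+1))‖ ^ a) ∂sg (n+1)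
        = V ((t * r) • (φ : EE (n+1))) * PhiT n a t := by
      intro φ
      have hφ : ‖(φ : EE (n+1))‖ = 1 := norm_eq_of_mem_sphere φ
      rw [lintegral_const_mul _ (by fun_prop), PhiT_eq' a t (φ : EE (n+1)) hφ]
    simp only [this]
    rw [lintegral_mul_const _ (hVr _)]
    ring
  rw [setLIntegral_congr_fun measurableSet_Ioi hl, lintegral_const_mul]
  swap
  · refine Measurable.mul (by fun_prop) (Measurable.mul (by fun_prop) (hW.comp (by fun_prop)))
  rw [← mul_assoc, mul_comm (ENNReal.ofReal _) (PhiT n a t), mul_assoc]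
  congr 1
  rw [scale_Ioi t ht (fun r => ENNReal.ofReal (r ^ n) * ∫⁻ φ : SS (n+1), V (r • (φ : EE (n+1))) *
      ENNReal.ofReal (‖r • (φ : EE (n+1))‖ ^ e) ∂sg (n+1)),
    ← lintegral_const_mul' _ _ ENNReal.ofReal_ne_top,
    ← lintegral_const_mul' _ _ ENNReal.ofReal_ne_top]
  refine setLIntegral_congr_fun measurableSet_Ioi fun r (hr : 0 < r) => ?_
  have htr : 0 < t * r := mul_pos ht hr
  simp only [norm_rs htr]
  rw [lintegral_mul_const _ (hVr _)]
  rw [mul_comm (lintegral _ _) (ENNReal.ofReal ((t * r) ^ e))]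
  simp only [← mul_assoc]
  congr 1
  rw [← ENNReal.ofReal_mul (by positivity), ← ENNReal.ofReal_mul (by positivity),
    ← ENNReal.ofReal_mul (by positivity), ← ENNReal.ofReal_mul (by positivity)]
  congr 1
  rw [Real.mul_rpow ht.le hr.le, mul_pow, Real.rpow_neg ht.le, Real.rpow_add ht, Real.rpow_natCast, pow_succ]
  have : 0 < t ^ e := Real.rpow_pos_of_pos ht e
  field_simp

end HardyTL
namespace HardyTL

/-- The angular average. -/
def GG (n : ℕ) (a p : ℝ) (u : EE (n+1) → ℝ) (x : EE (n+1)) (t : ℝ) : ℝ≥0∞ :=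
  ∫⁻ φ : SS (n+1), ENNReal.ofReal |u x - u ((t * ‖x‖) • (φ : EE (n+1)))| ^ p * ker n a t x φ ∂sg (n+1)

theorem GG_meas (n : ℕ) (a p : ℝ) (u : EE (n+1) → ℝ) (hu : Measurable u) :
    Measurable fun z : EE (n+1) × ℝ => GG n a p u z.1 z.2 := by
  unfold GG
  refine Measurable.lintegral_prod_right' (f := fun z : (EE (n+1) × ℝ) × SS (n+1) =>
    ENNReal.ofReal |u z.1.1 - u ((z.1.2 * ‖z.1.1‖) • (z.2 : EE (n+1)))| ^ p * ker n a z.1.2 z.1.1 z.2) ?_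
  refine Measurable.mul ?_ (ker_meas n a)
  have h1 : Measurable fun z : (EE (n+1) × ℝ) × SS (n+1) => u z.1.1 := hu.comp (by fun_prop)
  have h2 : Measurable fun z : (EE (n+1) × ℝ) × SS (n+1) =>
    u ((z.1.2 * ‖z.1.1‖) • (z.2 : EE (n+1))) := hu.comp (by fun_prop)
  have h3 : Measurable fun z : (EE (n+1) × ℝ) × SS (n+1) =>
    |u z.1.1 - u ((z.1.2 * ‖z.1.1‖) • (z.2 : EE (n+1)))| := continuous_abs.measurable.comp (h1.sub h2)
  exact (ENNReal.measurable_ofReal.comp h3).pow_const p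

theorem inner_polar {n : ℕ} (a p β : ℝ) (hp : 0 ≤ p) (u : EE (n+1) → ℝ) (hu : Measurable u)
    (x : EE (n+1)) (hx : x ≠ 0) :
    ∫⁻ y, ENNReal.ofReal (|u x - u y| ^ p * ‖x - y‖ ^ a * ‖y‖ ^ β)
    = ENNReal.ofReal (‖x‖ ^ (((n+1 : ℕ) : ℝ) + a + β)) *
      ∫⁻ t in Ioi (0:ℝ), ENNReal.ofReal (t ^ ((n:ℝ) + β)) * GG n a p u x t := by
  have hx0 : 0 < ‖x‖ := norm_pos_iff.2 hx
  have hm : Measurable fun y => |u x - u y| := continuous_abs.measurable.comp (measurable_const.sub hu)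
  rw [polarE (fun y => ENNReal.ofReal (|u x - u y| ^ p * ‖x - y‖ ^ a * ‖y‖ ^ β))
    (ENNReal.measurable_ofReal.comp (((hm.pow_const p).mul (by fun_prop)).mul (by fun_prop)))]
  rw [scale_Ioi ‖x‖ hx0, ← lintegral_const_mul' _ _ ENNReal.ofReal_ne_top,
    ← lintegral_const_mul' _ _ ENNReal.ofReal_ne_top]
  refine setLIntegral_congr_fun measurableSet_Ioi fun t (ht : 0 < t) => ?_
  have key : ∀ φ : SS (n+1), ENNReal.ofReal (|u x - u ((‖x‖ * t) • (φ : EE (n+1)))| ^ p *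
      ‖x - (‖x‖ * t) • (φ : EE (n+1))‖ ^ a * ‖(‖x‖ * t) • (φ : EE (n+1))‖ ^ β)
      = ENNReal.ofReal (‖x‖ ^ a * (‖x‖ * t) ^ β) *
        (ENNReal.ofReal |u x - u ((t * ‖x‖) • (φ : EE (n+1)))| ^ p * ker n a t x φ) := by
    intro φ
    have h1 : ‖x - (‖x‖ * t) • (φ : EE (n+1))‖ = ‖x‖ * ‖‖x‖⁻¹ • x - t • (φ : EE (n+1))‖ := by
      conv_rhs => rw [← norm_norm x, ← norm_smul, norm_norm, smul_sub, smul_smul, smul_smul,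
        mul_inv_cancel₀ hx0.ne', one_smul]
    rw [h1, norm_rs (mul_pos hx0 ht), mul_comm ‖x‖ t, Real.mul_rpow hx0.le (norm_nonneg _), ker,
      ENNReal.ofReal_rpow_of_nonneg (abs_nonneg _) hp, ← ENNReal.ofReal_mul (by positivity),
      ← ENNReal.ofReal_mul (by positivity)]
    congr 1
    ring
  simp only [key]
  rw [lintegral_const_mul' _ _ ENNReal.ofReal_ne_top]
  change _ * (_ * (_ * GG n a p u x t)) = _
  rw [← mul_assoc, ← mul_assoc, ← mul_assoc]
  congr 1
  rw [← ENNReal.ofReal_mul (by positivity), ← ENNReal.ofReal_mul (by positivity),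
    ← ENNReal.ofReal_mul (by positivity)]
  congr 1
  rw [Real.rpow_add hx0, Real.rpow_add hx0, Real.rpow_natCast, Real.rpow_add ht, Real.rpow_natCast,
    Real.mul_rpow hx0.le ht.le, mul_pow]
  ring

theorem J_bound {n : ℕ} (a e t p q : ℝ) (ha : a ≤ 0) (ht : 0 < t) (ht1 : t ≠ 1) (hq : 1 ≤ q) (hpq : q ≤ p)
    (u : EE (n+1) → ℝ) (hu : Measurable u)
    (hN : ∫⁻ x, ENNReal.ofReal |u x| ^ q * ENNReal.ofReal (‖x‖ ^ e) ≠ ∞) :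
    PhiT n a t ^ (q / p) * ENNReal.ofReal (|1 - t ^ (-(((n+1 : ℕ) : ℝ) + e) / q)| ^ q) *
      (∫⁻ x, ENNReal.ofReal |u x| ^ q * ENNReal.ofReal (‖x‖ ^ e))
    ≤ ∫⁻ x, ENNReal.ofReal (‖x‖ ^ e) * GG n a p u x t ^ (q / p) := by
  have hq0 : 0 < q := by linarith
  have hp0 : 0 < p := by linarith
  set N := ∫⁻ x, ENNReal.ofReal |u x| ^ q * ENNReal.ofReal (‖x‖ ^ e) with hNdef
  set F := PhiT n a t with hF
  have hFt : F ≠ ∞ := PhiT_ne_top ha ht ht1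
  have hk : Measurable fun z : EE (n+1) × SS (n+1) => ker n a t z.1 z.2 := by
    unfold ker; fun_prop
  have hw : Measurable fun z : EE (n+1) × SS (n+1) => ker n a t z.1 z.2 * ENNReal.ofReal (‖z.1‖ ^ e) :=
    hk.mul (by fun_prop)
  set ρ : Measure (EE (n+1) × SS (n+1)) := ((volume : Measure (EE (n+1))).prod (sg (n+1))).withDensity
    (fun z => ker n a t z.1 z.2 * ENNReal.ofReal (‖z.1‖ ^ e)) with hρ
  have hIntegral : ∀ f : EE (n+1) × SS (n+1) → ℝ≥0∞, Measurable f → ∫⁻ z, f z ∂ρ =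
      ∫⁻ x, (∫⁻ φ : SS (n+1), f (x, φ) * ker n a t x φ ∂sg (n+1)) * ENNReal.ofReal (‖x‖ ^ e) := by
    intro f hf
    rw [hρ, lintegral_withDensity_eq_lintegral_mul _ hw hf, lintegral_prod _ (hw.mul hf).aemeasurable]
    refine lintegral_congr fun x => ?_
    rw [← lintegral_mul_const' _ _ ENNReal.ofReal_ne_top]
    refine lintegral_congr fun φ => ?_
    simp only [Pi.mul_apply]
    ring
  have h1 : Measurable fun z : EE (n+1) × SS (n+1) => u z.1 := hu.comp (by fun_prop)
  have h2 : Measurable fun z : EE (n+1) × SS (n+1) =>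
    u ((t * ‖z.1‖) • (z.2 : EE (n+1))) := hu.comp (by fun_prop)
  have hfm : Measurable fun z : EE (n+1) × SS (n+1) => ENNReal.ofReal |u z.1| :=
    ENNReal.measurable_ofReal.comp (continuous_abs.measurable.comp h1)
  have hgm : Measurable fun z : EE (n+1) × SS (n+1) => ENNReal.ofReal |u ((t * ‖z.1‖) • (z.2 : EE (n+1)))| :=
    ENNReal.measurable_ofReal.comp (continuous_abs.measurable.comp h2)
  have hhm : Measurable fun z : EE (n+1) × SS (n+1) =>
      ENNReal.ofReal |u z.1 - u ((t * ‖z.1‖) • (z.2 : EE (n+1)))| :=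
    ENNReal.measurable_ofReal.comp (continuous_abs.measurable.comp (h1.sub h2))
  have hne : ∀ᵐ x : EE (n+1), x ≠ 0 := by
    rw [ae_iff]; simp
  have hA : F * N ≠ ∞ := ENNReal.mul_ne_top hFt hN
  have tri := rev_triangle ρ _ _ _ hfm hgm hhm
    (fun z => by
      rw [← ENNReal.ofReal_add (abs_nonneg _) (abs_nonneg _)]
      refine ENNReal.ofReal_le_ofReal ?_
      have := abs_add_le (u z.1 - u ((t * ‖z.1‖) • (z.2 : EE (n+1)))) (u ((t * ‖z.1‖) • (z.2 : EE (n+1))))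
      simpa using this)
    (fun z => by
      rw [← ENNReal.ofReal_add (abs_nonneg _) (abs_nonneg _)]
      refine ENNReal.ofReal_le_ofReal ?_
      have := abs_add_le (u ((t * ‖z.1‖) • (z.2 : EE (n+1))) - u z.1) (u z.1)
      rw [abs_sub_comm] at this
      simpa using this)
    hq (F * N) hA (t ^ (-(((n+1 : ℕ) : ℝ) + e) / q)) (by positivity)
    (by
      rw [hIntegral _ (hfm.pow_const q), hNdef, ← lintegral_const_mul' _ _ hFt]
      refine lintegral_congr_ae ?_
      filter_upwards [hne] with x hx
      rw [lintegral_const_mul' _ _ (ENNReal.rpow_ne_top_of_nonneg hq0.le ENNReal.ofReal_ne_top),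
        ker_int a t x hx]
      ring)
    (by
      rw [hIntegral _ (hgm.pow_const q), ← Real.rpow_mul ht.le, div_mul_cancel₀ _ hq0.ne']
      exact transported a e t ht (fun x => ENNReal.ofReal |u x| ^ q)
        ((ENNReal.measurable_ofReal.comp (continuous_abs.measurable.comp hu)).pow_const q))
  rw [hIntegral _ (hhm.pow_const q)] at tri
  have step : ∫⁻ x, (∫⁻ φ : SS (n+1), ENNReal.ofReal |u x - u ((t * ‖x‖) • (φ : EE (n+1)))| ^ q *
      ker n a t x φ ∂sg (n+1)) * ENNReal.ofReal (‖x‖ ^ e)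
      ≤ F ^ (1 - q / p) * ∫⁻ x, ENNReal.ofReal (‖x‖ ^ e) * GG n a p u x t ^ (q / p) := by
    have hFt' : F ^ (1 - q / p) ≠ ∞ := ENNReal.rpow_ne_top_of_nonneg
      (sub_nonneg.2 ((div_le_one hp0).2 hpq)) hFt
    rw [← lintegral_const_mul' _ _ hFt']
    refine lintegral_mono_ae ?_
    filter_upwards [hne] with x hx
    have m1 : Measurable fun φ : SS (n+1) => u ((t * ‖x‖) • (φ : EE (n+1))) := hu.comp (by fun_prop)
    have m2 : Measurable fun φ : SS (n+1) => ENNReal.ofReal |u x - u ((t * ‖x‖) • (φ : EE (n+1)))| :=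
      ENNReal.measurable_ofReal.comp (continuous_abs.measurable.comp (measurable_const.sub m1))
    have m3 : Measurable fun φ : SS (n+1) => ker n a t x φ := by unfold ker; fun_prop
    have hj := jensen (sg (n+1)) (fun φ : SS (n+1) => ENNReal.ofReal |u x - u ((t * ‖x‖) • (φ : EE (n+1)))|)
      (fun φ => ker n a t x φ) m2 m3 hq0 hpq
    rw [ker_int a t x hx] at hj
    calc _ ≤ GG n a p u x t ^ (q / p) * F ^ (1 - q / p) * ENNReal.ofReal (‖x‖ ^ e) := by
          gcongr; exact hj
      _ = _ := by ring
  have tot := tri.trans step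
  by_cases hF0 : F = 0
  · rw [hF0, ENNReal.zero_rpow_of_pos (by positivity)]; simp
  · have hsplit : F = F ^ (1 - q / p) * F ^ (q / p) := by
      rw [← ENNReal.rpow_add _ _ hF0 hFt]; simp
    refine (ENNReal.mul_le_mul_iff_right (a := F ^ (1 - q / p)) ?_ ?_).1 ?_
    · exact (ENNReal.rpow_pos (pos_iff_ne_zero.2 hF0) hFt).ne'
    · exact ENNReal.rpow_ne_top_of_nonneg (sub_nonneg.2 ((div_le_one hp0).2 hpq)) hFt
    · refine le_trans (le_of_eq ?_) tot
      conv_rhs => rw [hsplit]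
      ring

end HardyTL
namespace HardyTL

theorem N_fin {n : ℕ} (e q : ℝ) (hq : 0 < q) (u : EE (n+1) → ℝ) (hu : Continuous u)
    (hc : HasCompactSupport u) (h : -((n+1 : ℕ) : ℝ) < e ∨ (0 : EE (n+1)) ∉ tsupport u) :
    ∫⁻ x, ENNReal.ofReal |u x| ^ q * ENNReal.ofReal (‖x‖ ^ e) ≠ ∞ := by
  have hcu : Continuous fun x => |u x| ^ q := hu.abs.rpow_const (fun _ => Or.inr hq.le)
  have hI : IntegrableOn (fun x => |u x| ^ q * ‖x‖ ^ e) (tsupport u) := by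
    rcases h with h | h
    · obtain ⟨M, hM⟩ := hc.exists_bound_of_continuous hu
      refine LocallyIntegrable.integrableOn_isCompact ?_ hc
      refine locallyIntegrable_of_norm_le_rpow (C := M ^ q) (α := -e) ?_ ?_ ?_ ?_
      · rw [finrank_euclideanSpace_fin]; omega
      · rw [finrank_euclideanSpace_fin]; linarith
      · refine Filter.Eventually.of_forall fun x => ?_
        rw [neg_neg, Real.norm_eq_abs, abs_of_nonneg (by positivity)]
        gcongr
        exact hM x
      · exact (hcu.measurable.mul (by fun_prop)).aestronglyMeasurable
    · refine ContinuousOn.integrableOn_compact hc (hcu.continuousOn.mul ?_)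
      refine continuous_norm.continuousOn.rpow_const fun x hx => Or.inl ?_
      rw [norm_ne_zero_iff]
      rintro rfl
      exact h hx
  refine ne_of_lt (lt_of_le_of_lt (le_of_eq ?_) hI.setLIntegral_lt_top)
  rw [← lintegral_indicator (isClosed_tsupport u).measurableSet]
  refine lintegral_congr fun x => ?_
  by_cases hx : x ∈ tsupport u
  · rw [indicator_of_mem hx, ENNReal.ofReal_rpow_of_nonneg (abs_nonneg _) hq.le,
      ENNReal.ofReal_mul (by positivity)]
  · rw [indicator_of_notMem hx, image_eq_zero_of_notMem_tsupport hx]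
    simp [hq]

theorem inv_Ioi (W : ℝ → ℝ≥0∞) :
    ∫⁻ t in Ioi (1:ℝ), W t = ∫⁻ t in Ioo (0:ℝ) 1, ENNReal.ofReal ((t ^ 2)⁻¹) * W t⁻¹ := by
  have himg : (fun t : ℝ => t⁻¹) '' Ioo 0 1 = Ioi 1 := by
    ext y
    constructor
    · rintro ⟨t, ⟨h0, h1⟩, rfl⟩
      exact (one_lt_inv₀ h0).2 h1
    · intro (hy : 1 < y)
      exact ⟨y⁻¹, ⟨by positivity, inv_lt_one_of_one_lt₀ hy⟩, inv_inv y⟩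
  have := lintegral_image_eq_lintegral_abs_deriv_mul (s := Ioo (0:ℝ) 1) (f := fun t => t⁻¹)
    (f' := fun t => -(t ^ 2)⁻¹) measurableSet_Ioo
    (fun x hx => (hasDerivAt_inv hx.1.ne').hasDerivWithinAt)
    (fun x _ y _ h => inv_injective h) W
  rw [himg] at this
  rw [this]
  refine lintegral_congr fun t => ?_
  rw [abs_neg, abs_of_nonneg (by positivity)]

theorem fold {n : ℕ} (s p q α β : ℝ) (hp : 0 < p) (hq : 0 < q) :
    ENNReal.ofReal (∫ t in (0 : ℝ)..1,
              t ^ (s * p - 1) * (t ^ (-((p / q - 1) * ((n+1 : ℕ) : ℝ)) - p * α / q) + t ^ (-β)) *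
                |1 - t ^ ((((n+1 : ℕ) : ℝ) + α + q * β / p - s * q) / q)| ^ p * Phi (n+1) s p t)
    ≤ ∫⁻ t in Ioi (0:ℝ), ENNReal.ofReal (t ^ ((n:ℝ) + β)) * PhiT n (-((n+1:ℕ):ℝ) - s*p) t *
        ENNReal.ofReal (|1 - t ^ (-(((n+1 : ℕ) : ℝ) + (α + q * β / p - s * q)) / q)| ^ p) := by
  set W : ℝ → ℝ≥0∞ := fun t => ENNReal.ofReal (t ^ ((n:ℝ) + β)) * PhiT n (-((n+1:ℕ):ℝ) - s*p) t *
        ENNReal.ofReal (|1 - t ^ (-(((n+1 : ℕ) : ℝ) + (α + q * β / p - s * q)) / q)| ^ p) with hW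
  have hWm : Measurable W := by
    refine Measurable.mul (Measurable.mul (by fun_prop) (PhiT_meas n _)) ?_
    refine ENNReal.measurable_ofReal.comp (Measurable.pow_const ?_ p)
    exact continuous_abs.measurable.comp (by fun_prop)
  rw [intervalIntegral.integral_of_le zero_le_one, integral_Ioc_eq_integral_Ioo]
  have hpt : ∀ t ∈ Ioo (0:ℝ) 1, 0 ≤ t ^ (s * p - 1) * (t ^ (-((p / q - 1) * ((n+1 : ℕ) : ℝ)) - p * α / q) + t ^ (-β)) *
                |1 - t ^ ((((n+1 : ℕ) : ℝ) + α + q * β / p - s * q) / q)| ^ p * Phi (n+1) s p t := by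
    intro t ⟨h0, h1⟩
    have := Phi_nonneg (d := n+1) (by omega) s p t h0 h1
    positivity
  refine (ofReal_int_le _ _ ((ae_restrict_iff' measurableSet_Ioo).2 (Filter.Eventually.of_forall hpt))).trans ?_
  have hsub : Ioo (0:ℝ) 1 ∪ Ioi 1 ⊆ Ioi 0 := by
    rintro t (h | h)
    · exact h.1
    · exact lt_trans zero_lt_one (mem_Ioi.1 h)
  refine le_trans ?_ (lintegral_mono_set hsub)
  rw [lintegral_union measurableSet_Ioi (by
    rw [Set.disjoint_left]; intro t h h'; exact absurd h.2 (not_lt.2 (le_of_lt (mem_Ioi.1 h'))))]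
  rw [inv_Ioi, ← lintegral_add_left hWm]
  refine setLIntegral_mono' measurableSet_Ioo fun t ⟨h0, h1⟩ => ?_
  set σ := (((n+1 : ℕ) : ℝ) + α + q * β / p - s * q) / q with hσ
  have hσ' : -(((n+1 : ℕ) : ℝ) + (α + q * β / p - s * q)) / q = -σ := by rw [hσ]; ring
  simp only [hW, hσ']
  have e1 : t ^ ((n:ℝ) + β) * |1 - t ^ (-σ)| ^ p =
      t ^ (s * p - 1) * t ^ (-((p / q - 1) * ((n+1 : ℕ) : ℝ)) - p * α / q) * |1 - t ^ σ| ^ p := by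
    have h2 : |1 - t ^ (-σ)| = t ^ (-σ) * |1 - t ^ σ| := by
      have hpos : 0 < t ^ (-σ) := Real.rpow_pos_of_pos h0 _
      nth_rewrite 2 [← abs_of_pos hpos]
      rw [← abs_mul, mul_sub, ← Real.rpow_add h0, neg_add_cancel, Real.rpow_zero, mul_one, abs_sub_comm]
    rw [h2, Real.mul_rpow (by positivity) (abs_nonneg _), ← Real.rpow_mul h0.le, ← mul_assoc,
      ← Real.rpow_add h0, ← Real.rpow_add h0]
    congr 2
    rw [hσ]
    field_simp
    push_cast
    ring
  have e2 : (t ^ 2)⁻¹ * (t⁻¹ ^ ((n:ℝ) + β) * t ^ (-(-((n+1:ℕ):ℝ) - s*p)) * |1 - t⁻¹ ^ (-σ)| ^ p) =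
      t ^ (s * p - 1) * t ^ (-β) * |1 - t ^ σ| ^ p := by
    rw [Real.inv_rpow h0.le, Real.inv_rpow h0.le, ← Real.rpow_neg h0.le, ← Real.rpow_neg h0.le, neg_neg,
      ← Real.rpow_natCast, ← Real.rpow_neg h0.le, ← mul_assoc, ← Real.rpow_add h0, ← Real.rpow_add h0,
      ← Real.rpow_add h0]
    congr 2
    push_cast
    ring
  have hP := Phi_le (n := n) (s := s) (p := p) h0 h1
  have hP0 := Phi_nonneg (d := n+1) (by omega) s p t h0 h1
  rw [PhiT_inv h0]
  set F := PhiT n (-((n+1:ℕ):ℝ) - s*p) t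
  calc _ = (ENNReal.ofReal (t ^ ((n:ℝ) + β) * |1 - t ^ (-σ)| ^ p) + ENNReal.ofReal
        ((t ^ 2)⁻¹ * (t⁻¹ ^ ((n:ℝ) + β) * t ^ (-(-((n+1:ℕ):ℝ) - s*p)) * |1 - t⁻¹ ^ (-σ)| ^ p))) *
        ENNReal.ofReal (Phi (n+1) s p t) := by
        rw [e1, e2, ← ENNReal.ofReal_add (by positivity) (by positivity), ← ENNReal.ofReal_mul (by positivity)]
        congr 1
        ring
    _ ≤ (ENNReal.ofReal (t ^ ((n:ℝ) + β) * |1 - t ^ (-σ)| ^ p) + ENNReal.ofReal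
        ((t ^ 2)⁻¹ * (t⁻¹ ^ ((n:ℝ) + β) * t ^ (-(-((n+1:ℕ):ℝ) - s*p)) * |1 - t⁻¹ ^ (-σ)| ^ p))) * F := by
        gcongr
    _ = _ := by
        have i0 : 0 ≤ t⁻¹ := by positivity
        rw [ENNReal.ofReal_mul (by positivity), ENNReal.ofReal_mul (by positivity),
          ENNReal.ofReal_mul (by positivity), ENNReal.ofReal_mul (by positivity)]
        ring

end HardyTL
theorem weighted_fractional_Hardy_TriebelLizorkin (d : ℕ) (hd : 1 ≤ d) (s p q α β : ℝ)
    (hs : 0 < s) (hs1 : s < 1) (hq : 1 ≤ q) (hpq : q ≤ p)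
    (hα : α < s * q - (1 - q / p) * d) (hβ : β < s * p)
    (hα' : -(d : ℝ) < α) (hβ' : -(d : ℝ) < β) (hαβ : -(d : ℝ) < α + q * β / p)
    (u : EuclideanSpace ℝ (Fin d) → ℝ)
    (hu : (s * q - α - q * β / p < d ∧ ContDiff ℝ 1 u ∧ HasCompactSupport u) ∨
          ((d : ℝ) < s * q - α - q * β / p ∧ ContDiff ℝ 1 u ∧ HasCompactSupport u ∧
            (0 : EuclideanSpace ℝ (Fin d)) ∉ tsupport u)) :
    (∫⁻ x, (∫⁻ y, ENNReal.ofReal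
          (|u x - u y| ^ p * ‖x - y‖ ^ (-(d : ℝ) - s * p) * ‖y‖ ^ β)) ^ (q / p)
        * ENNReal.ofReal (‖x‖ ^ α))
      ≥ ENNReal.ofReal
          ((∫ t in (0 : ℝ)..1,
              t ^ (s * p - 1) * (t ^ (-((p / q - 1) * d) - p * α / q) + t ^ (-β)) *
                |1 - t ^ (((d : ℝ) + α + q * β / p - s * q) / q)| ^ p * Phi d s p t) ^ (q / p)) *
        ∫⁻ x, ENNReal.ofReal (|u x| ^ q * ‖x‖ ^ (-(s * q - α - q * β / p))) := by
  have hq0 : 0 < q := by linarith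
  have hp0 : 0 < p := by linarith
  have hqp : 0 < q / p := by positivity
  obtain ⟨n, rfl⟩ : ∃ n, d = n + 1 := ⟨d - 1, by omega⟩
  have hcont : Continuous u := by
    rcases hu with h | h
    · exact h.2.1.continuous
    · exact h.2.1.continuous
  have hcs : HasCompactSupport u := by
    rcases hu with h | h
    · exact h.2.2
    · exact h.2.2.1
  set e := α + q * β / p - s * q with he
  have hN := HardyTL.N_fin (n := n) e q hq0 u hcont hcs (by
    rcases hu with h | h
    · left; rw [he]; linarith [h.1]
    · right; exact h.2.2.2)
  have hum : Measurable u := hcont.measurable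
  set N := ∫⁻ x : HardyTL.EE (n+1), ENNReal.ofReal |u x| ^ q * ENNReal.ofReal (‖x‖ ^ e) with hNdef
  have hNeq : ∫⁻ x, ENNReal.ofReal (|u x| ^ q * ‖x‖ ^ (-(s * q - α - q * β / p))) = N := by
    refine lintegral_congr fun x => ?_
    have : -(s * q - α - q * β / p) = e := by rw [he]; ring
    rw [this, ENNReal.ofReal_mul (by positivity), ENNReal.ofReal_rpow_of_nonneg (abs_nonneg _) hq0.le]
  rw [hNeq]
  set a : ℝ := -((n+1 : ℕ) : ℝ) - s * p with ha
  have ha0 : a ≤ 0 := by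
    have h1 : 0 ≤ s * p := by positivity
    have h2 : (0:ℝ) ≤ ((n+1 : ℕ) : ℝ) := Nat.cast_nonneg _
    rw [ha]; linarith
  have hP : 1 ≤ p / q := (one_le_div hq0).2 hpq
  have hPi : 1 / (p / q) = q / p := one_div_div p q
  have hPc : q / p * (p / q) = 1 := by field_simp
  have hGm := HardyTL.GG_meas n a p u hum
  set H : HardyTL.EE (n+1) → ℝ → ℝ≥0∞ := fun x t => ENNReal.ofReal (‖x‖ ^ e) *
    (ENNReal.ofReal (t ^ ((n:ℝ) + β)) * HardyTL.GG n a p u x t) ^ (q / p) with hH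
  have hHm : Measurable (Function.uncurry H) := by
    refine Measurable.mul (f := fun z : HardyTL.EE (n+1) × ℝ => ENNReal.ofReal (‖z.1‖ ^ e))
      (g := fun z : HardyTL.EE (n+1) × ℝ =>
      (ENNReal.ofReal (z.2 ^ ((n:ℝ) + β)) * HardyTL.GG n a p u z.1 z.2) ^ (q / p)) (by fun_prop) ?_
    exact (Measurable.mul (by fun_prop) hGm).pow_const _
  have mink := HardyTL.minkowski_int (volume : Measure (HardyTL.EE (n+1)))
    ((volume : Measure ℝ).restrict (Ioi 0)) H hHm (p / q) hP
  rw [hPi] at mink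
  have hne : ∀ᵐ x : HardyTL.EE (n+1), x ≠ 0 := by
    rw [ae_iff]; simp
  have hL : ∫⁻ x, (∫⁻ t in Ioi (0:ℝ), H x t ^ (p / q)) ^ (q / p) =
      ∫⁻ x, (∫⁻ y, ENNReal.ofReal (|u x - u y| ^ p * ‖x - y‖ ^ a * ‖y‖ ^ β)) ^ (q / p)
        * ENNReal.ofReal (‖x‖ ^ α) := by
    refine lintegral_congr_ae ?_
    filter_upwards [hne] with x hx
    have hx0 : 0 < ‖x‖ := norm_pos_iff.2 hx
    rw [HardyTL.inner_polar a p β hp0.le u hum x hx]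
    have h1 : ∀ t, H x t ^ (p / q) = ENNReal.ofReal (‖x‖ ^ e) ^ (p / q) *
        (ENNReal.ofReal (t ^ ((n:ℝ) + β)) * HardyTL.GG n a p u x t) := by
      intro t
      simp only [hH]
      rw [ENNReal.mul_rpow_of_nonneg _ _ (by positivity), ← ENNReal.rpow_mul _ (q / p), hPc, ENNReal.rpow_one]
    simp only [h1]
    rw [lintegral_const_mul' _ _ (ENNReal.rpow_ne_top_of_nonneg (by positivity) ENNReal.ofReal_ne_top),
      ENNReal.mul_rpow_of_nonneg _ _ hqp.le, ENNReal.mul_rpow_of_nonneg _ _ hqp.le, ← ENNReal.rpow_mul,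
      mul_comm (p / q), hPc, ENNReal.rpow_one, mul_right_comm, ENNReal.ofReal_rpow_of_nonneg (by positivity) hqp.le,
      ← ENNReal.ofReal_mul (by positivity), ← Real.rpow_mul hx0.le, ← Real.rpow_add hx0]
    congr 4
    rw [ha, he]
    field_simp
    ring
  rw [hL] at mink
  refine le_trans ?_ mink
  have hfold := HardyTL.fold (n := n) s p q α β hp0 hq0
  have hJ : ∀ t : ℝ, 0 < t → t ≠ 1 → ENNReal.ofReal (t ^ ((n:ℝ) + β)) * HardyTL.PhiT n a t *
      ENNReal.ofReal (|1 - t ^ (-(((n+1 : ℕ) : ℝ) + e) / q)| ^ p) * N ^ (p / q) ≤ (∫⁻ x, H x t) ^ (p / q) := by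
    intro t ht ht1
    have h := HardyTL.J_bound a e t p q ha0 ht ht1 hq hpq u hum hN
    have h2 : ∫⁻ x, H x t = ENNReal.ofReal (t ^ ((n:ℝ) + β)) ^ (q / p) *
        ∫⁻ x, ENNReal.ofReal (‖x‖ ^ e) * HardyTL.GG n a p u x t ^ (q / p) := by
      rw [← lintegral_const_mul' _ _ (ENNReal.rpow_ne_top_of_nonneg hqp.le ENNReal.ofReal_ne_top)]
      refine lintegral_congr fun x => ?_
      simp only [hH]
      rw [ENNReal.mul_rpow_of_nonneg _ _ hqp.le]
      ring
    rw [h2]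
    have hPn : 0 ≤ p / q := by positivity
    calc _ = (ENNReal.ofReal (t ^ ((n:ℝ) + β)) ^ (q / p) * (HardyTL.PhiT n a t ^ (q / p) *
          ENNReal.ofReal (|1 - t ^ (-(((n+1 : ℕ) : ℝ) + e) / q)| ^ q) * N)) ^ (p / q) := by
          rw [ENNReal.mul_rpow_of_nonneg _ _ hPn, ENNReal.mul_rpow_of_nonneg _ _ hPn,
            ENNReal.mul_rpow_of_nonneg _ _ hPn, ← ENNReal.rpow_mul, ← ENNReal.rpow_mul, hPc,
            ENNReal.rpow_one, ENNReal.rpow_one, ENNReal.ofReal_rpow_of_nonneg (by positivity) hPn,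
            ← Real.rpow_mul (abs_nonneg _), mul_div_cancel₀ _ hq0.ne']
          ring
      _ ≤ _ := by gcongr
  have hIntegral : (∫⁻ t in Ioi (0:ℝ), ENNReal.ofReal (t ^ ((n:ℝ) + β)) * HardyTL.PhiT n a t *
      ENNReal.ofReal (|1 - t ^ (-(((n+1 : ℕ) : ℝ) + e) / q)| ^ p)) * N ^ (p / q)
      ≤ ∫⁻ t in Ioi (0:ℝ), (∫⁻ x, H x t) ^ (p / q) := by
    rw [← lintegral_mul_const' _ _ (ENNReal.rpow_ne_top_of_nonneg (by positivity) hN)]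
    refine lintegral_mono_ae ?_
    have h1 : ∀ᵐ t : ℝ ∂(volume.restrict (Ioi 0)), t ≠ 1 := by
      refine ae_restrict_of_ae ?_
      rw [ae_iff]; simp
    filter_upwards [h1, ae_restrict_mem measurableSet_Ioi] with t ht1 ht
    exact hJ t ht ht1
  have hfin := ENNReal.rpow_le_rpow ((mul_le_mul_left hfold (N ^ (p / q))).trans hIntegral) hqp.le
  rw [ENNReal.mul_rpow_of_nonneg _ _ hqp.le, ← ENNReal.rpow_mul, mul_comm (p / q), hPc, ENNReal.rpow_one,
    ENNReal.ofReal_rpow_of_nonneg _ hqp.le] at hfin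
  · exact hfin
  · rw [intervalIntegral.integral_of_le zero_le_one, integral_Ioc_eq_integral_Ioo]
    refine setIntegral_nonneg measurableSet_Ioo fun t ht => ?_
    have h0 : 0 < t := ht.1
    have := HardyTL.Phi_nonneg hd s p t h0 ht.2
    positivity
end
end

section
/- Let 0 < s < 1, p = q ≥ 1, d ≥ 1, α = β = 0 with sp < d. Then for every u ∈ C_c^1(ℝ^d), ∫_{ℝ^d} ∫_{ℝ^d} |u(x)−u(y)|^p |x−y|^{−d−sp} dy dx ≥ C ∫_{ℝ^d} |u(x)|^p |x|^{−sp} dx, where C = ∫_0^1 t^{sp−1} (1 + t^{−... }) ... Specifically C = 2 ∫_0^1 t^{sp−1} |1 − t^{(d−sp)/p}|^p Φ_{d,s,p}(t) dt, with Φ_{d,s,p} as the spherical kernel, and this constant is sharp. -/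
open MeasureTheory Set
open scoped ENNReal

noncomputable section

/-- The Frank–Seiringer sharp fractional Hardy constant. -/
def HardyConst (d : ℕ) (s p : ℝ) : ℝ :=
  2 * ∫ t in (0 : ℝ)..1,
    t ^ (s * p - 1) * |1 - t ^ (((d : ℝ) - s * p) / p)| ^ p * Phi d s p t

lemma hardy_lint_norm (n : ℕ) (hn : 1 ≤ n) (G : ℝ → ℝ≥0∞) (hG : Measurable G) :
    ∫⁻ x : EuclideanSpace ℝ (Fin n), G ‖x‖ =
      (n * volume (Metric.ball (0 : EuclideanSpace ℝ (Fin n)) 1)) *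
        ∫⁻ ρ in Ioi (0 : ℝ), ENNReal.ofReal (ρ ^ (n - 1)) * G ρ := by
  have : Nonempty (Fin n) := ⟨⟨0, hn⟩⟩
  set μ : Measure (EuclideanSpace ℝ (Fin n)) := volume with hμ
  have hdim : Module.finrank ℝ (EuclideanSpace ℝ (Fin n)) = n := by simp
  have h1 : ∫⁻ x, G ‖x‖ ∂μ =
      ∫⁻ x : ({(0 : EuclideanSpace ℝ (Fin n))}ᶜ : Set _), G ‖x.1‖ ∂(μ.comap (↑)) := by
    rw [lintegral_subtype_comap (measurableSet_singleton _).compl (fun x => G ‖x‖),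
      restrict_compl_singleton]
  have h2 := μ.measurePreserving_homeomorphUnitSphereProd.lintegral_comp_emb
    (Homeomorph.measurableEmbedding _) (G ∘ Subtype.val ∘ Prod.snd)
  simp only [Function.comp_def, homeomorphUnitSphereProd_apply_snd_coe] at h2
  rw [h1, h2, lintegral_prod _ (by fun_prop)]
  simp only [lintegral_const, Measure.toSphere_apply_univ, hdim]
  rw [mul_comm, Measure.volumeIoiPow, lintegral_withDensity_eq_lintegral_mul _ (by fun_prop)
    (by fun_prop)]
  congr 1
  exact lintegral_subtype_comap measurableSet_Ioi
    (fun a : ℝ => ENNReal.ofReal (a ^ (n-1)) * G a)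

lemma hardy_split (n : ℕ) (F : ℝ → ℝ → ℝ≥0∞) (hF : Measurable (Function.uncurry F)) :
    ∫⁻ x : EuclideanSpace ℝ (Fin (n+1)), F ‖x‖ (x 0) =
      ∫⁻ a : ℝ, ∫⁻ b : EuclideanSpace ℝ (Fin n), F (√(a^2 + ‖b‖^2)) a := by
  have e1 := (PiLp.volume_preserving_toLp (Fin (n+1)))
  have e2 := (volume_preserving_piFinSuccAbove (fun _ : Fin (n+1) => ℝ) 0).symm
  have e3 := (MeasurePreserving.id (volume : Measure ℝ)).prod (PiLp.volume_preserving_ofLp (Fin n))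
  have e := e1.comp (e2.comp e3)
  rw [← e.lintegral_comp (f := fun x => F ‖x‖ (x 0))]
  · rw [lintegral_prod]
    · refine lintegral_congr fun a => lintegral_congr fun b => ?_
      congr 1
      rw [EuclideanSpace.norm_eq, Fin.sum_univ_succ, EuclideanSpace.norm_sq_eq]
      simp
    · apply Measurable.aemeasurable
      refine Measurable.comp (g := fun x : EuclideanSpace ℝ (Fin (n+1)) => F ‖x‖ (x 0)) ?_ e.measurable
      exact hF.comp (f := fun x : EuclideanSpace ℝ (Fin (n+1)) => (‖x‖, x 0)) (by fun_prop)
  · exact hF.comp (f := fun x : EuclideanSpace ℝ (Fin (n+1)) => (‖x‖, x 0)) (by fun_prop)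

lemma hardy_sphere_const (n : ℕ) (hn : 1 ≤ n) :
    (n * volume (Metric.ball (0 : EuclideanSpace ℝ (Fin n)) 1)) =
      ENNReal.ofReal (2 * Real.pi ^ ((n : ℝ) / 2) / Real.Gamma ((n : ℝ) / 2)) := by
  have : Nonempty (Fin n) := ⟨⟨0, hn⟩⟩
  have hn' : (0:ℝ) < n := by exact_mod_cast hn
  rw [EuclideanSpace.volume_ball]
  simp only [ENNReal.ofReal_one, one_pow, one_mul, Fintype.card_fin]
  rw [← ENNReal.ofReal_natCast, ← ENNReal.ofReal_mul (by positivity),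
    Real.Gamma_add_one (by positivity)]
  congr 1
  have : √Real.pi ^ n = Real.pi ^ ((n:ℝ)/2) := by
    rw [Real.sqrt_eq_rpow, ← Real.rpow_natCast, ← Real.rpow_mul Real.pi_pos.le]
    congr 1; ring
  rw [this]
  have hG : Real.Gamma ((n:ℝ)/2) ≠ 0 := (Real.Gamma_pos_of_pos (by positivity)).ne'
  field_simp

/-- Slicing formula. -/
lemma hardy_slice (n : ℕ) (hn : 1 ≤ n) (F : ℝ → ℝ → ℝ≥0∞) (hF : Measurable (Function.uncurry F)) :
    ∫⁻ x : EuclideanSpace ℝ (Fin (n+1)), F ‖x‖ (x 0) =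
      ENNReal.ofReal (2 * Real.pi ^ ((n : ℝ) / 2) / Real.Gamma ((n : ℝ) / 2)) *
      ∫⁻ ρ in Ioi (0:ℝ), ENNReal.ofReal (ρ ^ n) *
        ∫⁻ r in Ioo (-1:ℝ) 1, ENNReal.ofReal ((1 - r^2) ^ (((n:ℝ) - 2)/2)) * F ρ (ρ * r) := by
  have hFm : ∀ {α : Type} [MeasurableSpace α] {f g : α → ℝ}, Measurable f → Measurable g →
      Measurable (fun x => F (f x) (g x)) := fun hf hg => hF.comp (hf.prodMk hg)
  rw [hardy_split n F hF]
  have h1 : ∀ a : ℝ, ∫⁻ b : EuclideanSpace ℝ (Fin n), F (√(a^2 + ‖b‖^2)) a =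
      (n * volume (Metric.ball (0 : EuclideanSpace ℝ (Fin n)) 1)) *
        ∫⁻ τ in Ioi (0 : ℝ), ENNReal.ofReal (τ ^ (n - 1)) * F (√(a^2 + τ^2)) a := fun a =>
    hardy_lint_norm n hn (fun τ => F (√(a^2 + τ^2)) a) (hFm (by fun_prop) (by fun_prop))
  simp_rw [h1, hardy_sphere_const n hn]
  have hm : Measurable (Function.uncurry fun a τ : ℝ =>
      (Ioi (0:ℝ)).indicator (fun τ => ENNReal.ofReal (τ ^ (n - 1)) * F (√(a^2 + τ^2)) a) τ) := by
    have : (Function.uncurry fun a τ : ℝ =>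
      (Ioi (0:ℝ)).indicator (fun τ => ENNReal.ofReal (τ ^ (n - 1)) * F (√(a^2 + τ^2)) a) τ) =
      indicator {q : ℝ × ℝ | 0 < q.2} (fun q => ENNReal.ofReal (q.2 ^ (n - 1)) * F (√(q.1^2 + q.2^2)) q.1) := by
      ext q; simp [indicator, Function.uncurry]
    rw [this]
    refine Measurable.indicator ?_ (measurableSet_lt measurable_const measurable_snd)
    exact Measurable.mul (by fun_prop) (hFm (by fun_prop) (by fun_prop))
  simp_rw [← lintegral_indicator measurableSet_Ioi]
  rw [lintegral_const_mul _ hm.lintegral_prod_right]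
  congr 1
  have h2 := lintegral_prod (μ := (volume : Measure ℝ)) (ν := (volume : Measure ℝ)) _ hm.aemeasurable
  simp only [Function.uncurry] at h2
  rw [← h2, ← Measure.volume_eq_prod, ← lintegral_comp_polarCoord_symm]
  have ht : polarCoord.target = Ioi (0:ℝ) ×ˢ Ioo (-Real.pi) Real.pi := rfl
  rw [ht, Measure.volume_eq_prod, ← Measure.prod_restrict, lintegral_prod]
  swap
  · apply Measurable.aemeasurable
    simp only [smul_eq_mul]
    refine Measurable.mul (by fun_prop) ?_
    have := hm.comp (f := polarCoord.symm) (by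
      have h : (polarCoord.symm : ℝ × ℝ → ℝ × ℝ) =
        fun q => (q.1 * Real.cos q.2, q.1 * Real.sin q.2) := rfl
      rw [h]; fun_prop)
    exact this
  rw [lintegral_indicator measurableSet_Ioi]
  refine setLIntegral_congr_fun measurableSet_Ioi fun ρ hρ => ?_
  have hρ : 0 < ρ := hρ
  simp only [polarCoord_symm_apply, smul_eq_mul]
  -- reduce to (0,π)
  have h3 : ∫⁻ φ in Ioo (-Real.pi) Real.pi, ENNReal.ofReal ρ *
      (Ioi (0:ℝ)).indicator (fun τ => ENNReal.ofReal (τ ^ (n - 1)) *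
        F (√((ρ * Real.cos φ)^2 + τ^2)) (ρ * Real.cos φ)) (ρ * Real.sin φ) =
      ∫⁻ φ in Ioo 0 Real.pi, ENNReal.ofReal (ρ^n) * (ENNReal.ofReal (Real.sin φ ^ (n-1)) *
        F ρ (ρ * Real.cos φ)) := by
    rw [← lintegral_indicator measurableSet_Ioo, ← lintegral_indicator measurableSet_Ioo]
    refine lintegral_congr fun φ => ?_
    by_cases h : φ ∈ Ioo 0 Real.pi
    · have h' : φ ∈ Ioo (-Real.pi) Real.pi := ⟨by linarith [h.1, Real.pi_pos], h.2⟩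
      have hs : 0 < Real.sin φ := Real.sin_pos_of_mem_Ioo h
      rw [indicator_of_mem h, indicator_of_mem h', indicator_of_mem (mem_Ioi.2 (mul_pos hρ hs))]
      have : √((ρ * Real.cos φ)^2 + (ρ * Real.sin φ)^2) = ρ := by
        rw [show (ρ * Real.cos φ)^2 + (ρ * Real.sin φ)^2 = ρ^2 * (Real.sin φ ^2 + Real.cos φ^2) by ring,
          Real.sin_sq_add_cos_sq, mul_one, Real.sqrt_sq hρ.le]
      rw [this, ← mul_assoc, ← mul_assoc, ← ENNReal.ofReal_mul hρ.le, ← ENNReal.ofReal_mul (by positivity)]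
      congr 2
      obtain ⟨m, rfl⟩ : ∃ m, n = m + 1 := ⟨n - 1, by omega⟩
      simp only [Nat.add_sub_cancel]; ring
    · rw [indicator_of_notMem h]
      by_cases h' : φ ∈ Ioo (-Real.pi) Real.pi
      · rw [indicator_of_mem h', indicator_of_notMem, mul_zero]
        simp only [mem_Ioi, not_lt]
        have : φ ≤ 0 := by
          by_contra hc; exact h ⟨not_le.mp hc, h'.2⟩
        have := Real.sin_nonpos_of_nonpos_of_neg_pi_le this h'.1.le
        exact mul_nonpos_of_nonneg_of_nonpos hρ.le this
      · rw [indicator_of_notMem h']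
  have hmm : Measurable (fun φ => ENNReal.ofReal (Real.sin φ ^ (n-1)) * F ρ (ρ * Real.cos φ)) :=
    Measurable.mul (by fun_prop) (hFm (by fun_prop) (by fun_prop))
  rw [h3, lintegral_const_mul _ hmm]
  congr 1
  have himg : Real.cos '' Ioo 0 Real.pi = Ioo (-1) 1 := by
    ext r; constructor
    · rintro ⟨φ, hφ, rfl⟩
      have := Real.sin_pos_of_mem_Ioo hφ
      have h4 := Real.sin_sq_add_cos_sq φ
      constructor <;> nlinarith
    · intro hr
      refine ⟨Real.arccos r, ⟨Real.arccos_pos.2 hr.2, ?_⟩, Real.cos_arccos hr.1.le hr.2.le⟩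
      refine lt_of_le_of_ne (Real.arccos_le_pi r) fun h => ?_
      rw [Real.arccos_eq_pi] at h; linarith [hr.1]
  rw [← himg, lintegral_image_eq_lintegral_abs_deriv_mul measurableSet_Ioo
    (fun x _ => (Real.hasDerivAt_cos x).hasDerivWithinAt)
    (Real.injOn_cos.mono Ioo_subset_Icc_self)]
  refine setLIntegral_congr_fun measurableSet_Ioo fun φ hφ => ?_
  have hs := Real.sin_pos_of_mem_Ioo hφ
  rw [← mul_assoc, ← ENNReal.ofReal_mul (by positivity), abs_neg, abs_of_pos hs,
    ← Real.sin_sq]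
  congr 2
  rw [← Real.rpow_natCast (Real.sin φ) 2, ← Real.rpow_mul hs.le]
  nth_rewrite 2 [← Real.rpow_one (Real.sin φ)]
  rw [← Real.rpow_add hs, ← Real.rpow_natCast]
  congr 1
  push_cast [Nat.cast_sub hn]; ring

/-- Extended-real-valued two-variable version of the angular kernel. -/
def PhiE (d : ℕ) (σ ρ R : ℝ) : ℝ≥0∞ :=
  if d = 1 then ENNReal.ofReal (|R - ρ| ^ (-1 - σ)) + ENNReal.ofReal ((R + ρ) ^ (-1 - σ))
  else ENNReal.ofReal (2 * Real.pi ^ (((d : ℝ) - 1) / 2) / Real.Gamma (((d : ℝ) - 1) / 2)) *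
    ∫⁻ r in Ioo (-1 : ℝ) 1, ENNReal.ofReal
      ((1 - r ^ 2) ^ (((d : ℝ) - 3) / 2) * (R ^ 2 - 2 * R * ρ * r + ρ ^ 2) ^ (-((d : ℝ) + σ) / 2))

lemma hardy_rot (n : ℕ) (σ : ℝ) (y : EuclideanSpace ℝ (Fin (n+1))) (G : ℝ → ℝ≥0∞) :
    ∫⁻ x, G ‖x‖ * ENNReal.ofReal (‖x - y‖ ^ (-((n+1 : ℕ) : ℝ) - σ)) =
    ∫⁻ x : EuclideanSpace ℝ (Fin (n+1)), G ‖x‖ *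
      ENNReal.ofReal ((‖y‖ ^ 2 - 2 * ‖y‖ * x 0 + ‖x‖ ^ 2) ^ (-(((n+1 : ℕ) : ℝ) + σ) / 2)) := by
  set v : EuclideanSpace ℝ (Fin (n+1)) := EuclideanSpace.single 0 ‖y‖ with hv
  have hvn : ‖v‖ = ‖y‖ := by simp [hv]
  set T := (Submodule.reflection (ℝ ∙ (v - y))ᗮ) with hT
  have hTv : T v = y := Submodule.reflection_sub hvn
  rw [← T.measurePreserving.lintegral_comp_emb T.toHomeomorph.measurableEmbedding]
  refine lintegral_congr fun x => ?_
  rw [← hTv, ← map_sub, T.norm_map, T.norm_map, T.norm_map, hvn]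
  have h2 : ‖y‖ ^ 2 - 2 * ‖y‖ * x 0 + ‖x‖ ^ 2 = ‖x - v‖ ^ 2 := by
    rw [norm_sub_sq_real, hvn, hv, EuclideanSpace.inner_single_right]
    simp; ring
  rw [h2, ← Real.rpow_natCast, ← Real.rpow_mul (norm_nonneg _)]
  congr 3
  push_cast; ring

lemma hardy_vol_E0 : volume (univ : Set (EuclideanSpace ℝ (Fin 0))) = 1 := by
  have := (PiLp.volume_preserving_ofLp (Fin 0)).measure_preimage (s := univ) (by simp)
  simp only [preimage_univ] at this
  rw [this, volume_pi, Measure.pi_univ]; simp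

lemma hardy_line (f : ℝ → ℝ≥0∞) (hf : Measurable f) :
    ∫⁻ a, f a = ∫⁻ ρ in Ioi (0:ℝ), (f ρ + f (-ρ)) := by
  rw [lintegral_add_left hf, ← lintegral_add_compl f (measurableSet_Ioi (a := (0:ℝ)))]
  congr 1
  rw [compl_Ioi, setLIntegral_congr Iio_ae_eq_Iic.symm]
  have : Iio (0:ℝ) = (fun x => -x) '' Ioi 0 := by simp
  rw [this, lintegral_image_eq_lintegral_abs_deriv_mul measurableSet_Ioi
    (fun x _ => (hasDerivAt_neg x).hasDerivWithinAt) neg_injective.injOn]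
  simp

lemma hardy_polar (d : ℕ) (hd : 1 ≤ d) (σ : ℝ) (y : EuclideanSpace ℝ (Fin d))
    (G : ℝ → ℝ≥0∞) (hG : Measurable G) :
    ∫⁻ x, G ‖x‖ * ENNReal.ofReal (‖x - y‖ ^ (-(d : ℝ) - σ)) =
    ∫⁻ ρ in Ioi (0:ℝ), ENNReal.ofReal (ρ ^ (d - 1)) * (G ρ * PhiE d σ ρ ‖y‖) := by
  obtain ⟨n, rfl⟩ : ∃ n, d = n + 1 := ⟨d - 1, by omega⟩
  rw [hardy_rot]
  set R := ‖y‖ with hR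
  have hR0 : 0 ≤ R := norm_nonneg _
  set F : ℝ → ℝ → ℝ≥0∞ := fun ρ a => G ρ *
      ENNReal.ofReal ((R ^ 2 - 2 * R * a + ρ ^ 2) ^ (-(((n+1 : ℕ) : ℝ) + σ) / 2)) with hFdef
  have hF : Measurable (Function.uncurry F) := by
    simp only [hFdef, Function.uncurry_def]; fun_prop
  change ∫⁻ x : EuclideanSpace ℝ (Fin (n+1)), F ‖x‖ (x 0) = _
  rcases Nat.eq_zero_or_pos n with hn | hn
  · subst hn
    rw [hardy_split 0 F hF]
    have h1 : ∀ a : ℝ, ∫⁻ b : EuclideanSpace ℝ (Fin 0), F (√(a^2 + ‖b‖^2)) a = F |a| a := by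
      intro a
      have : ∀ b : EuclideanSpace ℝ (Fin 0), F (√(a^2 + ‖b‖^2)) a = F |a| a := by
        intro b
        rw [Subsingleton.elim b 0]; simp [Real.sqrt_sq_eq_abs]
      simp_rw [this]
      rw [lintegral_const, hardy_vol_E0, mul_one]
    simp_rw [h1]
    have hF1 : Measurable (fun a : ℝ => F |a| a) :=
      hF.comp (f := fun a : ℝ => (|a|, a)) (by fun_prop)
    rw [hardy_line _ hF1]
    refine setLIntegral_congr_fun measurableSet_Ioi fun ρ hρ => ?_
    have hρ : 0 < ρ := hρ
    simp only [hFdef, abs_neg, abs_of_pos hρ, PhiE, zero_add, if_true, Nat.sub_self, pow_zero,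
      ENNReal.ofReal_one, one_mul, Nat.cast_one]
    rw [mul_add]
    congr 3
    · rw [show R ^ 2 - 2 * R * ρ + ρ ^ 2 = |R - ρ| ^ 2 by rw [sq_abs]; ring,
        ← Real.rpow_natCast, ← Real.rpow_mul (abs_nonneg _)]
      congr 1; push_cast; ring
    · rw [show R ^ 2 - 2 * R * (-ρ) + ρ ^ 2 = (R + ρ) ^ 2 by ring,
        ← Real.rpow_natCast, ← Real.rpow_mul (by positivity)]
      congr 1; push_cast; ring
  · rw [hardy_slice n hn F hF, ← lintegral_const_mul' _ _ ENNReal.ofReal_ne_top]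
    refine setLIntegral_congr_fun measurableSet_Ioi fun ρ hρ => ?_
    have hρ : 0 < ρ := hρ
    have hne : ¬ (n + 1 = 1) := by omega
    simp only [hFdef, PhiE, hne, if_false, Nat.add_sub_cancel]
    push_cast
    have e1 : (n:ℝ) + 1 - 1 = n := by ring
    have e2 : (n:ℝ) + 1 - 3 = n - 2 := by ring
    rw [e1, e2, mul_left_comm]
    congr 1
    rw [mul_left_comm]
    congr 1
    rw [← lintegral_const_mul _ (by fun_prop)]
    refine setLIntegral_congr_fun measurableSet_Ioo fun r hr => ?_
    have : 0 ≤ 1 - r ^ 2 := by nlinarith [hr.1, hr.2]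
    rw [mul_left_comm, ENNReal.ofReal_mul (by positivity)]
    simp only [mul_assoc]

lemma PhiE_measurable (d : ℕ) (σ R : ℝ) : Measurable (fun ρ => PhiE d σ ρ R) := by
  unfold PhiE
  split_ifs
  · fun_prop
  · refine Measurable.const_mul ?_ _
    apply Measurable.lintegral_prod_right'
      (f := fun q : ℝ × ℝ => ENNReal.ofReal ((1 - q.2 ^ 2) ^ (((d : ℝ) - 3) / 2) *
        (R ^ 2 - 2 * R * q.1 * q.2 + q.1 ^ 2) ^ (-((d : ℝ) + σ) / 2)))
    fun_prop

lemma PhiE_symm (d : ℕ) (σ ρ R : ℝ) : PhiE d σ ρ R = PhiE d σ R ρ := by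
  unfold PhiE
  rw [abs_sub_comm, add_comm R ρ]
  simp only [show ∀ r, R ^ 2 - 2 * R * ρ * r + ρ ^ 2 = ρ ^ 2 - 2 * ρ * R * r + R ^ 2 by
    intro r; ring]

lemma PhiE_smul (d : ℕ) (hd : 1 ≤ d) (σ ρ R c : ℝ) (hρ : 0 < ρ) (hR : 0 < R) (hc : 0 < c) :
    PhiE d σ (c * ρ) (c * R) = ENNReal.ofReal (c ^ (-(d:ℝ) - σ)) * PhiE d σ ρ R := by
  unfold PhiE
  split_ifs with h
  · subst h
    rw [← mul_sub, ← mul_add, abs_mul, abs_of_pos hc, Real.mul_rpow hc.le (abs_nonneg _),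
      Real.mul_rpow hc.le (by positivity), ENNReal.ofReal_mul (by positivity),
      ENNReal.ofReal_mul (by positivity), ← mul_add, Nat.cast_one]
  · rw [mul_left_comm (ENNReal.ofReal (c ^ _))]
    congr 1
    rw [← lintegral_const_mul' _ _ ENNReal.ofReal_ne_top]
    refine setLIntegral_congr_fun measurableSet_Ioo fun r hr => ?_
    rw [← ENNReal.ofReal_mul (by positivity)]
    congr 1
    rw [show (c * R) ^ 2 - 2 * (c * R) * (c * ρ) * r + (c * ρ) ^ 2 =
      c ^ 2 * (R ^ 2 - 2 * R * ρ * r + ρ ^ 2) by ring, Real.mul_rpow (by positivity)]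
    · rw [← Real.rpow_natCast c 2, ← Real.rpow_mul hc.le]
      rw [show ((2:ℕ):ℝ) * (-((d:ℝ) + σ) / 2) = -(d:ℝ) - σ by push_cast; ring]
      ring
    · nlinarith [sq_nonneg (R - ρ), mul_pos hR hρ, hr.2]

/-- For `t ∈ (0,1)` the extended kernel agrees with `Phi`. -/
lemma PhiE_eq_Phi (d : ℕ) (hd : 1 ≤ d) (s p t : ℝ) (hsp : 0 < s * p) (ht0 : 0 < t) (ht1 : t < 1) :
    PhiE d (s * p) t 1 = ENNReal.ofReal (Phi d s p t) := by
  unfold PhiE Phi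
  split_ifs with h
  · rw [abs_of_pos (by linarith), ENNReal.ofReal_add]
    · apply Real.rpow_nonneg; linarith
    · apply Real.rpow_nonneg; linarith
  · have hd2 : (2:ℝ) ≤ d := by exact_mod_cast (by omega : 2 ≤ d)
    have hc : 0 ≤ 2 * Real.pi ^ (((d : ℝ) - 1) / 2) / Real.Gamma (((d : ℝ) - 1) / 2) := by
      have := Real.Gamma_pos_of_pos (s := ((d : ℝ) - 1) / 2) (by linarith)
      positivity
    rw [ENNReal.ofReal_mul hc, intervalIntegral.integral_of_le (by norm_num),
      integral_Ioc_eq_integral_Ioo, ofReal_integral_eq_lintegral_ofReal]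
    · simp only [one_pow, mul_one]
    · -- integrability
      have hk : ∀ r ∈ Ioo (-1:ℝ) 1, (1 - t)^2 ≤ 1 - 2 * t * r + t ^ 2 := by
        intro r hr; nlinarith [hr.2]
      have hIntg : IntegrableOn (fun r : ℝ => (1 - r^2) ^ (((d:ℝ) - 3)/2)) (Ioo (-1) 1) := by
        have h0 : IntegrableOn (fun r : ℝ => 1 / √(1 - r^2)) (Ioo (-1) 1) := by
          refine (intervalIntegral.integrableOn_deriv_of_nonneg (g := Real.arcsin) ?_ ?_ ?_).mono_set
            Ioo_subset_Ioc_self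
          · exact Real.continuous_arcsin.continuousOn
          · intro x hx
            exact Real.hasDerivAt_arcsin (by linarith [hx.1]) (by linarith [hx.2])
          · intro x hx
            positivity
        refine Integrable.mono' h0 (Measurable.aestronglyMeasurable (by fun_prop)) ?_
        filter_upwards [ae_restrict_mem measurableSet_Ioo] with r hr
        have h1 : 0 < 1 - r ^ 2 := by nlinarith [hr.1, hr.2]
        rw [Real.norm_of_nonneg (by positivity), one_div, Real.sqrt_eq_rpow,
          ← Real.rpow_neg h1.le]
        exact Real.rpow_le_rpow_of_exponent_ge h1 (by nlinarith [sq_nonneg r]) (by linarith)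
      refine Integrable.mono' (hIntg.mul_const (((1-t)^2) ^ (-((d : ℝ) + s * p) / 2))) ?_ ?_
      · exact Measurable.aestronglyMeasurable (by fun_prop)
      · filter_upwards [ae_restrict_mem measurableSet_Ioo] with r hr
        have h1 : 0 < 1 - r ^ 2 := by nlinarith [hr.1, hr.2]
        have h3 : 0 < (1 - t) ^ 2 := by have : 0 < 1 - t := by linarith
                                        positivity
        have h2 := hk r hr
        have h4 : 0 < 1 - 2 * t * r + t ^ 2 := by linarith
        rw [Real.norm_of_nonneg (by positivity)]
        exact mul_le_mul_of_nonneg_left (Real.rpow_le_rpow_of_nonpos h3 h2 (by linarith))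
          (by positivity)
    · filter_upwards [ae_restrict_mem measurableSet_Ioo] with r hr
      have h1 : 0 ≤ 1 - r ^ 2 := by nlinarith [hr.1, hr.2]
      have h2 : 0 ≤ 1 - 2 * t * r + t ^ 2 := by nlinarith [hr.1, hr.2, sq_nonneg (1 - t)]
      simp only [Pi.zero_apply]
      positivity

lemma hardy_inner (d : ℕ) (hd : 1 ≤ d) (σ : ℝ) (y : EuclideanSpace ℝ (Fin d)) (hy : y ≠ 0)
    (g : ℝ → ℝ≥0∞) (hg : Measurable g) :
    ∫⁻ x, (if ‖x‖ < ‖y‖ then g (‖x‖ / ‖y‖) else 0) * ENNReal.ofReal (‖x - y‖ ^ (-(d : ℝ) - σ)) =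
    ENNReal.ofReal (‖y‖ ^ (-σ)) *
      ∫⁻ t in Ioo (0:ℝ) 1, g t * (ENNReal.ofReal (t ^ ((d:ℝ) - 1)) * PhiE d σ t 1) := by
  have hR : 0 < ‖y‖ := norm_pos_iff.2 hy
  rw [hardy_polar d hd σ y (fun ρ => if ρ < ‖y‖ then g (ρ / ‖y‖) else 0)
    (Measurable.ite measurableSet_Iio (by fun_prop) measurable_const)]
  set R := ‖y‖
  have himg : Ioi (0:ℝ) = (fun t => R * t) '' Ioi 0 := by
    ext z; constructor
    · intro hz; exact ⟨z / R, div_pos hz hR, by field_simp⟩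
    · rintro ⟨t, ht, rfl⟩; exact mul_pos hR ht
  rw [himg, lintegral_image_eq_lintegral_abs_deriv_mul (f' := fun _ => R) measurableSet_Ioi
    (fun x _ => by simpa using ((hasDerivAt_id x).const_mul R).hasDerivWithinAt)
    (fun a _ b _ h => by simpa [hR.ne'] using h)]
  rw [← lintegral_const_mul' _ _ ENNReal.ofReal_ne_top,
    ← lintegral_indicator measurableSet_Ioi, ← lintegral_indicator measurableSet_Ioo]
  refine lintegral_congr fun t => ?_
  by_cases ht0 : t ∈ Ioi (0:ℝ)
  swap
  · rw [indicator_of_notMem ht0, indicator_of_notMem fun h => ht0 h.1]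
  have ht0' : 0 < t := ht0
  rw [indicator_of_mem ht0]
  by_cases ht1 : t < 1
  · rw [indicator_of_mem (mem_Ioo.2 ⟨ht0', ht1⟩), if_pos (by nlinarith)]
    have h1 := PhiE_smul d hd σ t 1 R ht0' one_pos hR
    rw [mul_one] at h1
    rw [h1, mul_div_cancel_left₀ _ hR.ne', abs_of_pos hR]
    have h2 : R * ((R * t) ^ (d - 1) * R ^ (-(d:ℝ) - σ)) = R ^ (-σ) * t ^ ((d:ℝ) - 1) := by
      rw [← Real.rpow_natCast, Real.mul_rpow hR.le ht0'.le, Nat.cast_sub hd, Nat.cast_one,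
        show -σ = 1 + (((d:ℝ) - 1) + (-(d:ℝ) - σ)) by ring, Real.rpow_add hR, Real.rpow_add hR,
        Real.rpow_one]
      ring
    calc _ = (ENNReal.ofReal R * (ENNReal.ofReal ((R * t) ^ (d-1)) *
            ENNReal.ofReal (R ^ (-(d:ℝ) - σ)))) * (g t * PhiE d σ t 1) := by ring
      _ = _ := by
        rw [← ENNReal.ofReal_mul (by positivity), ← ENNReal.ofReal_mul (by positivity), h2,
          ENNReal.ofReal_mul (by positivity)]
        ring
  · rw [indicator_of_notMem fun h => ht1 h.2, if_neg (by nlinarith)]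
    simp

lemma hardy_outer (d : ℕ) (hd : 1 ≤ d) (σ : ℝ) (x : EuclideanSpace ℝ (Fin d)) (hx : x ≠ 0)
    (g : ℝ → ℝ≥0∞) (hg : Measurable g) :
    ∫⁻ y, (if ‖x‖ < ‖y‖ then g (‖x‖ / ‖y‖) else 0) * ENNReal.ofReal (‖x - y‖ ^ (-(d : ℝ) - σ)) =
    ENNReal.ofReal (‖x‖ ^ (-σ)) *
      ∫⁻ t in Ioo (0:ℝ) 1, g t * (ENNReal.ofReal (t ^ (σ - 1)) * PhiE d σ t 1) := by
  have hR : 0 < ‖x‖ := norm_pos_iff.2 hx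
  simp_rw [norm_sub_rev x]
  rw [hardy_polar d hd σ x (fun ρ => if ‖x‖ < ρ then g (‖x‖ / ρ) else 0)
    (Measurable.ite measurableSet_Ioi (by fun_prop) measurable_const)]
  set R := ‖x‖
  have himg : Ioi (0:ℝ) = (fun t => R / t) '' Ioi 0 := by
    ext z; constructor
    · intro hz
      have hz : 0 < z := hz
      exact ⟨R / z, div_pos hR hz, by field_simp⟩
    · rintro ⟨t, ht, rfl⟩; exact div_pos hR ht
  rw [himg, lintegral_image_eq_lintegral_abs_deriv_mul (f' := fun t => R * (-(t^2)⁻¹)) measurableSet_Ioi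
    (fun x hx => by
      have hx : 0 < x := hx
      simpa only [div_eq_mul_inv] using ((hasDerivAt_inv hx.ne').const_mul R).hasDerivWithinAt)
    (fun a ha b hb h => by
      have ha : 0 < a := ha
      have hb : 0 < b := hb
      field_simp at h
      exact h.symm)]
  rw [← lintegral_const_mul' _ _ ENNReal.ofReal_ne_top,
    ← lintegral_indicator measurableSet_Ioi, ← lintegral_indicator measurableSet_Ioo]
  refine lintegral_congr fun t => ?_
  by_cases ht0 : t ∈ Ioi (0:ℝ)
  swap
  · rw [indicator_of_notMem ht0, indicator_of_notMem fun h => ht0 h.1]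
  have ht0' : 0 < t := ht0
  rw [indicator_of_mem ht0]
  have hiff : R < R / t ↔ t < 1 := by
    rw [lt_div_iff₀ ht0']
    constructor <;> intro h <;> nlinarith
  by_cases ht1 : t < 1
  · rw [indicator_of_mem (mem_Ioo.2 ⟨ht0', ht1⟩), if_pos (hiff.2 ht1)]
    have h1 := PhiE_smul d hd σ 1 t (R / t) one_pos ht0' (div_pos hR ht0')
    rw [mul_one, div_mul_cancel₀ _ ht0'.ne', PhiE_symm d σ 1 t] at h1
    rw [h1, show R / (R / t) = t by field_simp, abs_mul, abs_of_pos hR, abs_neg,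
      abs_of_pos (by positivity)]
    have h2 : R * (t^2)⁻¹ * ((R / t) ^ (d - 1) * (R / t) ^ (-(d:ℝ) - σ)) =
        R ^ (-σ) * t ^ (σ - 1) := by
      rw [← Real.rpow_natCast (R / t), ← Real.rpow_add (by positivity), Nat.cast_sub hd, Nat.cast_one,
        show (d:ℝ) - 1 + (-(d:ℝ) - σ) = -σ - 1 by ring, Real.div_rpow hR.le ht0'.le,
        Real.rpow_sub hR, Real.rpow_one, show -σ - 1 = -(σ - 1) - 2 by ring, Real.rpow_sub ht0',
        Real.rpow_neg ht0'.le, Real.rpow_two]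
      have : t ^ (σ - 1) ≠ 0 := by positivity
      field_simp
    calc _ = (ENNReal.ofReal (R * (t^2)⁻¹) * (ENNReal.ofReal ((R / t) ^ (d-1)) *
            ENNReal.ofReal ((R / t) ^ (-(d:ℝ) - σ)))) * (g t * PhiE d σ t 1) := by ring
      _ = _ := by
        rw [← ENNReal.ofReal_mul (by positivity), ← ENNReal.ofReal_mul (by positivity), h2,
          ENNReal.ofReal_mul (by positivity)]
        ring
  · rw [indicator_of_notMem fun h => ht1 h.2, if_neg (fun h => ht1 (hiff.1 h))]
    simp

/-- Symmetrization. -/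
lemma hardy_symm (d : ℕ) (hd : 1 ≤ d)
    (W : EuclideanSpace ℝ (Fin d) → EuclideanSpace ℝ (Fin d) → ℝ≥0∞)
    (hW : Measurable (Function.uncurry W)) (hsym : ∀ x y, W x y = W y x) :
    ∫⁻ x, ∫⁻ y, W x y = 2 * ∫⁻ x, ∫⁻ y, (if ‖x‖ < ‖y‖ then W x y else 0) := by
  have : Nonempty (Fin d) := ⟨⟨0, hd⟩⟩
  have hm1 : Measurable (Function.uncurry fun x y : EuclideanSpace ℝ (Fin d) =>
      if ‖x‖ < ‖y‖ then W x y else 0) := by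
    refine Measurable.ite (measurableSet_lt ?_ ?_) hW measurable_const <;> fun_prop
  have hm2 : Measurable (Function.uncurry fun x y : EuclideanSpace ℝ (Fin d) =>
      if ‖y‖ < ‖x‖ then W x y else 0) := by
    refine Measurable.ite (measurableSet_lt ?_ ?_) hW measurable_const <;> fun_prop
  have h1 : ∀ x, ∫⁻ y, W x y = (∫⁻ y, (if ‖x‖ < ‖y‖ then W x y else 0)) +
      ∫⁻ y, (if ‖y‖ < ‖x‖ then W x y else 0) := by
    intro x
    rw [← lintegral_add_left (hm1.of_uncurry_left (x := x))]
    have hs : volume (Metric.sphere (0 : EuclideanSpace ℝ (Fin d)) ‖x‖) = 0 :=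
      Measure.addHaar_sphere _ _ _
    refine lintegral_congr_ae ?_
    filter_upwards [measure_eq_zero_iff_ae_notMem.1 hs] with y hy
    simp only [mem_sphere_iff_norm, sub_zero] at hy
    rcases lt_trichotomy ‖x‖ ‖y‖ with h | h | h
    · simp [h, h.not_gt]
    · exact absurd h.symm hy
    · simp [h, h.not_gt]
  simp_rw [h1]
  rw [lintegral_add_left hm1.lintegral_prod_right, two_mul]
  congr 1
  rw [lintegral_lintegral_swap hm2.aemeasurable]
  refine lintegral_congr fun x => lintegral_congr fun y => ?_
  rw [hsym]

lemma hardy_conv (p θ A B : ℝ) (hp : 1 ≤ p) (h0 : 0 < θ) (h1 : θ < 1) :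
    |A + B| ^ p ≤ (1 - θ) ^ (1 - p) * |A| ^ p + θ ^ (1 - p) * |B| ^ p := by
  have h1' : 0 < 1 - θ := by linarith
  have key := (convexOn_rpow hp).2 (x := |A| / (1 - θ)) (y := |B| / θ) (mem_Ici.2 (by positivity))
    (mem_Ici.2 (by positivity)) h1'.le h0.le (by ring)
  simp only [smul_eq_mul] at key
  rw [mul_div_cancel₀ _ h1'.ne', mul_div_cancel₀ _ h0.ne'] at key
  have e : ∀ c z : ℝ, 0 < c → 0 ≤ z → c * (z / c) ^ p = c ^ (1 - p) * z ^ p := by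
    intro c z hc hz
    rw [Real.div_rpow hz hc.le, Real.rpow_sub hc, Real.rpow_one]
    ring
  rw [e _ _ h1' (abs_nonneg _), e _ _ h0 (abs_nonneg _)] at key
  exact (Real.rpow_le_rpow (abs_nonneg _) (abs_add_le A B) (by linarith)).trans key

lemma hardy_lower (p θ a b : ℝ) (hp : 1 ≤ p) (h0 : 0 < θ) (h1 : θ < 1) :
    (1 - θ) ^ (p - 1) * |a| ^ p ≤ |a - b| ^ p + (θ⁻¹ - 1) ^ (p - 1) * |b| ^ p := by
  have h1' : 0 < 1 - θ := by linarith
  have key := hardy_conv p θ (a - b) b hp h0 h1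
  rw [sub_add_cancel] at key
  have := mul_le_mul_of_nonneg_left key (Real.rpow_nonneg h1'.le (p - 1))
  refine this.trans (le_of_eq ?_)
  rw [show θ⁻¹ - 1 = (1 - θ) / θ by field_simp, Real.div_rpow h1'.le h0.le,
    show 1 - p = -(p - 1) by ring, Real.rpow_neg h1'.le, Real.rpow_neg h0.le]
  have : (1 - θ) ^ (p - 1) ≠ 0 := by positivity
  field_simp

lemma hardy_lint_pow_zero (a r : ℝ) (ha : -1 < a) (hr : 0 ≤ r) :
    ∫⁻ ρ in Ioc (0:ℝ) r, ENNReal.ofReal (ρ ^ a) < ∞ := by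
  have := intervalIntegral.intervalIntegrable_rpow' (a := 0) (b := r) ha
  rw [intervalIntegrable_iff_integrableOn_Ioc_of_le hr] at this
  exact this.lintegral_lt_top

lemma hardy_N_finite (d : ℕ) (hd : 1 ≤ d) (p σ : ℝ) (hp : 1 ≤ p) (hσ : σ < d)
    (u : EuclideanSpace ℝ (Fin d) → ℝ) (hu : Continuous u) (hc : HasCompactSupport u) :
    ∫⁻ x, ENNReal.ofReal (|u x| ^ p * ‖x‖ ^ (-σ)) < ∞ := by
  obtain ⟨M, hM⟩ := hu.bounded_above_of_compact_support hc
  obtain ⟨r, hr0, hr⟩ := hc.isCompact.isBounded.exists_pos_norm_le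
  have hM0 : 0 ≤ M := (norm_nonneg _).trans (hM 0)
  set G : ℝ → ℝ≥0∞ := (Iic r).indicator (fun ρ => ENNReal.ofReal (M ^ p * ρ ^ (-σ)))
  have hG : Measurable G := Measurable.indicator (by fun_prop) measurableSet_Iic
  have h1 : ∫⁻ x, ENNReal.ofReal (|u x| ^ p * ‖x‖ ^ (-σ)) ≤
      ∫⁻ x : EuclideanSpace ℝ (Fin d), G ‖x‖ := by
    refine lintegral_mono fun x => ?_
    by_cases hx : ‖x‖ ≤ r
    · simp only [G]
      rw [indicator_of_mem (mem_Iic.2 hx)]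
      apply ENNReal.ofReal_le_ofReal
      gcongr
      exact hM x
    · have : u x = 0 := by
        by_contra h
        exact hx (hr x (subset_tsupport u h))
      have hp' : p ≠ 0 := by linarith
      simp [this, hp']
  refine h1.trans_lt ?_
  rw [hardy_lint_norm d hd G hG]
  refine ENNReal.mul_lt_top (ENNReal.mul_lt_top (by simp) measure_ball_lt_top) ?_
  calc ∫⁻ ρ in Ioi (0 : ℝ), ENNReal.ofReal (ρ ^ (d - 1)) * G ρ
      = ∫⁻ ρ in Ioc (0:ℝ) r, ENNReal.ofReal (M ^ p) * ENNReal.ofReal (ρ ^ ((d:ℝ) - 1 - σ)) := by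
        rw [← lintegral_indicator measurableSet_Ioi, ← lintegral_indicator measurableSet_Ioc]
        refine lintegral_congr fun ρ => ?_
        by_cases h0 : ρ ∈ Ioi (0:ℝ)
        · have h0' : 0 < ρ := h0
          rw [indicator_of_mem h0]
          by_cases hr' : ρ ≤ r
          · simp only [G]
            rw [indicator_of_mem (mem_Iic.2 hr'), indicator_of_mem (mem_Ioc.2 ⟨h0', hr'⟩),
              ← ENNReal.ofReal_mul (by positivity), ← ENNReal.ofReal_mul (by positivity)]
            congr 1
            rw [sub_eq_add_neg ((d:ℝ) - 1), Real.rpow_add h0', ← Real.rpow_natCast, Nat.cast_sub hd,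
              Nat.cast_one]
            ring
          · simp only [G]
            rw [indicator_of_notMem (by simpa using hr'), indicator_of_notMem fun h => hr' h.2,
              mul_zero]
        · rw [indicator_of_notMem h0, indicator_of_notMem fun h => h0 h.1]
    _ < ∞ := by
        rw [lintegral_const_mul' _ _ ENNReal.ofReal_ne_top]
        exact ENNReal.mul_lt_top ENNReal.ofReal_lt_top
          (hardy_lint_pow_zero _ _ (by linarith) hr0.le)

lemma hardy_M_finite (d : ℕ) (hd : 1 ≤ d) (s p : ℝ) (hs : 0 < s) (hs1 : s < 1) (hp : 1 ≤ p) :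
    ∫⁻ t in Ioo (0:ℝ) 1, ENNReal.ofReal ((-Real.log t) ^ p) *
      (ENNReal.ofReal (t ^ (s * p - 1)) * PhiE d (s * p) t 1) < ∞ := by
  have hp0 : 0 < p := by linarith
  have hσ : 0 < s * p := by positivity
  have hσp : s * p < p := by nlinarith
  set e : EuclideanSpace ℝ (Fin d) := EuclideanSpace.single ⟨0, hd⟩ 1 with he
  have hen : ‖e‖ = 1 := by simp [he]
  have he0 : e ≠ 0 := by rw [← norm_pos_iff, hen]; exact one_pos
  have h := hardy_outer d hd (s * p) e he0 (fun t => ENNReal.ofReal ((-Real.log t) ^ p)) (by fun_prop)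
  rw [hen, Real.one_rpow, ENNReal.ofReal_one, one_mul] at h
  rw [← h]
  set G : ℝ → ℝ≥0∞ := fun ρ => ENNReal.ofReal (Real.log (1 + ρ) ^ p * ρ ^ (-(d:ℝ) - s * p)) with hGdef
  have hG : Measurable G := by simp only [hGdef]; fun_prop
  calc _ ≤ ∫⁻ y, G ‖y - e‖ := by
        refine lintegral_mono fun y => ?_
        by_cases hy : 1 < ‖y‖
        · simp only [hGdef]
          rw [if_pos hy, norm_sub_rev e y, one_div, Real.log_inv, neg_neg]
          have hl : 0 ≤ Real.log ‖y‖ := Real.log_nonneg hy.le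
          rw [← ENNReal.ofReal_mul (by positivity)]
          apply ENNReal.ofReal_le_ofReal
          gcongr
          have := norm_sub_norm_le y e
          linarith
        · simp [hy]
    _ = ∫⁻ z : EuclideanSpace ℝ (Fin d), G ‖z‖ := lintegral_sub_right_eq_self (fun z => G ‖z‖) e
    _ < ∞ := by
      rw [hardy_lint_norm d hd G hG]
      refine ENNReal.mul_lt_top (ENNReal.mul_lt_top (by simp) measure_ball_lt_top) ?_
      have hw : ∀ ρ : ℝ, 0 < ρ → ENNReal.ofReal (ρ ^ (d - 1)) * G ρ =
          ENNReal.ofReal (Real.log (1 + ρ) ^ p * ρ ^ (-1 - s * p)) := by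
        intro ρ hρ
        simp only [hGdef]
        rw [← ENNReal.ofReal_mul (by positivity)]
        congr 1
        rw [show -1 - s * p = ((d:ℝ) - 1) + (-(d:ℝ) - s * p) by ring, Real.rpow_add hρ,
          ← Real.rpow_natCast, Nat.cast_sub hd, Nat.cast_one]
        ring
      rw [setLIntegral_congr_fun measurableSet_Ioi (fun ρ hρ => hw ρ hρ),
        ← Ioc_union_Ioi_eq_Ioi (zero_le_one (α := ℝ))]
      refine (lintegral_union_le _ _ _).trans_lt (ENNReal.add_lt_top.2 ⟨?_, ?_⟩)
      · refine (setLIntegral_mono' measurableSet_Ioc (g := fun ρ => ENNReal.ofReal (ρ ^ (p - 1 - s * p)))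
          fun ρ hρ => ?_).trans_lt (hardy_lint_pow_zero _ _ (by linarith) zero_le_one)
        have hρ0 : 0 < ρ := hρ.1
        apply ENNReal.ofReal_le_ofReal
        rw [show p - 1 - s * p = p + (-1 - s * p) by ring, Real.rpow_add hρ0]
        have hl : 0 ≤ Real.log (1 + ρ) := Real.log_nonneg (by linarith)
        gcongr
        have := Real.log_le_sub_one_of_pos (x := 1 + ρ) (by linarith)
        linarith
      · have hi := integrableOn_Ioi_rpow_of_lt (a := -1 - s * p / 2) (c := 1) (by linarith) one_pos
        refine (setLIntegral_mono' measurableSet_Ioi (g := fun ρ =>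
          ENNReal.ofReal ((2 ^ (s / 2) / (s / 2)) ^ p * ρ ^ (-1 - s * p / 2)))
          fun ρ hρ => ?_).trans_lt (hi.const_mul _).lintegral_lt_top
        have hρ1 : 1 < ρ := hρ
        have hρ0 : 0 < ρ := by linarith
        apply ENNReal.ofReal_le_ofReal
        have hl : 0 ≤ Real.log (1 + ρ) := Real.log_nonneg (by linarith)
        have h3 : Real.log (1 + ρ) ≤ (2 ^ (s / 2) / (s / 2)) * ρ ^ (s / 2) := by
          have h4 := Real.log_le_rpow_div (x := 1 + ρ) (ε := s / 2) (by linarith) (by linarith)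
          have h5 : (1 + ρ) ^ (s / 2) ≤ (2 * ρ) ^ (s / 2) := by
            gcongr; linarith
          rw [Real.mul_rpow (by norm_num) hρ0.le] at h5
          calc _ ≤ _ := h4
            _ ≤ 2 ^ (s / 2) * ρ ^ (s / 2) / (s / 2) := by gcongr
            _ = _ := by ring
        calc _ ≤ ((2 ^ (s / 2) / (s / 2)) * ρ ^ (s / 2)) ^ p * ρ ^ (-1 - s * p) := by gcongr
          _ = _ := by
            rw [Real.mul_rpow (by positivity) (by positivity), ← Real.rpow_mul hρ0.le, mul_assoc,
              ← Real.rpow_add hρ0]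
            congr 2; ring

/-- One-dimensional weighted integral against the angular kernel. -/
def hardyJ (d : ℕ) (σ w : ℝ) (g : ℝ → ℝ≥0∞) : ℝ≥0∞ :=
  ∫⁻ t in Ioo (0:ℝ) 1, g t * (ENNReal.ofReal (t ^ w) * PhiE d σ t 1)

lemma Phi_nonneg (d : ℕ) (hd : 1 ≤ d) (s p t : ℝ) (ht0 : 0 < t) (ht1 : t < 1) : 0 ≤ Phi d s p t := by
  unfold Phi
  split_ifs with h
  · have : 0 < 1 - t := by linarith
    positivity
  · have hd2 : (2:ℝ) ≤ d := by exact_mod_cast (by omega : 2 ≤ d)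
    have := Real.Gamma_pos_of_pos (s := ((d : ℝ) - 1) / 2) (by linarith)
    refine mul_nonneg (by positivity) (intervalIntegral.integral_nonneg (by norm_num) fun r hr => ?_)
    have h1 : 0 ≤ 1 - r ^ 2 := by nlinarith [hr.1, hr.2]
    have h2 : 0 ≤ 1 - 2 * t * r + t ^ 2 := by nlinarith [hr.1, hr.2, sq_nonneg (1 - t)]
    positivity

lemma one_sub_rpow_le_log (γ t : ℝ) (ht0 : 0 < t) : 1 - t ^ γ ≤ γ * (-Real.log t) := by
  rw [Real.rpow_def_of_pos ht0]
  have := Real.add_one_le_exp (Real.log t * γ)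
  linarith

lemma hardyJ_mono {d : ℕ} {σ w : ℝ} {g g' : ℝ → ℝ≥0∞} (h : ∀ t ∈ Ioo (0:ℝ) 1, g t ≤ g' t) :
    hardyJ d σ w g ≤ hardyJ d σ w g' :=
  setLIntegral_mono' measurableSet_Ioo fun t ht => by gcongr; exact h t ht

lemma hardyJ_const_mul {d : ℕ} {σ w : ℝ} {g : ℝ → ℝ≥0∞} (c : ℝ≥0∞) (hc : c ≠ ∞) :
    hardyJ d σ w (fun t => c * g t) = c * hardyJ d σ w g := by
  unfold hardyJ
  rw [← lintegral_const_mul' _ _ hc]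
  simp only [mul_assoc]

lemma hardyJ_C_finite (d : ℕ) (hd : 1 ≤ d) (s p : ℝ) (hs : 0 < s) (hs1 : s < 1) (hp : 1 ≤ p)
    (γ : ℝ) (hγ : 0 < γ) :
    hardyJ d (s * p) (s * p - 1) (fun t => ENNReal.ofReal ((1 - t ^ γ) ^ p)) < ∞ := by
  refine lt_of_le_of_lt (hardyJ_mono (g' := fun t => ENNReal.ofReal (γ ^ p) *
    ENNReal.ofReal ((-Real.log t) ^ p)) fun t ht => ?_) ?_
  · have hl : 0 ≤ -Real.log t := by
      have := Real.log_nonpos ht.1.le ht.2.le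
      linarith
    have h1 : 0 ≤ 1 - t ^ γ := by
      have := Real.rpow_le_one ht.1.le ht.2.le hγ.le
      linarith
    rw [← ENNReal.ofReal_mul (by positivity), ← Real.mul_rpow hγ.le hl]
    apply ENNReal.ofReal_le_ofReal
    gcongr
    exact one_sub_rpow_le_log γ t ht.1
  · rw [hardyJ_const_mul _ ENNReal.ofReal_ne_top]
    exact ENNReal.mul_lt_top ENNReal.ofReal_lt_top (hardy_M_finite d hd s p hs hs1 hp)

lemma HardyConst_eq (d : ℕ) (hd : 1 ≤ d) (s p : ℝ) (hs : 0 < s) (hs1 : s < 1) (hp : 1 ≤ p)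
    (hsp : s * p < d) :
    ENNReal.ofReal (HardyConst d s p) = 2 * hardyJ d (s * p) (s * p - 1)
      (fun t => ENNReal.ofReal ((1 - t ^ (((d:ℝ) - s * p) / p)) ^ p)) ∧ 0 ≤ HardyConst d s p := by
  have hp0 : 0 < p := by linarith
  have hσ : 0 < s * p := by positivity
  have hγ : 0 < ((d:ℝ) - s * p) / p := div_pos (by linarith) hp0
  have hfin := hardyJ_C_finite d hd s p hs hs1 hp _ hγ
  set γ := ((d:ℝ) - s * p) / p with hγdef
  set F : ℝ → ℝ≥0∞ := fun t => ENNReal.ofReal ((1 - t ^ γ) ^ p) *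
    (ENNReal.ofReal (t ^ (s * p - 1)) * PhiE d (s * p) t 1) with hF
  have hFm : Measurable F := by
    have := PhiE_measurable d (s * p) 1
    simp only [hF]; fun_prop
  have e : HardyConst d s p = 2 * (hardyJ d (s * p) (s * p - 1)
      (fun t => ENNReal.ofReal ((1 - t ^ γ) ^ p))).toReal := by
    unfold HardyConst
    rw [intervalIntegral.integral_of_le zero_le_one, integral_Ioc_eq_integral_Ioo]
    congr 1
    unfold hardyJ
    rw [← integral_toReal hFm.aemeasurable (ae_lt_top hFm hfin.ne)]
    refine setIntegral_congr_fun measurableSet_Ioo fun t ht => ?_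
    have h1 : 0 ≤ 1 - t ^ γ := by
      have := Real.rpow_le_one ht.1.le ht.2.le hγ.le
      linarith
    have h2 := ht.1
    simp only [hF]
    rw [PhiE_eq_Phi d hd s p t hσ ht.1 ht.2, ENNReal.toReal_mul, ENNReal.toReal_mul,
      ENNReal.toReal_ofReal (by positivity), ENNReal.toReal_ofReal (by positivity),
      ENNReal.toReal_ofReal (Phi_nonneg d hd s p t ht.1 ht.2), abs_of_nonneg h1]
    ring
  rw [e]
  refine ⟨?_, by positivity⟩
  rw [ENNReal.ofReal_mul (by norm_num), ENNReal.ofReal_toReal hfin.ne]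
  norm_num

/-- The Gagliardo kernel. -/
def hardyK (d : ℕ) (σ : ℝ) (x y : EuclideanSpace ℝ (Fin d)) : ℝ≥0∞ :=
  ENNReal.ofReal (‖x - y‖ ^ (-(d : ℝ) - σ))

lemma hardyK_measurable (d : ℕ) (σ : ℝ) : Measurable (Function.uncurry (hardyK d σ)) := by
  unfold hardyK
  simp only [Function.uncurry_def]; fun_prop

lemma hardy_double_outer (d : ℕ) (hd : 1 ≤ d) (σ : ℝ) (g : ℝ → ℝ≥0∞) (hg : Measurable g)
    (f : EuclideanSpace ℝ (Fin d) → ℝ≥0∞) (hf : Measurable f) (hfin : ∀ x, f x ≠ ∞) :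
    ∫⁻ x, ∫⁻ y, (if ‖x‖ < ‖y‖ then f x * (g (‖x‖ / ‖y‖) * hardyK d σ x y) else 0) =
      hardyJ d σ (σ - 1) g * ∫⁻ x, f x * ENNReal.ofReal (‖x‖ ^ (-σ)) := by
  have : Nonempty (Fin d) := ⟨⟨0, hd⟩⟩
  rw [← lintegral_const_mul _ (by fun_prop)]
  have h0 : ∀ᵐ x : EuclideanSpace ℝ (Fin d), x ≠ 0 := by
    simp [ae_iff]
  refine lintegral_congr_ae ?_
  filter_upwards [h0] with x hx
  have h := hardy_outer d hd σ x hx g hg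
  have : ∀ y, (if ‖x‖ < ‖y‖ then f x * (g (‖x‖ / ‖y‖) * hardyK d σ x y) else 0) =
      f x * ((if ‖x‖ < ‖y‖ then g (‖x‖ / ‖y‖) else 0) *
        ENNReal.ofReal (‖x - y‖ ^ (-(d : ℝ) - σ))) := by
    intro y; unfold hardyK; split_ifs <;> simp
  simp_rw [this]
  rw [lintegral_const_mul' _ _ (hfin x), h]
  unfold hardyJ
  ring

lemma hardy_double_inner (d : ℕ) (hd : 1 ≤ d) (σ : ℝ) (g : ℝ → ℝ≥0∞) (hg : Measurable g)
    (f : EuclideanSpace ℝ (Fin d) → ℝ≥0∞) (hf : Measurable f) (hfin : ∀ x, f x ≠ ∞) :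
    ∫⁻ x, ∫⁻ y, (if ‖x‖ < ‖y‖ then f y * (g (‖x‖ / ‖y‖) * hardyK d σ x y) else 0) =
      hardyJ d σ ((d:ℝ) - 1) g * ∫⁻ x, f x * ENNReal.ofReal (‖x‖ ^ (-σ)) := by
  have : Nonempty (Fin d) := ⟨⟨0, hd⟩⟩
  have hm : Measurable (Function.uncurry fun x y : EuclideanSpace ℝ (Fin d) =>
      if ‖x‖ < ‖y‖ then f y * (g (‖x‖ / ‖y‖) * hardyK d σ x y) else 0) := by
    have hK := hardyK_measurable d σ
    simp only [Function.uncurry_def] at hK ⊢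
    refine Measurable.ite (measurableSet_lt ?_ ?_) ?_ measurable_const <;> fun_prop
  rw [lintegral_lintegral_swap hm.aemeasurable, ← lintegral_const_mul _ (by fun_prop)]
  have h0 : ∀ᵐ x : EuclideanSpace ℝ (Fin d), x ≠ 0 := by
    simp [ae_iff]
  refine lintegral_congr_ae ?_
  filter_upwards [h0] with y hy
  have h := hardy_inner d hd σ y hy g hg
  have : ∀ x, (if ‖x‖ < ‖y‖ then f y * (g (‖x‖ / ‖y‖) * hardyK d σ x y) else 0) =
      f y * ((if ‖x‖ < ‖y‖ then g (‖x‖ / ‖y‖) else 0) *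
        ENNReal.ofReal (‖x - y‖ ^ (-(d : ℝ) - σ))) := by
    intro x; unfold hardyK; split_ifs <;> simp
  simp_rw [this]
  rw [lintegral_const_mul' _ _ (hfin y), h]
  unfold hardyJ
  ring

/-- The Gagliardo energy reduced to `‖x‖ < ‖y‖`. -/
lemma hardy_energy (d : ℕ) (hd : 1 ≤ d) (σ p : ℝ) (u : EuclideanSpace ℝ (Fin d) → ℝ)
    (hu : Measurable u) :
    (∫⁻ x, ∫⁻ y, ENNReal.ofReal (|u x - u y| ^ p * ‖x - y‖ ^ (-(d : ℝ) - σ))) =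
      2 * ∫⁻ x, ∫⁻ y, (if ‖x‖ < ‖y‖ then ENNReal.ofReal (|u x - u y| ^ p) * hardyK d σ x y else 0) := by
  rw [hardy_symm d hd (fun x y => ENNReal.ofReal (|u x - u y| ^ p * ‖x - y‖ ^ (-(d : ℝ) - σ)))]
  · congr 1
    refine lintegral_congr fun x => lintegral_congr fun y => ?_
    rw [ENNReal.ofReal_mul (by positivity)]; rfl
  · simp only [Function.uncurry_def]; fun_prop
  · intro x y
    rw [abs_sub_comm, norm_sub_rev]

lemma hardy_lower_trunc (d : ℕ) (hd : 1 ≤ d) (s p : ℝ) (hs : 0 < s) (hs1 : s < 1) (hp : 1 ≤ p)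
    (hsp : s * p < d) (γ : ℝ) (hγ : γ = ((d:ℝ) - s * p) / p)
    (u : EuclideanSpace ℝ (Fin d) → ℝ) (hu : Continuous u) (hc : HasCompactSupport u)
    (l : ℝ) (hl0 : 0 < l) (hl1 : l < 1) :
    hardyJ d (s * p) (s * p - 1) (fun t => if t < l then ENNReal.ofReal ((1 - t ^ γ) ^ p) else 0) *
      ∫⁻ x, ENNReal.ofReal (|u x| ^ p * ‖x‖ ^ (-(s * p))) ≤
    ∫⁻ x, ∫⁻ y, (if ‖x‖ < ‖y‖ then ENNReal.ofReal (|u x - u y| ^ p) * hardyK d (s * p) x y else 0) := by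
  have : Nonempty (Fin d) := ⟨⟨0, hd⟩⟩
  have hp0 : 0 < p := by linarith
  have hγ0 : 0 < γ := by rw [hγ]; exact div_pos (by linarith) hp0
  have hum := hu.measurable
  have hN := hardy_N_finite d hd p (s * p) hp hsp u hu hc
  set σ := s * p with hσ
  have hNe : ∫⁻ x, ENNReal.ofReal (|u x| ^ p * ‖x‖ ^ (-σ)) =
      ∫⁻ x, ENNReal.ofReal (|u x| ^ p) * ENNReal.ofReal (‖x‖ ^ (-σ)) := by
    refine lintegral_congr fun x => ?_
    rw [ENNReal.ofReal_mul (by positivity)]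
  rw [hNe] at hN ⊢
  set N := ∫⁻ x, ENNReal.ofReal (|u x| ^ p) * ENNReal.ofReal (‖x‖ ^ (-σ))
  set E := ∫⁻ x, ∫⁻ y, (if ‖x‖ < ‖y‖ then ENNReal.ofReal (|u x - u y| ^ p) * hardyK d σ x y else 0)
    with hE
  set g0 : ℝ → ℝ≥0∞ := fun t => if t < l then ENNReal.ofReal ((1 - t ^ γ) ^ p) else 0 with hg0
  set g1 : ℝ → ℝ≥0∞ := fun t => if t < l then ENNReal.ofReal ((1 - t ^ γ) ^ (p - 1)) else 0 with hg1
  set g2 : ℝ → ℝ≥0∞ := fun t => if t < l then ENNReal.ofReal (((t ^ γ)⁻¹ - 1) ^ (p - 1)) else 0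
    with hg2
  have hg0m : Measurable g0 := Measurable.ite measurableSet_Iio (by fun_prop) measurable_const
  have hg1m : Measurable g1 := Measurable.ite measurableSet_Iio (by fun_prop) measurable_const
  have hg2m : Measurable g2 := Measurable.ite measurableSet_Iio (by fun_prop) measurable_const
  have hθ : ∀ t : ℝ, 0 < t → t < 1 → 0 < t ^ γ ∧ t ^ γ < 1 := fun t h0 h1 =>
    ⟨by positivity, Real.rpow_lt_one h0.le h1 hγ0⟩
  -- main estimate
  have hK := hardyK_measurable d σ
  have hmain : hardyJ d σ (σ - 1) g1 * N ≤ E + hardyJ d σ ((d:ℝ) - 1) g2 * N := by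
    rw [← hardy_double_outer d hd σ g1 hg1m (fun x => ENNReal.ofReal (|u x| ^ p)) (by fun_prop)
      (fun _ => ENNReal.ofReal_ne_top), ← hardy_double_inner d hd σ g2 hg2m
      (fun x => ENNReal.ofReal (|u x| ^ p)) (by fun_prop) (fun _ => ENNReal.ofReal_ne_top), hE]
    have hmE : Measurable (Function.uncurry fun x y : EuclideanSpace ℝ (Fin d) =>
        (if ‖x‖ < ‖y‖ then ENNReal.ofReal (|u x - u y| ^ p) * hardyK d σ x y else 0)) := by
      simp only [Function.uncurry_def] at hK ⊢
      refine Measurable.ite (measurableSet_lt ?_ ?_) ?_ measurable_const <;> fun_prop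
    rw [← lintegral_add_left hmE.lintegral_prod_right]
    have h0 : ∀ᵐ x : EuclideanSpace ℝ (Fin d), x ≠ 0 := by
      simp [ae_iff]
    refine lintegral_mono_ae ?_
    filter_upwards [h0] with x hx
    rw [← lintegral_add_left (hmE.of_uncurry_left (x := x))]
    refine lintegral_mono fun y => ?_
    simp only
    by_cases hxy : ‖x‖ < ‖y‖
    swap
    · simp [hxy]
    simp only [hxy, if_true]
    have hx0 : 0 < ‖x‖ := norm_pos_iff.2 hx
    have ht0 : 0 < ‖x‖ / ‖y‖ := div_pos hx0 (hx0.trans hxy)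
    have ht1 : ‖x‖ / ‖y‖ < 1 := (div_lt_one (hx0.trans hxy)).2 hxy
    set t := ‖x‖ / ‖y‖
    simp only [hg1, hg2]
    by_cases htl : t < l
    swap
    · simp [htl]
    simp only [htl, if_true]
    obtain ⟨h1, h2⟩ := hθ t ht0 ht1
    have h3 : 0 < 1 - t ^ γ := by linarith
    have h4 : 0 < (t ^ γ)⁻¹ - 1 := by
      have := (one_lt_inv₀ h1).2 h2
      linarith
    rw [← mul_assoc, ← mul_assoc, ← add_mul, ← ENNReal.ofReal_mul (by positivity),
      ← ENNReal.ofReal_mul (by positivity), ← ENNReal.ofReal_add (by positivity) (by positivity)]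
    gcongr
    have := hardy_lower p (t ^ γ) (u x) (u y) hp h1 h2
    linarith
  have hsplit : hardyJ d σ (σ - 1) g1 = hardyJ d σ (σ - 1) g0 + hardyJ d σ ((d:ℝ) - 1) g2 := by
    unfold hardyJ
    have hPm := PhiE_measurable d σ 1
    rw [← lintegral_add_left (by fun_prop)]
    refine setLIntegral_congr_fun measurableSet_Ioo fun t ht => ?_
    simp only [hg0, hg1, hg2]
    by_cases htl : t < l
    swap
    · simp [htl]
    simp only [htl, if_true]
    have ht0 := ht.1
    obtain ⟨h1, h2⟩ := hθ t ht.1 ht.2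
    have h3 : 0 < 1 - t ^ γ := by linarith
    have h4 : 0 < (t ^ γ)⁻¹ - 1 := by
      have := (one_lt_inv₀ h1).2 h2
      linarith
    rw [← mul_assoc, ← mul_assoc, ← mul_assoc, ← add_mul, ← ENNReal.ofReal_mul (by positivity),
      ← ENNReal.ofReal_mul (by positivity), ← ENNReal.ofReal_mul (by positivity),
      ← ENNReal.ofReal_add (by positivity) (by positivity)]
    congr 2
    have e1 : (1 - t ^ γ) ^ p = (1 - t ^ γ) * (1 - t ^ γ) ^ (p - 1) := by
      nth_rewrite 2 [← Real.rpow_one (1 - t ^ γ)]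
      rw [← Real.rpow_add h3]; congr 1; ring
    have e2 : ((t ^ γ)⁻¹ - 1) ^ (p - 1) = (1 - t ^ γ) ^ (p - 1) * t ^ (-(γ * (p - 1))) := by
      rw [show (t ^ γ)⁻¹ - 1 = (1 - t ^ γ) * (t ^ γ)⁻¹ by field_simp,
        Real.mul_rpow h3.le (by positivity), ← Real.rpow_neg ht0.le, ← Real.rpow_mul ht0.le]
      congr 2; ring
    have e3 : t ^ (-(γ * (p - 1))) * t ^ ((d:ℝ) - 1) = t ^ γ * t ^ (σ - 1) := by
      rw [← Real.rpow_add ht0, ← Real.rpow_add ht0]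
      congr 1
      have : γ * p = d - σ := by rw [hγ]; field_simp
      linarith
    rw [e1, e2, mul_assoc _ _ (t ^ ((d:ℝ) - 1)), e3]
    ring
  have hlg : 0 < 1 - l ^ γ := by linarith [(hθ l hl0 hl1).2]
  have hfin1 : hardyJ d σ (σ - 1) g1 < ∞ := by
    refine lt_of_le_of_lt (hardyJ_mono (g' := fun t => ENNReal.ofReal ((1 - l ^ γ)⁻¹) *
      ENNReal.ofReal ((1 - t ^ γ) ^ p)) fun t ht => ?_) ?_
    · simp only [hg1]
      by_cases htl : t < l
      swap
      · simp [htl]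
      simp only [htl, if_true]
      have ht0 := ht.1
      obtain ⟨h1, h2⟩ := hθ t ht.1 ht.2
      have h3 : 0 < 1 - t ^ γ := by linarith
      rw [← ENNReal.ofReal_mul (by positivity)]
      apply ENNReal.ofReal_le_ofReal
      have e1 : (1 - t ^ γ) ^ p = (1 - t ^ γ) * (1 - t ^ γ) ^ (p - 1) := by
        nth_rewrite 2 [← Real.rpow_one (1 - t ^ γ)]
        rw [← Real.rpow_add h3]; congr 1; ring
      have h5 : t ^ γ ≤ l ^ γ := by gcongr
      rw [e1, ← mul_assoc]
      have h6 : 1 ≤ (1 - l ^ γ)⁻¹ * (1 - t ^ γ) := by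
        rw [inv_mul_eq_div, one_le_div hlg]; linarith
      exact le_mul_of_one_le_left (by positivity) h6
    · rw [hardyJ_const_mul _ ENNReal.ofReal_ne_top]
      exact ENNReal.mul_lt_top ENNReal.ofReal_lt_top (hardyJ_C_finite d hd s p hs hs1 hp γ hγ0)
  have hfin2 : hardyJ d σ ((d:ℝ) - 1) g2 * N ≠ ∞ := by
    refine ENNReal.mul_ne_top (ne_top_of_le_ne_top hfin1.ne ?_) hN.ne
    rw [hsplit]; exact le_add_self
  rw [hsplit, add_mul] at hmain
  exact (ENNReal.add_le_add_iff_right hfin2).1 hmain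

lemma hardy_part1 (d : ℕ) (hd : 1 ≤ d) (s p : ℝ) (hs : 0 < s) (hs1 : s < 1) (hp : 1 ≤ p)
    (hsp : s * p < d) (u : EuclideanSpace ℝ (Fin d) → ℝ) (hu : Continuous u)
    (hc : HasCompactSupport u) :
    ENNReal.ofReal (HardyConst d s p) * ∫⁻ x, ENNReal.ofReal (|u x| ^ p * ‖x‖ ^ (-(s * p))) ≤
    ∫⁻ x, ∫⁻ y, ENNReal.ofReal (|u x - u y| ^ p * ‖x - y‖ ^ (-(d : ℝ) - s * p)) := by
  rw [hardy_energy d hd (s * p) p u hu.measurable, (HardyConst_eq d hd s p hs hs1 hp hsp).1, mul_assoc]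
  gcongr
  have key := hardy_lower_trunc d hd s p hs hs1 hp hsp _ rfl u hu hc
  set γ := ((d:ℝ) - s * p) / p
  set E := ∫⁻ x, ∫⁻ y, (if ‖x‖ < ‖y‖ then ENNReal.ofReal (|u x - u y| ^ p) * hardyK d (s * p) x y else 0)
  set N := ∫⁻ x, ENNReal.ofReal (|u x| ^ p * ‖x‖ ^ (-(s * p)))
  have hsup : hardyJ d (s * p) (s * p - 1) (fun t => ENNReal.ofReal ((1 - t ^ γ) ^ p)) =
      ⨆ n : ℕ, hardyJ d (s * p) (s * p - 1)
        (fun t => if t < 1 - 1 / ((n:ℝ) + 2) then ENNReal.ofReal ((1 - t ^ γ) ^ p) else 0) := by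
    have hPm := PhiE_measurable d (s * p) 1
    unfold hardyJ
    rw [← lintegral_iSup]
    · refine setLIntegral_congr_fun measurableSet_Ioo fun t ht => ?_
      simp only
      rw [← ENNReal.iSup_mul]
      congr 1
      apply le_antisymm
      · obtain ⟨n, hn⟩ := exists_nat_one_div_lt (sub_pos.2 ht.2)
        refine le_iSup_of_le n ?_
        have : 1 / ((n:ℝ) + 2) ≤ 1 / ((n:ℝ) + 1) := by gcongr; norm_num
        rw [if_pos (by linarith)]
      · refine iSup_le fun n => ?_
        split_ifs <;> simp
    · intro n
      refine Measurable.mul (Measurable.ite measurableSet_Iio (by fun_prop) measurable_const) (by fun_prop)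
    · intro n m hnm t
      simp only
      gcongr
      have h3 : (n:ℝ) ≤ m := by exact_mod_cast hnm
      have h4 : 1 / ((m:ℝ) + 2) ≤ 1 / ((n:ℝ) + 2) := by gcongr
      by_cases h : t < 1 - 1 / ((n:ℝ) + 2)
      · rw [if_pos h, if_pos (by linarith)]
      · rw [if_neg h]; exact zero_le
  rw [hsup, ENNReal.iSup_mul]
  refine iSup_le fun n => key _ ?_ ?_
  · have : 1 / ((n:ℝ) + 2) < 1 := by
      rw [div_lt_one (by positivity)]
      have : (0:ℝ) ≤ n := n.cast_nonneg
      linarith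
    linarith
  · have : 0 < 1 / ((n:ℝ) + 2) := by positivity
    linarith

/-- A smooth cutoff profile. -/
structure HardyCut (η : ℝ → ℝ) (K : ℝ) : Prop where
  smooth : ContDiff ℝ 1 η
  nonneg : ∀ z, 0 ≤ η z
  one : ∀ z, |z| ≤ 1 → η z = 1
  zero : ∀ z, 2 ≤ |z| → η z = 0
  K_nonneg : 0 ≤ K
  lip : ∀ z w, |η z - η w| ≤ K * |z - w|

lemma hardy_cut_exists : ∃ η K, HardyCut η K := by
  let η : ContDiffBump (0:ℝ) := ⟨1, 2, by norm_num, by norm_num⟩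
  have h1 : ContDiff ℝ 1 η := η.contDiff
  obtain ⟨K, hK⟩ := h1.lipschitzWith_of_hasCompactSupport η.hasCompactSupport (by norm_num)
  refine ⟨η, K, h1, fun z => η.nonneg, fun z hz => ?_, fun z hz => ?_, K.2, fun z w => ?_⟩
  · apply η.one_of_mem_closedBall; simpa [η] using hz
  · apply η.zero_of_le_dist; simpa [η] using hz
  · simpa [Real.dist_eq] using hK.dist_le_mul z w

/-- Radial profile of the test function. -/
def hardyU (η : ℝ → ℝ) (γ L r : ℝ) : ℝ := r ^ (-γ) * η (Real.log r / L)

/-- Indicator-type weight. -/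
def hardyF (δ b r : ℝ) : ℝ := if |Real.log r| ≤ b then r ^ (-δ) else 0

lemma hardyF_nonneg (δ b r : ℝ) (hr : 0 ≤ r) : 0 ≤ hardyF δ b r := by
  unfold hardyF; split_ifs <;> positivity

lemma hardyF_measurable (δ b : ℝ) : Measurable (hardyF δ b) := by
  unfold hardyF
  refine Measurable.ite (measurableSet_le (by fun_prop) (by fun_prop)) (by fun_prop) (by fun_prop)

lemma hardyU_pointwise {η : ℝ → ℝ} {K : ℝ} (hη : HardyCut η K) (p γ θ L a b : ℝ) (hp : 1 ≤ p)
    (hγ : 0 < γ) (hθ : 0 < θ) (hθ1 : θ < 1) (hL : 0 < L) (ha : 0 < a) (hab : a < b) :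
    |hardyU η γ L a - hardyU η γ L b| ^ p ≤
      (1 - θ) ^ (1 - p) * ((1 - (a / b) ^ γ) ^ p * |hardyU η γ L a| ^ p) +
      θ ^ (1 - p) * (K / L) ^ p * ((-Real.log (a / b)) ^ p *
        (hardyF (γ * p) (2 * L) a + hardyF (γ * p) (2 * L) b)) := by
  have hb : 0 < b := ha.trans hab
  have hK := hη.K_nonneg
  have ht0 : 0 < a / b := by positivity
  have ht1 : a / b < 1 := (div_lt_one hb).2 hab
  have htγ : (a / b) ^ γ ≤ 1 := Real.rpow_le_one ht0.le ht1.le hγ.le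
  have hlog : 0 < - Real.log (a / b) := by linarith [Real.log_neg ht0 ht1]
  have hωb : b ^ (-γ) = a ^ (-γ) * (a / b) ^ γ := by
    rw [Real.div_rpow ha.le hb.le, Real.rpow_neg ha.le, Real.rpow_neg hb.le]
    have := (Real.rpow_pos_of_pos ha γ).ne'
    field_simp
  have hc := hardy_conv p θ ((a ^ (-γ) - b ^ (-γ)) * η (Real.log a / L))
    (b ^ (-γ) * (η (Real.log a / L) - η (Real.log b / L))) hp hθ hθ1
  have e1 : (a ^ (-γ) - b ^ (-γ)) * η (Real.log a / L) +
    (b ^ (-γ) * (η (Real.log a / L) - η (Real.log b / L))) = hardyU η γ L a - hardyU η γ L b := by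
    unfold hardyU; ring
  rw [e1] at hc
  have eA : |(a ^ (-γ) - b ^ (-γ)) * η (Real.log a / L)| ^ p =
      (1 - (a / b) ^ γ) ^ p * |hardyU η γ L a| ^ p := by
    rw [← Real.mul_rpow (by linarith) (abs_nonneg _)]
    congr 1
    rw [hωb, ← abs_of_nonneg (show 0 ≤ 1 - (a/b)^γ by linarith), ← abs_mul]
    unfold hardyU; congr 1; ring
  have hFa := hardyF_nonneg (γ * p) (2 * L) a ha.le
  have hFb := hardyF_nonneg (γ * p) (2 * L) b hb.le
  have eB : |b ^ (-γ) * (η (Real.log a / L) - η (Real.log b / L))| ^ p ≤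
      (K / L) ^ p * ((-Real.log (a / b)) ^ p *
        (hardyF (γ * p) (2 * L) a + hardyF (γ * p) (2 * L) b)) := by
    have hbp : (b ^ (-γ)) ^ p = b ^ (-(γ * p)) := by
      rw [← Real.rpow_mul hb.le]; ring_nf
    have hba : b ^ (-(γ * p)) ≤ a ^ (-(γ * p)) :=
      Real.rpow_le_rpow_of_nonpos ha hab.le (by nlinarith)
    by_cases hz : 2 * L < |Real.log a| ∧ 2 * L < |Real.log b|
    · have hz1 : η (Real.log a / L) = 0 := hη.zero _ (by
        rw [abs_div, abs_of_pos hL, le_div_iff₀ hL]; exact hz.1.le)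
      have hz2 : η (Real.log b / L) = 0 := hη.zero _ (by
        rw [abs_div, abs_of_pos hL, le_div_iff₀ hL]; exact hz.2.le)
      rw [hz1, hz2]
      simp only [sub_zero, mul_zero, abs_zero]
      rw [Real.zero_rpow (by linarith)]; positivity
    · have hS : b ^ (-(γ * p)) ≤ hardyF (γ * p) (2 * L) a + hardyF (γ * p) (2 * L) b := by
        by_cases h1 : |Real.log b| ≤ 2 * L
        · have : hardyF (γ * p) (2 * L) b = b ^ (-(γ * p)) := if_pos h1
          linarith
        · have h2 : |Real.log a| ≤ 2 * L := by
            by_contra h3; exact hz ⟨not_le.1 h3, not_le.1 h1⟩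
          have : hardyF (γ * p) (2 * L) a = a ^ (-(γ * p)) := if_pos h2
          linarith
      have hd : |η (Real.log a / L) - η (Real.log b / L)| ≤ (K / L) * (-Real.log (a / b)) := by
        refine (hη.lip _ _).trans (le_of_eq ?_)
        rw [← sub_div, ← Real.log_div ha.ne' hb.ne', abs_div, abs_of_pos hL, abs_of_neg (by linarith)]
        ring
      rw [abs_mul, abs_of_pos (Real.rpow_pos_of_pos hb _), Real.mul_rpow (by positivity) (abs_nonneg _), hbp]
      calc b ^ (-(γ * p)) * |η (Real.log a / L) - η (Real.log b / L)| ^ p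
          ≤ (hardyF (γ * p) (2 * L) a + hardyF (γ * p) (2 * L) b) * ((K / L) * (-Real.log (a / b))) ^ p := by
            gcongr
        _ = _ := by
            rw [Real.mul_rpow (by positivity) hlog.le]; ring
  refine hc.trans ?_
  rw [eA]
  have := mul_le_mul_of_nonneg_left eB (Real.rpow_nonneg hθ.le (1 - p))
  linarith

lemma hardyU_contDiff {η : ℝ → ℝ} {K : ℝ} (hη : HardyCut η K) (d : ℕ) (γ L : ℝ)
    (hγ : 0 < γ) (hL : 0 < L) :
    ContDiff ℝ 1 (fun x : EuclideanSpace ℝ (Fin d) => hardyU η γ L ‖x‖) := by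
  rw [contDiff_iff_contDiffAt]
  intro x
  by_cases hx : x = 0
  · subst hx
    have : (fun x : EuclideanSpace ℝ (Fin d) => hardyU η γ L ‖x‖) =ᶠ[nhds 0] fun _ => 0 := by
      filter_upwards [Metric.ball_mem_nhds (0 : EuclideanSpace ℝ (Fin d)) (Real.exp_pos (-(2*L)))] with y hy
      rw [mem_ball_zero_iff] at hy
      unfold hardyU
      rcases (norm_nonneg y).eq_or_lt with h | h
      · rw [← h, Real.zero_rpow (by linarith), zero_mul]
      · have h2 : Real.log ‖y‖ < -(2 * L) := (Real.log_lt_iff_lt_exp h).2 hy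
        rw [hη.zero, mul_zero]
        rw [abs_div, abs_of_pos hL, le_div_iff₀ hL, abs_of_neg (by linarith)]; linarith
    exact contDiffAt_const.congr_of_eventuallyEq this
  · have hn : ContDiffAt ℝ 1 (fun x : EuclideanSpace ℝ (Fin d) => ‖x‖) x := contDiffAt_norm ℝ hx
    have hx' : ‖x‖ ≠ 0 := norm_ne_zero_iff.2 hx
    unfold hardyU
    refine (hn.rpow_const_of_ne hx').mul ?_
    exact hη.smooth.contDiffAt.comp x ((hn.log hx').div_const L)

lemma hardyU_compact {η : ℝ → ℝ} {K : ℝ} (hη : HardyCut η K) (d : ℕ) (γ L : ℝ) (hL : 0 < L) :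
    HasCompactSupport (fun x : EuclideanSpace ℝ (Fin d) => hardyU η γ L ‖x‖) := by
  refine HasCompactSupport.intro (isCompact_closedBall (0 : EuclideanSpace ℝ (Fin d)) (Real.exp (2 * L))) ?_
  intro x hx
  rw [mem_closedBall_zero_iff, not_le] at hx
  have h0 : 0 < ‖x‖ := (Real.exp_pos _).trans hx
  have h2 : 2 * L < Real.log ‖x‖ := (Real.lt_log_iff_exp_lt h0).2 hx
  unfold hardyU
  rw [hη.zero, mul_zero]
  rw [abs_div, abs_of_pos hL, le_div_iff₀ hL, abs_of_pos (by linarith)]; linarith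

lemma hardy_annulus (d : ℕ) (hd : 1 ≤ d) (σ b : ℝ) (hb : 0 < b) :
    ∫⁻ x : EuclideanSpace ℝ (Fin d), ENNReal.ofReal (hardyF ((d:ℝ) - σ) b ‖x‖) * ENNReal.ofReal (‖x‖ ^ (-σ)) =
      (d * volume (Metric.ball (0 : EuclideanSpace ℝ (Fin d)) 1)) * ENNReal.ofReal (2 * b) := by
  have hm := hardyF_measurable ((d:ℝ) - σ) b
  rw [hardy_lint_norm d hd (fun r => ENNReal.ofReal (hardyF ((d:ℝ) - σ) b r) * ENNReal.ofReal (r ^ (-σ))) (by fun_prop)]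
  congr 1
  have hlt : Real.exp (-b) ≤ Real.exp b := Real.exp_le_exp.2 (by linarith)
  have e1 : ∀ ρ ∈ Ioi (0:ℝ), ENNReal.ofReal (ρ ^ (d - 1)) *
      (ENNReal.ofReal (hardyF ((d:ℝ) - σ) b ρ) * ENNReal.ofReal (ρ ^ (-σ))) =
      (Icc (Real.exp (-b)) (Real.exp b)).indicator (fun ρ => ENNReal.ofReal ρ⁻¹) ρ := by
    intro ρ hρ
    rw [mem_Ioi] at hρ
    have hiff : |Real.log ρ| ≤ b ↔ ρ ∈ Icc (Real.exp (-b)) (Real.exp b) := by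
      rw [abs_le, mem_Icc, Real.le_log_iff_exp_le hρ, Real.log_le_iff_le_exp hρ]
    by_cases h : ρ ∈ Icc (Real.exp (-b)) (Real.exp b)
    · rw [indicator_of_mem h, hardyF, if_pos (hiff.2 h), ← ENNReal.ofReal_mul (by positivity),
        ← ENNReal.ofReal_mul (by positivity)]
      congr 1
      rw [← Real.rpow_natCast, ← Real.rpow_add hρ, ← Real.rpow_add hρ, ← Real.rpow_neg_one]
      congr 1
      push_cast [hd]; ring
    · rw [indicator_of_notMem h, hardyF, if_neg (fun h' => h (hiff.1 h'))]; simp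
  rw [setLIntegral_congr_fun measurableSet_Ioi e1, setLIntegral_indicator measurableSet_Icc,
    inter_eq_left.2 (show Icc (Real.exp (-b)) (Real.exp b) ⊆ Ioi 0 from fun ρ hρ => mem_Ioi.2 ((Real.exp_pos _).trans_le hρ.1)), ← restrict_Ioc_eq_restrict_Icc,
    ← ofReal_integral_eq_lintegral_ofReal, ← intervalIntegral.integral_of_le hlt, integral_inv_of_pos (Real.exp_pos _) (Real.exp_pos _),
    ← Real.exp_sub, Real.log_exp]
  · congr 1; ring
  · rw [← IntegrableOn, ← intervalIntegrable_iff_integrableOn_Ioc_of_le hlt]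
    exact intervalIntegral.intervalIntegrable_inv (fun x hx => by
      rw [uIcc_of_le hlt] at hx; exact ((Real.exp_pos _).trans_le hx.1).ne') continuousOn_id
  · filter_upwards [ae_restrict_mem measurableSet_Ioc] with ρ hρ
    exact (inv_pos.2 ((Real.exp_pos _).trans hρ.1)).le

lemma hardy_sum3 {X : Type*} [MeasureSpace X] [SFinite (volume : Measure X)] (T1 T2 T3 : X → X → ℝ≥0∞)
    (hm1 : Measurable (fun z : X × X => T1 z.1 z.2)) (hm2 : Measurable (fun z : X × X => T2 z.1 z.2))
    (hm3 : Measurable (fun z : X × X => T3 z.1 z.2)) (c1 c2 : ℝ≥0∞) :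
    ∫⁻ x, ∫⁻ y, (c1 * T1 x y + (c2 * T2 x y + c2 * T3 x y)) =
      c1 * (∫⁻ x, ∫⁻ y, T1 x y) + (c2 * (∫⁻ x, ∫⁻ y, T2 x y) + c2 * (∫⁻ x, ∫⁻ y, T3 x y)) := by
  have a1 : ∀ x, Measurable (T1 x) := fun x => hm1.comp (measurable_prodMk_left (x := x))
  have a2 : ∀ x, Measurable (T2 x) := fun x => hm2.comp (measurable_prodMk_left (x := x))
  have a3 : ∀ x, Measurable (T3 x) := fun x => hm3.comp (measurable_prodMk_left (x := x))
  have b1 : Measurable (fun x => ∫⁻ y, T1 x y) := hm1.lintegral_prod_right'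
  have b2 : Measurable (fun x => ∫⁻ y, T2 x y) := hm2.lintegral_prod_right'
  have b3 : Measurable (fun x => ∫⁻ y, T3 x y) := hm3.lintegral_prod_right'
  have hx : ∀ x, ∫⁻ y, (c1 * T1 x y + (c2 * T2 x y + c2 * T3 x y)) =
      c1 * (∫⁻ y, T1 x y) + (c2 * (∫⁻ y, T2 x y) + c2 * (∫⁻ y, T3 x y)) := by
    intro x
    rw [lintegral_add_left ((a1 x).const_mul _), lintegral_add_left ((a2 x).const_mul _),
      lintegral_const_mul _ (a1 x), lintegral_const_mul _ (a2 x), lintegral_const_mul _ (a3 x)]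
  simp only [hx]
  rw [lintegral_add_left (b1.const_mul _), lintegral_add_left (b2.const_mul _),
      lintegral_const_mul _ b1, lintegral_const_mul _ b2, lintegral_const_mul _ b3]

set_option maxHeartbeats 1000000 in
lemma hardy_upper {η : ℝ → ℝ} {K : ℝ} (hη : HardyCut η K) (d : ℕ) (hd : 1 ≤ d) (s p : ℝ)
    (hs : 0 < s) (hs1 : s < 1) (hp : 1 ≤ p) (hsp : s * p < d) (θ L : ℝ) (hθ : 0 < θ) (hθ1 : θ < 1)
    (hL : 0 < L) (u : EuclideanSpace ℝ (Fin d) → ℝ)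
    (hu : u = fun x => hardyU η (((d:ℝ) - s * p) / p) L ‖x‖) :
    (∫⁻ x, ∫⁻ y, ENNReal.ofReal (|u x - u y| ^ p * ‖x - y‖ ^ (-(d : ℝ) - s * p))) ≤
      (ENNReal.ofReal ((1 - θ) ^ (1 - p)) * ENNReal.ofReal (HardyConst d s p) +
        8 * ENNReal.ofReal (θ ^ (1 - p) * (K / L) ^ p) *
          hardyJ d (s * p) (s * p - 1) (fun t => ENNReal.ofReal ((-Real.log t) ^ p))) *
      ∫⁻ x, ENNReal.ofReal (|u x| ^ p * ‖x‖ ^ (-(s * p))) ∧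
    (∫⁻ x, ENNReal.ofReal (|u x| ^ p * ‖x‖ ^ (-(s * p)))) ≠ 0 := by
  have hp0 : 0 < p := by linarith
  have hK := hη.K_nonneg
  have : Nonempty (Fin d) := ⟨⟨0, hd⟩⟩
  set σ := s * p with hσ
  set γ := ((d:ℝ) - σ) / p with hγd
  have hγ : 0 < γ := div_pos (by linarith) hp0
  have hγp : γ * p = (d:ℝ) - σ := by rw [hγd]; field_simp
  have hum : Measurable u := by
    rw [hu]; exact (hardyU_contDiff hη d γ L hγ hL).continuous.measurable
  have h0 : ∀ᵐ x : EuclideanSpace ℝ (Fin d), x ≠ 0 := by simp [ae_iff]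
  have hFm := hardyF_measurable ((d:ℝ) - σ) (2 * L)
  set f : EuclideanSpace ℝ (Fin d) → ℝ≥0∞ := fun x => ENNReal.ofReal (hardyF ((d:ℝ) - σ) (2 * L) ‖x‖) with hf
  have hfm : Measurable f := by rw [hf]; fun_prop
  set N := ∫⁻ x, ENNReal.ofReal (|u x| ^ p * ‖x‖ ^ (-σ)) with hN
  have hNe : N = ∫⁻ x, ENNReal.ofReal (|u x| ^ p) * ENNReal.ofReal (‖x‖ ^ (-σ)) := by
    refine lintegral_congr fun x => ?_
    rw [ENNReal.ofReal_mul (by positivity)]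
  have hlow : (d * volume (Metric.ball (0 : EuclideanSpace ℝ (Fin d)) 1)) * ENNReal.ofReal (2 * L) ≤ N := by
    rw [hNe, ← hardy_annulus d hd σ L hL]
    refine lintegral_mono_ae ?_
    filter_upwards [h0] with x hx
    gcongr
    have hx0 : 0 < ‖x‖ := norm_pos_iff.2 hx
    unfold hardyF
    split_ifs with h
    · rw [hu]
      simp only [hardyU]
      rw [hη.one _ (by rw [abs_div, abs_of_pos hL, div_le_one hL]; exact h), mul_one,
        abs_of_pos (Real.rpow_pos_of_pos hx0 _), ← Real.rpow_mul hx0.le, ← hγp, neg_mul]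
    · positivity
  have hN0 : N ≠ 0 := by
    intro h
    rw [h, nonpos_iff_eq_zero, mul_eq_zero, mul_eq_zero] at hlow
    rcases hlow with (h | h) | h
    · simp at h; omega
    · exact (Metric.measure_ball_pos volume _ one_pos).ne' h
    · rw [ENNReal.ofReal_eq_zero] at h; linarith
  refine ⟨?_, hN0⟩
  have hS : ∫⁻ x, f x * ENNReal.ofReal (‖x‖ ^ (-σ)) ≤ 2 * N := by
    have e := hardy_annulus d hd σ (2 * L) (by positivity)
    rw [show ∫⁻ x, f x * ENNReal.ofReal (‖x‖ ^ (-σ)) = _ from e,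
      ENNReal.ofReal_mul (by norm_num), ENNReal.ofReal_ofNat, mul_left_comm]
    gcongr
  set S := ∫⁻ x, f x * ENNReal.ofReal (‖x‖ ^ (-σ))
  set gA : ℝ → ℝ≥0∞ := fun t => ENNReal.ofReal ((1 - t ^ γ) ^ p) with hgA
  set gM : ℝ → ℝ≥0∞ := fun t => ENNReal.ofReal ((-Real.log t) ^ p) with hgM
  have hgAm : Measurable gA := by rw [hgA]; fun_prop
  have hgMm : Measurable gM := by rw [hgM]; fun_prop
  set c1 := ENNReal.ofReal ((1 - θ) ^ (1 - p)) with hc1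
  set c2 := ENNReal.ofReal (θ ^ (1 - p) * (K / L) ^ p) with hc2
  set fu : EuclideanSpace ℝ (Fin d) → ℝ≥0∞ := fun x => ENNReal.ofReal (|u x| ^ p) with hfu
  have hfum : Measurable fu := by rw [hfu]; fun_prop
  have hKm := hardyK_measurable d σ
  simp only [Function.uncurry_def] at hKm
  set T1 : EuclideanSpace ℝ (Fin d) → EuclideanSpace ℝ (Fin d) → ℝ≥0∞ := fun x y =>
    if ‖x‖ < ‖y‖ then fu x * (gA (‖x‖ / ‖y‖) * hardyK d σ x y) else 0 with hT1
  set T2 : EuclideanSpace ℝ (Fin d) → EuclideanSpace ℝ (Fin d) → ℝ≥0∞ := fun x y =>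
    if ‖x‖ < ‖y‖ then f x * (gM (‖x‖ / ‖y‖) * hardyK d σ x y) else 0 with hT2
  set T3 : EuclideanSpace ℝ (Fin d) → EuclideanSpace ℝ (Fin d) → ℝ≥0∞ := fun x y =>
    if ‖x‖ < ‖y‖ then f y * (gM (‖x‖ / ‖y‖) * hardyK d σ x y) else 0 with hT3
  have hm1 : Measurable (fun z : EuclideanSpace ℝ (Fin d) × EuclideanSpace ℝ (Fin d) => T1 z.1 z.2) := by
    refine Measurable.ite (measurableSet_lt ?_ ?_) ?_ measurable_const <;> fun_prop
  have hm2 : Measurable (fun z : EuclideanSpace ℝ (Fin d) × EuclideanSpace ℝ (Fin d) => T2 z.1 z.2) := by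
    refine Measurable.ite (measurableSet_lt ?_ ?_) ?_ measurable_const <;> fun_prop
  have hm3 : Measurable (fun z : EuclideanSpace ℝ (Fin d) × EuclideanSpace ℝ (Fin d) => T3 z.1 z.2) := by
    refine Measurable.ite (measurableSet_lt ?_ ?_) ?_ measurable_const <;> fun_prop
  have hI1 : ∫⁻ x, ∫⁻ y, T1 x y = hardyJ d σ (σ - 1) gA * N := by
    rw [hNe]; exact hardy_double_outer d hd σ gA hgAm fu hfum (fun x => ENNReal.ofReal_ne_top)
  have hI2 : ∫⁻ x, ∫⁻ y, T2 x y = hardyJ d σ (σ - 1) gM * S :=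
    hardy_double_outer d hd σ gM hgMm f hfm (fun x => ENNReal.ofReal_ne_top)
  have hI3 : ∫⁻ x, ∫⁻ y, T3 x y = hardyJ d σ ((d:ℝ) - 1) gM * S :=
    hardy_double_inner d hd σ gM hgMm f hfm (fun x => ENNReal.ofReal_ne_top)
  have hJ : hardyJ d σ ((d:ℝ) - 1) gM ≤ hardyJ d σ (σ - 1) gM := by
    refine setLIntegral_mono' measurableSet_Ioo fun t ht => ?_
    gcongr gM t * (ENNReal.ofReal ?_ * _)
    exact Real.rpow_le_rpow_of_exponent_ge ht.1 ht.2.le (by linarith)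
  have hpt : ∫⁻ x, ∫⁻ y, (if ‖x‖ < ‖y‖ then ENNReal.ofReal (|u x - u y| ^ p) * hardyK d σ x y else 0) ≤
      ∫⁻ x, ∫⁻ y, (c1 * T1 x y + (c2 * T2 x y + c2 * T3 x y)) := by
    refine lintegral_mono_ae ?_
    filter_upwards [h0] with x hx
    refine lintegral_mono fun y => ?_
    have hx0 : 0 < ‖x‖ := norm_pos_iff.2 hx
    simp only [hT1, hT2, hT3]
    by_cases hxy : ‖x‖ < ‖y‖
    · simp only [if_pos hxy]
      have hb : 0 < ‖y‖ := hx0.trans hxy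
      have ht0 : 0 < ‖x‖ / ‖y‖ := by positivity
      have ht1 : ‖x‖ / ‖y‖ < 1 := (div_lt_one hb).2 hxy
      have htγ : (‖x‖ / ‖y‖) ^ γ ≤ 1 := Real.rpow_le_one ht0.le ht1.le hγ.le
      have hlog : 0 < - Real.log (‖x‖ / ‖y‖) := by linarith [Real.log_neg ht0 ht1]
      have key := hardyU_pointwise hη p γ θ L ‖x‖ ‖y‖ hp hγ hθ hθ1 hL hx0 hxy
      rw [hγp] at key
      have hFa := hardyF_nonneg ((d:ℝ) - σ) (2 * L) ‖x‖ hx0.le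
      have hFb := hardyF_nonneg ((d:ℝ) - σ) (2 * L) ‖y‖ hb.le
      have h1θ : 0 < 1 - θ := by linarith
      have h1γ : 0 ≤ 1 - (‖x‖ / ‖y‖) ^ γ := by linarith
      have key2 := ENNReal.ofReal_le_ofReal key
      rw [ENNReal.ofReal_add (by positivity) (by positivity), ENNReal.ofReal_mul (by positivity),
        ENNReal.ofReal_mul (by positivity), ENNReal.ofReal_mul (by positivity),
        ENNReal.ofReal_mul (p := (-Real.log (‖x‖ / ‖y‖)) ^ p) (by positivity), ENNReal.ofReal_add hFa hFb] at key2
      have e : ENNReal.ofReal (|u x - u y| ^ p) ≤ c1 * (gA (‖x‖ / ‖y‖) * fu x) +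
        c2 * (gM (‖x‖ / ‖y‖) * (f x + f y)) := by
        rw [hfu]; simp only [hu]; exact key2
      calc _ ≤ (c1 * (gA (‖x‖ / ‖y‖) * fu x) +
        c2 * (gM (‖x‖ / ‖y‖) * (f x + f y))) * hardyK d σ x y := by gcongr
        _ = _ := by ring
    · simp [hxy]
  have hsum : ∫⁻ x, ∫⁻ y, (c1 * T1 x y + (c2 * T2 x y + c2 * T3 x y)) =
      c1 * (hardyJ d σ (σ - 1) gA * N) + (c2 * (hardyJ d σ (σ - 1) gM * S) + c2 * (hardyJ d σ ((d:ℝ) - 1) gM * S)) := by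
    rw [← hI1, ← hI2, ← hI3]
    exact hardy_sum3 T1 T2 T3 hm1 hm2 hm3 c1 c2
  rw [hardy_energy d hd σ p u hum, (HardyConst_eq d hd s p hs hs1 hp hsp).1]
  calc _ ≤ 2 * (c1 * (hardyJ d σ (σ - 1) gA * N) + (c2 * (hardyJ d σ (σ - 1) gM * S) +
        c2 * (hardyJ d σ ((d:ℝ) - 1) gM * S))) := by rw [← hsum]; gcongr
    _ ≤ 2 * (c1 * (hardyJ d σ (σ - 1) gA * N) + (c2 * (hardyJ d σ (σ - 1) gM * (2 * N)) +
        c2 * (hardyJ d σ (σ - 1) gM * (2 * N)))) := by gcongr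
    _ = (c1 * (2 * hardyJ d σ (σ - 1) gA) + 8 * c2 * hardyJ d σ (σ - 1) gM) * N := by ring

open Filter Topology in
lemma hardy_part2 (d : ℕ) (hd : 1 ≤ d) (s p : ℝ) (hs : 0 < s) (hs1 : s < 1) (hp : 1 ≤ p)
    (hsp : s * p < d) (C' : ℝ)
    (h : ∀ u : EuclideanSpace ℝ (Fin d) → ℝ, ContDiff ℝ 1 u → HasCompactSupport u →
        (∫⁻ x, ∫⁻ y, ENNReal.ofReal (|u x - u y| ^ p * ‖x - y‖ ^ (-(d : ℝ) - s * p)))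
          ≥ ENNReal.ofReal C' *
            ∫⁻ x, ENNReal.ofReal (|u x| ^ p * ‖x‖ ^ (-(s * p)))) :
    C' ≤ HardyConst d s p := by
  obtain ⟨η, K, hη⟩ := hardy_cut_exists
  have hK := hη.K_nonneg
  have hp0 : 0 < p := by linarith
  have hC := (HardyConst_eq d hd s p hs hs1 hp hsp).2
  have hMfin : hardyJ d (s * p) (s * p - 1) (fun t => ENNReal.ofReal ((-Real.log t) ^ p)) < ∞ :=
    hardy_M_finite d hd s p hs hs1 hp
  set M := hardyJ d (s * p) (s * p - 1) (fun t => ENNReal.ofReal ((-Real.log t) ^ p)) with hM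
  have hγ : 0 < ((d:ℝ) - s * p) / p := div_pos (by linarith) hp0
  have step : ∀ θ L : ℝ, 0 < θ → θ < 1 → 0 < L →
      C' ≤ (1 - θ) ^ (1 - p) * HardyConst d s p + 8 * (θ ^ (1 - p) * (K / L) ^ p) * M.toReal := by
    intro θ L hθ hθ1 hL
    have h1θ : 0 < 1 - θ := by linarith
    have hcd := hardyU_contDiff hη d (((d:ℝ) - s * p) / p) L hγ hL
    have hcc := hardyU_compact hη d (((d:ℝ) - s * p) / p) L hL
    obtain ⟨k1, k2⟩ := hardy_upper hη d hd s p hs hs1 hp hsp θ L hθ hθ1 hL _ rfl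
    have k3 := hardy_N_finite d hd p (s * p) hp hsp _ hcd.continuous hcc
    have k4 := (h _ hcd hcc).le.trans k1
    have k5 := (ENNReal.mul_le_mul_iff_left k2 k3.ne).1 k4
    rw [← hM, ← ENNReal.ofReal_toReal hMfin.ne, ← ENNReal.ofReal_ofNat 8, ← ENNReal.ofReal_mul (by positivity),
      ← ENNReal.ofReal_mul (by positivity), ← ENNReal.ofReal_mul (by positivity),
      ← ENNReal.ofReal_add (by positivity) (by positivity)] at k5
    exact (ENNReal.ofReal_le_ofReal_iff (by positivity)).1 k5
  have step2 : ∀ θ : ℝ, 0 < θ → θ < 1 → C' ≤ (1 - θ) ^ (1 - p) * HardyConst d s p := by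
    intro θ hθ hθ1
    have t1 : Tendsto (fun L : ℝ => K / L) atTop (𝓝 0) := tendsto_const_nhds.div_atTop tendsto_id
    have t2 : Tendsto (fun L : ℝ => (K / L) ^ p) atTop (𝓝 0) := by
      have := t1.rpow_const (p := p) (Or.inr hp0.le)
      rwa [Real.zero_rpow hp0.ne'] at this
    have t3 : Tendsto (fun L : ℝ => (1 - θ) ^ (1 - p) * HardyConst d s p + 8 * (θ ^ (1 - p) * (K / L) ^ p) * M.toReal)
        atTop (𝓝 ((1 - θ) ^ (1 - p) * HardyConst d s p + 8 * (θ ^ (1 - p) * 0) * M.toReal)) :=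
      tendsto_const_nhds.add (((t2.const_mul _).const_mul _).mul_const _)
    have := ge_of_tendsto t3 (by
      filter_upwards [eventually_gt_atTop 0] with L hL using step θ L hθ hθ1 hL)
    simpa using this
  have t4 : Tendsto (fun θ : ℝ => (1 - θ) ^ (1 - p) * HardyConst d s p) (𝓝[>] 0) (𝓝 ((1 - 0) ^ (1 - p) * HardyConst d s p)) := by
    have t5 : Tendsto (fun θ : ℝ => 1 - θ) (𝓝 0) (𝓝 (1 - 0)) := tendsto_const_nhds.sub tendsto_id
    exact ((t5.rpow_const (Or.inl (by norm_num))).mul_const _).mono_left nhdsWithin_le_nhds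
  have := ge_of_tendsto t4 (by
    filter_upwards [Ioo_mem_nhdsGT (one_pos : (0:ℝ) < 1)] with θ hθ using step2 θ hθ.1 hθ.2)
  simpa using this

theorem sharp_fractional_Hardy (d : ℕ) (hd : 1 ≤ d) (s p : ℝ)
    (hs : 0 < s) (hs1 : s < 1) (hp : 1 ≤ p) (hsp : s * p < d) :
    (∀ u : EuclideanSpace ℝ (Fin d) → ℝ, ContDiff ℝ 1 u → HasCompactSupport u →
      (∫⁻ x, ∫⁻ y, ENNReal.ofReal (|u x - u y| ^ p * ‖x - y‖ ^ (-(d : ℝ) - s * p)))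
        ≥ ENNReal.ofReal (HardyConst d s p) *
          ∫⁻ x, ENNReal.ofReal (|u x| ^ p * ‖x‖ ^ (-(s * p)))) ∧
    (∀ C' : ℝ,
      (∀ u : EuclideanSpace ℝ (Fin d) → ℝ, ContDiff ℝ 1 u → HasCompactSupport u →
        (∫⁻ x, ∫⁻ y, ENNReal.ofReal (|u x - u y| ^ p * ‖x - y‖ ^ (-(d : ℝ) - s * p)))
          ≥ ENNReal.ofReal C' *
            ∫⁻ x, ENNReal.ofReal (|u x| ^ p * ‖x‖ ^ (-(s * p)))) →
      C' ≤ HardyConst d s p) := by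
  exact ⟨fun u hu hc => hardy_part1 d hd s p hs hs1 hp hsp u hu.continuous hc,
    fun C' h => hardy_part2 d hd s p hs hs1 hp hsp C' h⟩
end
end
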